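/- Let L be a finite flag complex and suppose that the embedding dimension of the octahedralization OL is strictly greater than dim L + 2. Then the action dimension of the right-angled Artin group A_L is at most embdim(OL) + 1. -/

import Mathlib

open Finset

/-- An abstract simplicial complex on the vertex type `V`: a collection of nonempty
finite subsets of `V` (the simplices, or faces) closed under passing to nonempty subsets. -/
structure SCplx (V : Type) where
  faces : Set (Finset V)
  down_closed : ∀ ⦃s t : Finset V⦄, s ∈ faces → t ⊆ s → t.Nonempty → t ∈ faces
  nonempty_of_mem : ∀ ⦃s : Finset V⦄, s ∈ faces → s.Nonempty

variable {V : Type}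

/-- `L` is a `k`-dimensional complex: every simplex has at most `k+1` vertices and
some simplex has exactly `k+1` vertices. -/
def IsDimOf (L : SCplx V) (k : ℕ) : Prop :=
  (∀ s ∈ L.faces, s.card ≤ k + 1) ∧ ∃ s ∈ L.faces, s.card = k + 1

variable [DecidableEq V] in
/-- A flag complex: every nonempty set of pairwise adjacent vertices spans a simplex. -/
def IsFlag (L : SCplx V) : Prop :=
  ∀ s : Finset V, s.Nonempty →
    (∀ u ∈ s, ∀ w ∈ s, ({u, w} : Finset V) ∈ L.faces) → s ∈ L.faces

section Oct

variable [DecidableEq V]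

/-- The projection `OL → L` on simplices, induced by `V × {±1} → V`
(`Bool` plays the role of `{±1}`, with `false` the minus sign). -/
def pface (s : Finset (V × Bool)) : Finset V := s.image Prod.fst

/-- The octahedralization `OL` of `L`: vertices are doubled, and a set of doubled
vertices spans a simplex iff its first coordinates are distinct and span a simplex of `L`. -/
def oct (L : SCplx V) : SCplx (V × Bool) where
  faces := {s | pface s ∈ L.faces ∧ (pface s).card = s.card}
  down_closed := by
    rintro s t ⟨hf, hc⟩ hts hne
    refine ⟨L.down_closed hf (Finset.image_subset_image hts) ?_, ?_⟩
    · obtain ⟨x, hx⟩ := hne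
      exact ⟨x.1, Finset.mem_image_of_mem _ hx⟩
    · rw [pface, Finset.card_image_iff] at hc ⊢
      exact hc.mono (Finset.coe_subset.mpr hts)
  nonempty_of_mem := by
    rintro s ⟨hf, hc⟩
    by_contra h
    rw [Finset.not_nonempty_iff_eq_empty] at h
    subst h
    simp [pface] at hf
    exact absurd (L.nonempty_of_mem hf) (by simp)

/-- The full subcomplex of `K` on a set `A` of vertices. -/
def fullSub (K : SCplx V) (A : Finset V) : SCplx V where
  faces := {s | s ∈ K.faces ∧ s ⊆ A}
  down_closed := by
    rintro s t ⟨hs, hA⟩ hts ht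
    exact ⟨K.down_closed hs hts ht, hts.trans hA⟩
  nonempty_of_mem := by
    rintro s ⟨hs, -⟩
    exact K.nonempty_of_mem hs

/-- The link of a simplex `σ` in `L`. -/
def scLink (L : SCplx V) (σ : Finset V) : SCplx V where
  faces := {τ | Disjoint σ τ ∧ σ ∪ τ ∈ L.faces ∧ τ.Nonempty}
  down_closed := by
    rintro s t ⟨hd, hf, -⟩ hts ht
    refine ⟨hd.mono_right hts, L.down_closed hf (Finset.union_subset_union (subset_refl σ) hts) ?_, ht⟩
    obtain ⟨x, hx⟩ := ht
    exact ⟨x, Finset.mem_union_right _ hx⟩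
  nonempty_of_mem := by
    rintro s ⟨-, -, h⟩
    exact h

/-- The closed star of a simplex `σ` in `L`; one has `St(σ) = Lk(σ) * σ`. -/
def scStar (L : SCplx V) (σ : Finset V) : SCplx V where
  faces := {τ | τ.Nonempty ∧ σ ∪ τ ∈ L.faces}
  down_closed := by
    rintro s t ⟨-, hf⟩ hts ht
    refine ⟨ht, L.down_closed hf (Finset.union_subset_union (subset_refl σ) hts) ?_⟩
    obtain ⟨x, hx⟩ := ht
    exact ⟨x, Finset.mem_union_right _ hx⟩
  nonempty_of_mem := by
    rintro s ⟨h, -⟩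
    exact h

end Oct

/-- The simplicial join of two complexes. -/
def scJoin {V₁ V₂ : Type} [DecidableEq V₁] [DecidableEq V₂]
    (K₁ : SCplx V₁) (K₂ : SCplx V₂) : SCplx (V₁ ⊕ V₂) where
  faces := {s | s.Nonempty ∧ ∃ (s₁ : Finset V₁) (s₂ : Finset V₂),
    s = s₁.image Sum.inl ∪ s₂.image Sum.inr ∧
    (s₁ = ∅ ∨ s₁ ∈ K₁.faces) ∧ (s₂ = ∅ ∨ s₂ ∈ K₂.faces)}
  down_closed := by
    rintro s t ⟨hne, s₁, s₂, rfl, h₁, h₂⟩ hts htne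
    refine ⟨htne, s₁.filter (fun v => Sum.inl v ∈ t), s₂.filter (fun v => Sum.inr v ∈ t),
      ?_, ?_, ?_⟩
    · ext x
      simp only [Finset.mem_union, Finset.mem_image, Finset.mem_filter]
      constructor
      · intro hx
        have hx' := hts hx
        simp only [Finset.mem_union, Finset.mem_image] at hx'
        rcases hx' with ⟨v, hv, rfl⟩ | ⟨v, hv, rfl⟩
        · exact Or.inl ⟨v, ⟨hv, hx⟩, rfl⟩
        · exact Or.inr ⟨v, ⟨hv, hx⟩, rfl⟩
      · rintro (⟨v, ⟨hv, hvt⟩, rfl⟩ | ⟨v, ⟨hv, hvt⟩, rfl⟩) <;> assumption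
    · by_cases h : s₁.filter (fun v => Sum.inl v ∈ t) = ∅
      · exact Or.inl h
      · right
        rcases h₁ with rfl | h₁
        · simp at h
        · exact K₁.down_closed h₁ (Finset.filter_subset _ _)
            (Finset.nonempty_iff_ne_empty.mpr h)
    · by_cases h : s₂.filter (fun v => Sum.inr v ∈ t) = ∅
      · exact Or.inl h
      · right
        rcases h₂ with rfl | h₂
        · simp at h
        · exact K₂.down_closed h₂ (Finset.filter_subset _ _)
            (Finset.nonempty_iff_ne_empty.mpr h)
  nonempty_of_mem := by
    rintro s ⟨h, -⟩
    exact h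

/-! ### Right-angled Artin groups -/

/-- The standard commutator relators of the right-angled Artin group on the 1-skeleton of `L`. -/
def raagRels [DecidableEq V] (L : SCplx V) : Set (FreeGroup V) :=
  {r | ∃ u w : V, u ≠ w ∧ ({u, w} : Finset V) ∈ L.faces ∧
    r = FreeGroup.of u * FreeGroup.of w * (FreeGroup.of u)⁻¹ * (FreeGroup.of w)⁻¹}

/-- The right-angled Artin group `A_L` associated to a flag complex `L`:
one generator for each vertex, with commuting relations along the edges of `L`. -/
def RAAG [DecidableEq V] (L : SCplx V) : Type := PresentedGroup (raagRels L)

instance [DecidableEq V] (L : SCplx V) : Group (RAAG L) :=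
  inferInstanceAs (Group (PresentedGroup (raagRels L)))

/-! ### Geometric realization -/

/-- The standard basis vertex placement for the geometric realization. -/
def stdVert [DecidableEq V] (v : V) : V → ℝ := fun w => if w = v then 1 else 0

/-- The geometric realization of an abstract simplicial complex, inside `V → ℝ`. -/
def realization [DecidableEq V] (L : SCplx V) : Set (V → ℝ) :=
  ⋃ s ∈ L.faces, convexHull ℝ (stdVert '' (s : Set V))

/-! ### Action dimension and geometric dimension -/

/-- The action dimension of a group `Γ`: the least dimension of a contractible
(topological) manifold admitting a proper (i.e. properly discontinuous, by
homeomorphisms) `Γ`-action; `⊤` if there is no such manifold. -/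
noncomputable def actdim (Γ : Type) [Group Γ] : ℕ∞ :=
  sInf {n : ℕ∞ | ∃ m : ℕ, n = (m : ℕ∞) ∧
    ∃ (M : Type) (_ : TopologicalSpace M) (_ : T2Space M)
      (_ : ChartedSpace (EuclideanSpace ℝ (Fin m)) M) (ρ : Γ →* Equiv.Perm M),
      ContractibleSpace M ∧ (∀ γ : Γ, Continuous (⇑(ρ γ) : M → M)) ∧
      ∀ K L : Set M, IsCompact K → IsCompact L →
        {γ : Γ | ((⇑(ρ γ) : M → M) '' K ∩ L).Nonempty}.Finite}

/-- The geometric dimension of a group `Γ`: the least dimension of a (simplicial) model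
for the classifying space `BΓ`, i.e. the least `m` such that `Γ` acts freely simplicially on
an `m`-dimensional contractible simplicial complex; `⊤` if there is no finite-dimensional
model. -/
noncomputable def gd (Γ : Type) [Group Γ] : ℕ∞ :=
  sInf {n : ℕ∞ | ∃ m : ℕ, n = (m : ℕ∞) ∧
    ∃ (W : Type) (_ : DecidableEq W) (X : SCplx W) (ρ : Γ →* Equiv.Perm W),
      (∀ (γ : Γ), ∀ s ∈ X.faces, s.image (ρ γ) ∈ X.faces) ∧
      (∀ (γ : Γ), γ ≠ 1 → ∀ s ∈ X.faces, s.image (ρ γ) ≠ s) ∧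
      (∀ s ∈ X.faces, s.card ≤ m + 1) ∧
      ContractibleSpace (realization X)}

/-! ### PL embeddings and embedding dimension -/

/-- A compact polyhedron in a real vector space: a finite union of polytopes. -/
def IsCompactPolyhedron {E : Type*} [AddCommGroup E] [Module ℝ E] (S : Set E) : Prop :=
  ∃ F : Finset (Finset E), S = ⋃ t ∈ F, convexHull ℝ (t : Set E)

/-- A piecewise linear embedding of the compact polyhedron `P` into `Q`: an injective
map `P → Q` whose graph is a compact polyhedron. -/
def HasPLEmbedding {E₁ E₂ : Type*} [AddCommGroup E₁] [Module ℝ E₁]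
    [AddCommGroup E₂] [Module ℝ E₂] (P : Set E₁) (Q : Set E₂) : Prop :=
  ∃ f : E₁ → E₂, Set.InjOn f P ∧ f '' P ⊆ Q ∧
    IsCompactPolyhedron {p : E₁ × E₂ | p.1 ∈ P ∧ p.2 = f p.1}

/-- The boundary complex of the `(m+1)`-simplex, a standard PL `m`-sphere. -/
def sphereCplx (m : ℕ) : SCplx (Fin (m + 2)) where
  faces := {s | s.Nonempty ∧ s ≠ Finset.univ}
  down_closed := by
    rintro s t ⟨-, hs⟩ hts ht
    refine ⟨ht, fun h => hs ?_⟩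
    exact Finset.univ_subset_iff.mp (h ▸ hts)
  nonempty_of_mem := fun _ h => h.1

/-- `K` embeds piecewise linearly in the sphere `S^m`. -/
def PLEmbedsInSphere [DecidableEq V] (K : SCplx V) (m : ℕ) : Prop :=
  HasPLEmbedding (realization K) (realization (sphereCplx m))

/-- The embedding dimension of `K`: the least `m` such that `K` piecewise linearly
embeds in `S^m`. -/
noncomputable def embdim [DecidableEq V] (K : SCplx V) : ℕ :=
  sInf {m | PLEmbedsInSphere K m}

/-! ### Simplicial chains and homology mod 2 -/

/-- A simplicial `k`-chain with `ℤ/2` coefficients on `L`, recorded as its coefficient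
function on finite vertex sets: it is supported on the `k`-simplices of `L`. -/
def IsChainOn (L : SCplx V) (k : ℕ) (c : Finset V → ZMod 2) : Prop :=
  ∀ s, c s ≠ 0 → s ∈ L.faces ∧ s.card = k + 1

/-- The mod 2 simplicial boundary operator (the coefficient of `∂c` on `t` is the sum
of the coefficients of `c` over the cofaces of `t`). -/
noncomputable def bd2 [Fintype V] [DecidableEq V] (c : Finset V → ZMod 2) :
    Finset V → ZMod 2 :=
  fun t => ∑ x ∈ tᶜ, c (insert x t)

/-- `c` is a mod 2 simplicial `k`-cycle on `L`. -/
def IsCycleOn [Fintype V] [DecidableEq V] (L : SCplx V) (k : ℕ)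
    (c : Finset V → ZMod 2) : Prop :=
  IsChainOn L k c ∧ ∀ t : Finset V, t.Nonempty → bd2 c t = 0

/-- `H_k(L; ℤ/2) ≠ 0`: there is a mod 2 `k`-cycle which is not a boundary. -/
def ModTwoHomologyNonzero [Fintype V] [DecidableEq V] (L : SCplx V) (k : ℕ) : Prop :=
  ∃ c, IsCycleOn L k c ∧ ¬∃ d, IsChainOn L (k + 1) d ∧ bd2 d = c

/-! ### The van Kampen obstruction -/

/-- An (ordered) cell `σ × τ` of the simplicial deleted product of `K`. -/
def IsCell {W : Type} (K : SCplx W) (σ τ : Finset W) : Prop :=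
  σ ∈ K.faces ∧ τ ∈ K.faces ∧ Disjoint σ τ

/-- An equivariant, augmentation-preserving chain map (mod 2) from the cellular chains of the
simplicial deleted product of `K` to the standard free resolution `W_*` of `ℤ/2` over
`ℤ/2[ℤ/2]` (the cellular chains of `S^∞ = EZ/2`); such a map classifies the free involution.
The value on a cell `(σ,τ)` is the pair of coefficients of `e_n` and `Te_n`, `n = dim σ×τ`. -/
structure VKMap {W : Type} [DecidableEq W] (K : SCplx W) where
  f : Finset W × Finset W → ZMod 2 × ZMod 2
  supp : ∀ p : Finset W × Finset W, ¬ IsCell K p.1 p.2 → f p = 0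
  symm : ∀ σ τ : Finset W, f (τ, σ) = (f (σ, τ)).swap
  aug : ∀ v w : W, IsCell K {v} {w} → (f ({v}, {w})).1 + (f ({v}, {w})).2 = 1
  chain : ∀ σ τ : Finset W, IsCell K σ τ → 3 ≤ σ.card + τ.card →
    ((∑ x ∈ σ, f (σ.erase x, τ)) + (∑ x ∈ τ, f (σ, τ.erase x))) =
      ((f (σ, τ)).1 + (f (σ, τ)).2, (f (σ, τ)).1 + (f (σ, τ)).2)

/-- The pullback under `Φ` of the standard cocycle representing `w_1^m` on `RP^∞` is a
coboundary in the complex of symmetric (= `ℤ/2`-equivariant) cochains on the deleted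
product, i.e. the class `vk^m_{ℤ/2}(K) = c^*(w_1^m) ∈ H^m(C(K); ℤ/2)` vanishes. -/
def vkClassVanishes {W : Type} [DecidableEq W] (K : SCplx W) (Φ : VKMap K) (m : ℕ) : Prop :=
  ∃ η : Finset W × Finset W → ZMod 2,
    (∀ p : Finset W × Finset W, ¬ IsCell K p.1 p.2 → η p = 0) ∧
    (∀ σ τ : Finset W, η (τ, σ) = η (σ, τ)) ∧
    ∀ σ τ : Finset W, IsCell K σ τ → σ.card + τ.card = m + 2 →
      ((∑ x ∈ σ, η (σ.erase x, τ)) + (∑ x ∈ τ, η (σ, τ.erase x))) =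
        (Φ.f (σ, τ)).1 + (Φ.f (σ, τ)).2

/-- Nonvanishing of the mod 2 van Kampen obstruction
`vk^m_{ℤ/2}(K) = c^*(w_1^m) ∈ H^m(C(K); ℤ/2)`. -/
def vkModTwoNonzero {W : Type} [DecidableEq W] (K : SCplx W) (m : ℕ) : Prop :=
  ∃ Φ : VKMap K, ¬ vkClassVanishes K Φ m

/-- The van Kampen dimension of `K`: the largest `m` with `vk^m_{ℤ/2}(K) ≠ 0`
(with the usual conventions `vkdim ∅ = -2` and `vkdim(point) = -1`). -/
noncomputable def vkdim {W : Type} [DecidableEq W] (K : SCplx W) : ℤ :=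
  sSup ({-2} ∪ {m : ℤ | (m = -1 ∧ K.faces.Nonempty) ∨
    ∃ n : ℕ, m = (n : ℤ) ∧ vkModTwoNonzero K n})

/-! ### The integral van Kampen obstruction -/

open Classical in
/-- The sign `(-1)^i` where `i` is the position of `x` in the simplex `σ` ordered by `lt`. -/
noncomputable def osign' {W : Type} (lt : W → W → Prop) (σ : Finset W) (x : W) : ℤ :=
  (-1) ^ (σ.filter (fun y => lt y x)).card

/-- An equivariant, augmentation-preserving integral chain map from the cellular chains of
the simplicial deleted product of `K` (cells oriented by the order `lt`, the involution acting
with the sign `(-1)^{dim σ · dim τ}`) to the standard free resolution `W_*` of `ℤ` over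
`ℤ[ℤ/2]` (with `∂e_n = e_{n-1} + (-1)^n Te_{n-1}`). -/
structure VKMapZ {W : Type} [DecidableEq W] (K : SCplx W) (lt : W → W → Prop) where
  f : Finset W × Finset W → ℤ × ℤ
  supp : ∀ p : Finset W × Finset W, ¬ IsCell K p.1 p.2 → f p = 0
  symm : ∀ σ τ : Finset W,
    f (τ, σ) = ((-1 : ℤ) ^ ((σ.card - 1) * (τ.card - 1))) • (f (σ, τ)).swap
  aug : ∀ v w : W, IsCell K {v} {w} → (f ({v}, {w})).1 + (f ({v}, {w})).2 = 1
  chain : ∀ σ τ : Finset W, IsCell K σ τ → 3 ≤ σ.card + τ.card →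
    ((∑ x ∈ σ, osign' lt σ x • f (σ.erase x, τ)) +
      ((-1 : ℤ) ^ (σ.card - 1)) • ∑ x ∈ τ, osign' lt τ x • f (σ, τ.erase x)) =
      ((f (σ, τ)).1 + (-1 : ℤ) ^ (σ.card + τ.card) * (f (σ, τ)).2,
       (-1 : ℤ) ^ (σ.card + τ.card) * (f (σ, τ)).1 + (f (σ, τ)).2)

/-- The integral van Kampen class `vk^m(K) = c^*(e_1^m) ∈ H^m(C(K); ℤ)` (in even degree `m`)
vanishes: the pullback under `Φ` of the standard invariant cocycle generating
`H^m(RP^∞;ℤ)` is a coboundary of an invariant integral cochain. -/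
def vkZClassVanishes {W : Type} [DecidableEq W] (K : SCplx W) (lt : W → W → Prop)
    (Φ : VKMapZ K lt) (m : ℕ) : Prop :=
  ∃ η : Finset W × Finset W → ℤ,
    (∀ p : Finset W × Finset W, ¬ IsCell K p.1 p.2 → η p = 0) ∧
    (∀ σ τ : Finset W, η (τ, σ) = ((-1 : ℤ) ^ ((σ.card - 1) * (τ.card - 1))) * η (σ, τ)) ∧
    ∀ σ τ : Finset W, IsCell K σ τ → σ.card + τ.card = m + 2 →
      ((∑ x ∈ σ, osign' lt σ x * η (σ.erase x, τ)) +
        ((-1 : ℤ) ^ (σ.card - 1)) * ∑ x ∈ τ, osign' lt τ x * η (σ, τ.erase x)) =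
        (Φ.f (σ, τ)).1 + (Φ.f (σ, τ)).2

/-- Nonvanishing of the integral van Kampen obstruction `vk^m(K) ∈ H^m(C(K); ℤ)`
(`m` even). -/
def vkZNonzero {W : Type} [DecidableEq W] (K : SCplx W) (lt : W → W → Prop) (m : ℕ) : Prop :=
  ∃ Φ : VKMapZ K lt, ¬ vkZClassVanishes K lt Φ m

/-! ### Orders and meshing -/

/-- The order on the doubled vertices `V × {±1}`: `v⁻ < v⁺ < w⁻ < w⁺ < ⋯` for `v < w`
(`false` is the minus sign). -/
def olt [LT V] (a b : V × Bool) : Prop :=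
  a.1 < b.1 ∨ (a.1 = b.1 ∧ a.2 = false ∧ b.2 = true)

/-- The reflexive closure of `olt`. -/
def ole [LT V] (a b : V × Bool) : Prop := olt a b ∨ a = b

/-- `Meshed r s [v₀,…,v_k] [w₀,…,w_k]` says `r v₀ w₀`, `s w₀ v₁`, `r v₁ w₁`, `s w₁ v₂`, … ,
`r v_k w_k`, i.e. the two vertex lists alternate with respect to the relations `r`, `s`. -/
def Meshed {α : Type*} (r s : α → α → Prop) : List α → List α → Prop
  | [a], [b] => r a b
  | a :: a' :: l₁, b :: l₂ => r a b ∧ s b a' ∧ Meshed r s (a' :: l₁) l₂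
  | _, _ => False

/-- `l` is the enumeration of the finite set `σ` in increasing order w.r.t. `r`. -/
def SListOf {α : Type*} [DecidableEq α] (r : α → α → Prop) (l : List α) (σ : Finset α) : Prop :=
  l.toFinset = σ ∧ l.Chain' r

open Classical in
/-- The standard integral cocycle `ν` representing the top-degree van Kampen obstruction:
on an oriented cell `[σ,τ]` of `C(OL)` (simplices oriented by increasing vertex order)
it is `1` if `σ,τ` mesh, `(-1)^k` if `τ,σ` mesh, `0` otherwise. -/
noncomputable def nuVal [LinearOrder V] (k : ℕ) (σ τ : Finset (V × Bool)) : ℤ :=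
  if ∃ l₁ l₂ : List (V × Bool), SListOf olt l₁ σ ∧ SListOf olt l₂ τ ∧ Meshed olt olt l₁ l₂
  then 1
  else if ∃ l₁ l₂ : List (V × Bool), SListOf olt l₁ σ ∧ SListOf olt l₂ τ ∧ Meshed olt olt l₂ l₁
  then (-1) ^ k
  else 0

open Classical in
/-- The cocycle `μ ∈ Z^{2k}(OL × L; ℤ)`: its value on a cell `(σ, b)` is `1` if
`σ` meshes nonstrictly with the minus-copy `b⁻` of `b` (that is,
`v₀ ≤ w₀⁻ < v₁ ≤ w₁⁻ < ⋯ ≤ w_k⁻`), and `0` otherwise. -/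
noncomputable def muVal [LinearOrder V] (σ : Finset (V × Bool)) (b : Finset V) : ℤ :=
  if ∃ (l₁ : List (V × Bool)) (l₂ : List V), SListOf olt l₁ σ ∧
      l₂.toFinset = b ∧ l₂.Chain' (· < ·) ∧
      Meshed ole olt l₁ (l₂.map (fun w => (w, false)))
  then 1 else 0

/-! ### The chains `Ω`, `s_*`, and `OΔ × M` -/

open Classical in
/-- The vertices of (the support of) a mod 2 cycle `M`. -/
noncomputable def cycVerts [Fintype V] [DecidableEq V] (M : Finset V → ZMod 2) : Finset V :=
  Finset.univ.filter (fun v => ∃ s, M s ≠ 0 ∧ v ∈ s)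

/-- The vertex set `M⁻ ∪ {v₀^±, …, v_k^±}` of `D`, the complex `M` doubled over `Δ`. -/
noncomputable def doubledVerts [Fintype V] [DecidableEq V] (M : Finset V → ZMod 2)
    (Δ : Finset V) : Finset (V × Bool) :=
  (cycVerts M).image (fun v => (v, false)) ∪ Δ.image (fun v => (v, false)) ∪
    Δ.image (fun v => (v, true))

open Classical in
/-- The mod 2 chain `Ω ∈ C_{2k}(C(D); ℤ/2)` (as a symmetric function on ordered pairs):
a `2k`-cell `[σ,τ]` of `C(D)` lies in `Ω` iff `σ ∩ τ = ∅` and `Δ⁰ ⊆ p(σ) ∪ p(τ)`. -/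
noncomputable def OmegaChain [DecidableEq V] (D : SCplx (V × Bool)) (Δ : Finset V) (k : ℕ) :
    Finset (V × Bool) × Finset (V × Bool) → ZMod 2 :=
  fun p => if IsCell D p.1 p.2 ∧ p.1.card + p.2.card = 2 * k + 2 ∧
      Δ ⊆ pface p.1 ∪ pface p.2 then 1 else 0

open Classical in
/-- The pushforward under the chain map
`s : C_*(C(OL)) → C_*(OL × L)`, `[σ,τ] ↦ (σ, p(τ)) + (τ, p(σ))` (mod 2), of a mod 2 chain on
`C(OL)` given as a symmetric function on ordered pairs. -/
noncomputable def pushS [Fintype V] [DecidableEq V]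
    (c : Finset (V × Bool) × Finset (V × Bool) → ZMod 2) :
    Finset (V × Bool) × Finset V → ZMod 2 :=
  fun q => ∑ τ : Finset (V × Bool), if pface τ = q.2 then c (q.1, τ) else 0

open Classical in
/-- The mod 2 chain `OΔ × M ∈ C_{2k}(OL × L; ℤ/2)`. -/
noncomputable def chODeltaM [DecidableEq V] (Δ : Finset V) (M : Finset V → ZMod 2) (k : ℕ) :
    Finset (V × Bool) × Finset V → ZMod 2 :=
  fun q => if pface q.1 = Δ ∧ q.1.card = k + 1 then M q.2 else 0

/-- The mod 2 cellular boundary operator on chains of the configuration space `C(D)`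
(symmetric functions on ordered pairs): `∂(σ × τ) = ∂σ × τ + σ × ∂τ`. -/
noncomputable def cBd2 [Fintype V] [DecidableEq V]
    (c : Finset (V × Bool) × Finset (V × Bool) → ZMod 2) :
    Finset (V × Bool) × Finset (V × Bool) → ZMod 2 :=
  fun p => (∑ x ∈ p.1ᶜ, c (insert x p.1, p.2)) + (∑ x ∈ p.2ᶜ, c (p.1, insert x p.2))

/-- The `*`-condition for `(M, Δ)`: for all simplices `σ, τ` of `M` with
`Δ⁰ ⊆ σ ∪ τ` one has `σ ∩ τ ⊆ Δ`. -/
def StarCond [DecidableEq V] (M : Finset V → ZMod 2) (Δ : Finset V) : Prop :=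
  ∀ σ τ : Finset V, M σ ≠ 0 → M τ ≠ 0 → Δ ⊆ σ ∪ τ → σ ∩ τ ⊆ Δ

/-! ### Rational (reduced) simplicial homology -/

/-- The augmented rational simplicial boundary operator, on coefficient functions
`Finset V → ℚ` (the empty set plays the role of the `(-1)`-simplex, so this computes
reduced homology). -/
noncomputable def bdQ [Fintype V] [DecidableEq V] [LinearOrder V] :
    (Finset V → ℚ) →ₗ[ℚ] (Finset V → ℚ) where
  toFun c := fun t => ∑ x ∈ tᶜ, ((-1 : ℚ) ^ (t.filter (· < x)).card) * c (insert x t)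
  map_add' a b := by
    funext t
    simp [mul_add, Finset.sum_add_distrib]
  map_smul' r a := by
    funext t
    simp only [RingHom.id_apply, Pi.smul_apply, smul_eq_mul]
    rw [Finset.mul_sum]
    exact Finset.sum_congr rfl (fun x _ => by ring)

/-- The submodule of rational `k`-chains on `L`. -/
def chainsQ (L : SCplx V) (k : ℕ) : Submodule ℚ (Finset V → ℚ) where
  carrier := {c | ∀ s, c s ≠ 0 → s ∈ L.faces ∧ s.card = k + 1}
  add_mem' := by
    intro a b ha hb s hs
    by_cases h1 : a s = 0
    · by_cases h2 : b s = 0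
      · exact absurd (by simp [h1, h2]) hs
      · exact hb s h2
    · exact ha s h1
  zero_mem' := by intro s hs; simp at hs
  smul_mem' := by
    intro r a ha s hs
    refine ha s (fun h => hs ?_)
    simp [h]

/-- The reduced rational Betti number `b̄_k(L) = dim_ℚ H̃_k(L; ℚ)`. -/
noncomputable def redBetti [Fintype V] [DecidableEq V] [LinearOrder V]
    (L : SCplx V) (k : ℕ) : ℕ :=
  Module.finrank ℚ
    ((chainsQ L k ⊓ LinearMap.ker bdQ : Submodule ℚ (Finset V → ℚ)) ⧸
      (Submodule.comap (chainsQ L k ⊓ LinearMap.ker bdQ).subtype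
        (Submodule.map bdQ (chainsQ L (k + 1)))))

/-! ### Integral simplicial cohomology in the top degree -/

open Classical in
/-- The integral simplicial coboundary operator into degree `k` cochains on `L`. -/
noncomputable def cobOn [Fintype V] [DecidableEq V] [LinearOrder V] (L : SCplx V) (k : ℕ) :
    (Finset V → ℤ) →ₗ[ℤ] (Finset V → ℤ) where
  toFun φ := fun s => if s ∈ L.faces ∧ s.card = k + 1 then
      ∑ x ∈ s, ((-1 : ℤ) ^ (s.filter (· < x)).card) * φ (s.erase x) else 0
  map_add' a b := by
    funext s
    by_cases h : s ∈ L.faces ∧ s.card = k + 1 <;>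
      simp [h, mul_add, Finset.sum_add_distrib]
  map_smul' r a := by
    funext s
    simp only [RingHom.id_apply, Pi.smul_apply, smul_eq_mul]
    by_cases h : s ∈ L.faces ∧ s.card = k + 1
    · rw [if_pos h, if_pos h, Finset.mul_sum]
      exact Finset.sum_congr rfl (fun x _ => by ring)
    · rw [if_neg h, if_neg h, mul_zero]

/-- The submodule of integral `k`-cochains on `L` (functions supported on `k`-simplices). -/
def cochainsZ (L : SCplx V) (k : ℕ) : Submodule ℤ (Finset V → ℤ) where
  carrier := {c | ∀ s, c s ≠ 0 → s ∈ L.faces ∧ s.card = k + 1}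
  add_mem' := by
    intro a b ha hb s hs
    by_cases h1 : a s = 0
    · by_cases h2 : b s = 0
      · exact absurd (by simp [h1, h2]) hs
      · exact hb s h2
    · exact ha s h1
  zero_mem' := by intro s hs; simp at hs
  smul_mem' := by
    intro r a ha s hs
    refine ha s (fun h => hs ?_)
    simp [h]

open Classical in
/-- The submodule of integral `k`-coboundaries on `L`. -/
noncomputable def cobndZ [Fintype V] [DecidableEq V] [LinearOrder V]
    (L : SCplx V) (k : ℕ) : Submodule ℤ (Finset V → ℤ) :=
  if k = 0 then ⊥ else Submodule.map (cobOn L k) (cochainsZ L (k - 1))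

/-- The top-degree integral simplicial cohomology `H^k(L; ℤ)` (for `k = dim L` every
`k`-cochain is a cocycle). -/
noncomputable def topCohomologyZ [Fintype V] [DecidableEq V] [LinearOrder V]
    (L : SCplx V) (k : ℕ) :=
  (cochainsZ L k) ⧸ (Submodule.comap (cochainsZ L k).subtype (cobndZ L k))

noncomputable instance [Fintype V] [DecidableEq V] [LinearOrder V] (L : SCplx V) (k : ℕ) :
    AddCommGroup (topCohomologyZ L k) :=
  inferInstanceAs (AddCommGroup ((cochainsZ L k) ⧸
    (Submodule.comap (cochainsZ L k).subtype (cobndZ L k))))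

/-- A space is aspherical if it admits a contractible covering space. -/
def IsAspherical (X : Type) [TopologicalSpace X] : Prop :=
  ∃ (Y : Type) (_ : TopologicalSpace Y) (f : Y → X), IsCoveringMap f ∧ ContractibleSpace Y

/-! ### Right-angled Coxeter groups via pilings -/
namespace RAM

section Pilings

variable {S : Type} (adj : S → S → Prop)

open Classical in
noncomputable def push (s : S) (p : S → List Bool) : S → List Bool :=
  fun t => if t = s then true :: p t else if adj s t then p t else false :: p t

open Classical in
noncomputable def pop (s : S) (p : S → List Bool) : S → List Bool :=
  fun t => if t = s then (p t).tail else if adj s t then p t else (p t).tail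

def hd (s : S) (p : S → List Bool) : Prop := (p s).head? = some true

inductive Reach : (S → List Bool) → Prop
  | nil : Reach (fun _ => [])
  | push {p : S → List Bool} (s : S) : Reach p → ¬ hd s p → Reach (push adj s p)

variable {adj}

theorem hd_push_self (s : S) (p : S → List Bool) : hd s (push adj s p) := by
  simp [hd, push]

theorem hd_push_adj {s u : S} (h : adj u s) (hsu : s ≠ u) (p : S → List Bool) :
    hd s (push adj u p) ↔ hd s p := by
  simp [hd, push, h, hsu]

theorem hd_pop_adj {s u : S} (h : adj u s) (hsu : s ≠ u) (p : S → List Bool) :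
    hd s (pop adj u p) ↔ hd s p := by
  simp [hd, pop, h, hsu]

theorem not_hd_push {s u : S} (h : ¬ adj u s) (hsu : s ≠ u) (p : S → List Bool) :
    ¬ hd s (push adj u p) := by
  simp [hd, push, h, hsu]

theorem pop_push (s : S) (p : S → List Bool) : pop adj s (push adj s p) = p := by
  funext t
  simp only [pop, push]
  split_ifs <;> simp

def Inv (adj : S → S → Prop) (p : S → List Bool) : Prop :=
  ∀ s t, hd s p → ¬ adj s t → t ≠ s → (p t).head? = some false

theorem head_tail {l : List Bool} {b : Bool} (h : l.head? = some b) : b :: l.tail = l := by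
  cases l with
  | nil => simp at h
  | cons a l => simp at h; simp [h]

theorem push_pop {s : S} {p : S → List Bool} (hi : Inv adj p) (h : hd s p) :
    push adj s (pop adj s p) = p := by
  funext t
  simp only [pop, push]
  split_ifs with h1 h2
  · subst h1; exact head_tail h
  · rfl
  · exact head_tail (hi s t h h2 h1)

variable (hsymm : ∀ s t, adj s t → adj t s)

include hsymm in
theorem Reach.inv {p : S → List Bool} (hp : Reach adj p) : Inv adj p := by
  induction hp with
  | nil => intro s t h; simp [hd] at h
  | @push q u hq hu ih =>
    intro s t h hst hts
    by_cases hsu : s = u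
    · subst hsu; simp [RAM.push, hst, hts]
    · have ha : adj u s := by
        by_contra hn; exact not_hd_push hn hsu q h
      rw [hd_push_adj ha hsu] at h
      have := ih s t h hst hts
      have htu : t ≠ u := by rintro rfl; exact hst (hsymm _ _ ha)
      simp only [RAM.push, htu, if_false]
      split_ifs
      · exact this
      · rfl

include hsymm in
theorem pop_push_comm {s u : S} (h : adj u s) (hsu : s ≠ u) {p : S → List Bool}
    (hi : Inv adj p) (hs : hd s p) : pop adj s (push adj u p) = push adj u (pop adj s p) := by
  have h' := hsymm _ _ h
  funext t
  simp only [pop, push]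
  by_cases h1 : t = s
  · subst h1; simp [h, hsu]
  · by_cases h2 : t = u
    · subst h2; simp [h', h1]
    · by_cases h3 : adj s t
      · simp [h1, h2, h3]
      · by_cases h4 : adj u t
        · simp [h1, h2, h3, h4]
        · simp [h1, h2, h3, h4, head_tail (hi s t hs h3 h1)]

theorem push_comm {s u : S} (h : adj u s) (h' : adj s u) (p : S → List Bool) :
    push adj s (push adj u p) = push adj u (push adj s p) := by
  funext t
  simp only [push]
  by_cases h1 : t = s
  · subst h1; by_cases h2 : t = u
    · subst h2; rfl
    · simp [h, h2]
  · by_cases h2 : t = u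
    · subst h2; simp [h', h1]
    · by_cases h3 : adj s t <;> by_cases h4 : adj u t <;> simp [h1, h2, h3, h4]

theorem pop_comm {s u : S} (h : adj u s) (h' : adj s u) (p : S → List Bool) :
    pop adj s (pop adj u p) = pop adj u (pop adj s p) := by
  funext t
  simp only [pop]
  by_cases h1 : t = s
  · subst h1; by_cases h2 : t = u
    · subst h2; rfl
    · simp [h, h2]
  · by_cases h2 : t = u
    · subst h2; simp [h', h1]
    · by_cases h3 : adj s t <;> by_cases h4 : adj u t <;> simp [h1, h2, h3, h4]

include hsymm in
theorem Reach.pop {p : S → List Bool} (hp : Reach adj p) {s : S} (hs : hd s p) :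
    Reach adj (pop adj s p) ∧ ¬ hd s (RAM.pop adj s p) := by
  induction hp with
  | nil => simp [hd] at hs
  | @push q u hq hu ih =>
    by_cases hsu : s = u
    · subst hsu; rw [pop_push]; exact ⟨hq, hu⟩
    · have ha : adj u s := by
        by_contra hn; exact not_hd_push hn hsu q hs
      rw [hd_push_adj ha hsu] at hs
      rw [pop_push_comm hsymm ha hsu (hq.inv hsymm) hs, hd_push_adj ha hsu]
      exact ⟨Reach.push u (ih hs).1 (by rwa [hd_pop_adj (hsymm _ _ ha) (Ne.symm hsu)]), (ih hs).2⟩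

open Classical in
noncomputable def flip (adj : S → S → Prop) (s : S) (p : S → List Bool) : S → List Bool :=
  if hd s p then pop adj s p else push adj s p

include hsymm in
theorem Reach.flip {p : S → List Bool} (hp : Reach adj p) (s : S) : Reach adj (flip adj s p) := by
  unfold RAM.flip
  split_ifs with h
  · exact (hp.pop hsymm h).1
  · exact hp.push s h

include hsymm in
theorem hd_flip_self {p : S → List Bool} (hp : Reach adj p) (s : S) :
    hd s (flip adj s p) ↔ ¬ hd s p := by
  unfold RAM.flip
  split_ifs with h
  · simp [h, (hp.pop hsymm h).2]
  · simp [h, hd_push_self]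

include hsymm in
theorem flip_flip {p : S → List Bool} (hp : Reach adj p) (s : S) :
    flip adj s (flip adj s p) = p := by
  have h1 := hd_flip_self hsymm hp s
  by_cases h : hd s p
  · rw [flip, if_neg (by rw [h1]; simpa using h), flip, if_pos h, push_pop (hp.inv hsymm) h]
  · rw [flip, if_pos (by rw [h1]; simpa using h), flip, if_neg h, pop_push]

theorem hd_flip_adj {s u : S} (h : adj u s) (hsu : s ≠ u) (p : S → List Bool) :
    hd s (flip adj u p) ↔ hd s p := by
  unfold RAM.flip
  split_ifs
  · exact hd_pop_adj h hsu p
  · exact hd_push_adj h hsu p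

include hsymm in
theorem flip_comm {p : S → List Bool} (hp : Reach adj p) {s t : S} (h : adj s t) (hst : s ≠ t) :
    flip adj s (flip adj t p) = flip adj t (flip adj s p) := by
  have h' := hsymm _ _ h
  have hi := hp.inv hsymm
  have e1 := hd_flip_adj h' hst p
  have e2 := hd_flip_adj h hst.symm p
  by_cases hs : hd s p <;> by_cases ht : hd t p
  · rw [flip, if_pos (e1.2 hs), flip, if_pos ht, flip, if_pos (e2.2 ht), flip, if_pos hs,
      pop_comm h' h]
  · rw [flip, if_pos (e1.2 hs), flip, if_neg ht, flip, if_neg (by rwa [e2]), flip, if_pos hs,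
      pop_push_comm hsymm h' hst hi hs]
  · rw [flip, if_neg (by rwa [e1]), flip, if_pos ht, flip, if_pos (e2.2 ht), flip, if_neg hs,
      pop_push_comm hsymm h hst.symm hi ht]
  · rw [flip, if_neg (by rwa [e1]), flip, if_neg ht, flip, if_neg (by rwa [e2]), flip, if_neg hs,
      push_comm h' h]

end Pilings

/-- A graph on a finite set of generators. -/
structure Gr where
  S : Type
  fin : Fintype S
  adj : S → S → Prop
  symm : ∀ s t, adj s t → adj t s
  irr : ∀ s, ¬ adj s s

attribute [instance] Gr.fin

variable (G : Gr)

def rels : Set (FreeGroup G.S) :=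
  {r | (∃ s, r = FreeGroup.of s * FreeGroup.of s) ∨
    ∃ s t, G.adj s t ∧ r = FreeGroup.of s * FreeGroup.of t * (FreeGroup.of s)⁻¹ * (FreeGroup.of t)⁻¹}

/-- The right-angled Coxeter group. -/
abbrev W : Type := PresentedGroup (rels G)

variable {G}

def gen (s : G.S) : W G := PresentedGroup.of s

def lift {H : Type} [Group H] (f : G.S → H) (h1 : ∀ s, f s * f s = 1)
    (h2 : ∀ s t, G.adj s t → f s * f t = f t * f s) : W G →* H :=
  PresentedGroup.toGroup (f := f) (by
    rintro r (⟨s, rfl⟩ | ⟨s, t, h, rfl⟩)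
    · simp [h1]
    · simp only [map_mul, map_inv, FreeGroup.lift_apply_of]
      rw [h2 s t h]; group)

@[simp] theorem lift_gen {H : Type} [Group H] (f : G.S → H) (h1 h2) (s : G.S) :
    lift f h1 h2 (gen s) = f s := by
  simp [lift, gen]

theorem gen_mul_self (s : G.S) : gen s * gen s = 1 := by
  have : PresentedGroup.mk (rels G) (FreeGroup.of s * FreeGroup.of s) = 1 :=
    PresentedGroup.one_of_mem (Or.inl ⟨s, rfl⟩)
  rw [map_mul] at this
  exact this

theorem gen_inv (s : G.S) : (gen s)⁻¹ = gen s := inv_eq_of_mul_eq_one_left (gen_mul_self s)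

theorem gen_comm {s t : G.S} (h : G.adj s t) : gen s * gen t = gen t * gen s := by
  have : PresentedGroup.mk (rels G) (FreeGroup.of s * FreeGroup.of t * (FreeGroup.of s)⁻¹ * (FreeGroup.of t)⁻¹) = 1 :=
    PresentedGroup.one_of_mem (Or.inr ⟨s, t, h, rfl⟩)
  simp only [map_mul, map_inv] at this
  have h2 : gen s * gen t * (gen s)⁻¹ * (gen t)⁻¹ = 1 := this
  rw [mul_inv_eq_one, mul_inv_eq_iff_eq_mul] at h2
  exact h2

theorem W_induction {P : W G → Prop} (h1 : P 1) (h2 : ∀ w s, P w → P (w * gen s)) (w : W G) : P w := by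
  have hw : w ∈ Subgroup.closure (Set.range (PresentedGroup.of : G.S → W G)) := by
    rw [PresentedGroup.closure_range_of]; trivial
  induction hw using Subgroup.closure_induction_right with
  | one => exact h1
  | mul_right x hx y hy ih => obtain ⟨s, rfl⟩ := hy; exact h2 _ s ih
  | mul_inv_cancel x hx y hy ih =>
    obtain ⟨s, rfl⟩ := hy
    have := gen_inv s
    unfold gen at this
    rw [this]; exact h2 _ s ih

noncomputable def flipPerm (s : G.S) : Equiv.Perm {p : G.S → List Bool // Reach G.adj p} where
  toFun p := ⟨flip G.adj s p.1, p.2.flip G.symm s⟩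
  invFun p := ⟨flip G.adj s p.1, p.2.flip G.symm s⟩
  left_inv p := Subtype.ext (flip_flip G.symm p.2 s)
  right_inv p := Subtype.ext (flip_flip G.symm p.2 s)

theorem adj_ne {s t : G.S} (h : G.adj s t) : s ≠ t := by
  rintro rfl; exact G.irr _ h

noncomputable def act : W G →* Equiv.Perm {p : G.S → List Bool // Reach G.adj p} :=
  lift flipPerm (fun s => by ext1 p; exact Subtype.ext (flip_flip G.symm p.2 s))
    (fun s t h => by ext1 p; exact Subtype.ext (flip_comm G.symm p.2 h (adj_ne h)))

noncomputable def pil (w : W G) : {p : G.S → List Bool // Reach G.adj p} :=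
  act w⁻¹ ⟨_, Reach.nil⟩

theorem pil_mul (w : W G) (s : G.S) : (pil (w * gen s)).1 = flip G.adj s (pil w).1 := by
  simp only [pil, mul_inv_rev, map_mul, gen_inv]
  simp [act, Equiv.Perm.mul_apply, flipPerm]

theorem pil_one : (pil (1 : W G)).1 = fun _ => [] := by
  simp [pil]

/-- The set of right descents. -/
def In (w : W G) : Set G.S := {s | hd s (pil w).1}

noncomputable def len (w : W G) : ℕ := ∑ s, ((pil w).1 s).count true

theorem mem_In_mul_self (w : W G) (s : G.S) : s ∈ In (w * gen s) ↔ s ∉ In w := by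
  simp only [In, Set.mem_ofPred_eq, pil_mul]
  exact hd_flip_self G.symm (pil w).2 s

theorem mem_In_mul_adj (w : W G) {s t : G.S} (h : G.adj s t) : t ∈ In (w * gen s) ↔ t ∈ In w := by
  simp only [In, Set.mem_ofPred_eq, pil_mul]
  exact hd_flip_adj h (adj_ne h).symm _

theorem In_clique (w : W G) {s t : G.S} (hs : s ∈ In w) (ht : t ∈ In w) (hst : s ≠ t) : G.adj s t := by
  by_contra h
  have := (pil w).2.inv G.symm s t hs h hst.symm
  have h2 : ((pil w).1 t).head? = some true := ht
  rw [this] at h2; simp at h2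

theorem len_one : len (1 : W G) = 0 := by simp [len, pil_one]

theorem len_mul (w : W G) (s : G.S) (h : s ∉ In w) : len (w * gen s) = len w + 1 := by
  classical
  have h' : ¬ hd s (pil w).1 := h
  have : ∀ t, ((pil (w * gen s)).1 t).count true = ((pil w).1 t).count true + if t = s then 1 else 0 := by
    intro t
    rw [pil_mul, flip, if_neg h', push]
    split_ifs <;> simp
  simp [len, this, Finset.sum_add_distrib]

theorem mul_gen_gen (w : W G) (s : G.S) : w * gen s * gen s = w := by
  rw [mul_assoc, gen_mul_self, mul_one]

theorem len_mul_of_mem (w : W G) (s : G.S) (h : s ∈ In w) : len (w * gen s) + 1 = len w := by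
  have h2 : s ∉ In (w * gen s) := by rw [mem_In_mul_self]; simpa using h
  have := len_mul _ s h2
  rw [mul_gen_gen] at this
  exact this.symm

inductive Rel : (G.S → List Bool) → W G → Prop
  | nil : Rel (fun _ => []) 1
  | push {p : G.S → List Bool} {w : W G} (s : G.S) : Rel p w → ¬ hd s p → Rel (push G.adj s p) (w * gen s)

theorem Rel.reach {p : G.S → List Bool} {w : W G} (h : Rel p w) : Reach G.adj p := by
  induction h with
  | nil => exact Reach.nil
  | push s _ hs ih => exact ih.push s hs

theorem Rel.pop {p : G.S → List Bool} {w : W G} (h : Rel p w) {s : G.S} (hs : hd s p) :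
    Rel (pop G.adj s p) (w * gen s) := by
  induction h with
  | nil => simp [hd] at hs
  | @push q w u hq hu ih =>
    by_cases hsu : s = u
    · subst hsu; rw [pop_push, mul_gen_gen]; exact hq
    · have ha : G.adj u s := by
        by_contra hn; exact not_hd_push hn hsu q hs
      rw [hd_push_adj ha hsu] at hs
      rw [pop_push_comm G.symm ha hsu (hq.reach.inv G.symm) hs, mul_assoc, gen_comm ha, ← mul_assoc]
      exact (ih hs).push u (by rwa [hd_pop_adj (G.symm _ _ ha) (Ne.symm hsu)])

theorem rel_pil (w : W G) : Rel (pil w).1 w := by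
  induction w using W_induction with
  | h1 => rw [pil_one]; exact Rel.nil
  | h2 w s ih =>
    rw [pil_mul, flip]
    split_ifs with h
    · exact ih.pop h
    · exact ih.push s h

theorem eq_one_of_In (w : W G) (h : In w = ∅) : w = 1 := by
  have := rel_pil w
  have h' : ∀ s, ¬ hd s (pil w).1 := fun s hs => by
    have : s ∈ In w := hs
    rw [h] at this; exact this
  generalize (pil w).1 = p at this h'
  cases this with
  | nil => rfl
  | push s _ _ => exact absurd (hd_push_self s _) (h' s)

open Classical in
noncomputable def chi (s : G.S) : W G →* ℤˣ :=
  lift (fun t => if t = s then -1 else 1) (fun t => by split_ifs <;> simp)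
    (fun _ _ _ => mul_comm _ _)

open Classical in
theorem chi_gen (s t : G.S) : chi s (gen t) = if t = s then -1 else 1 := by
  simp [chi]

end RAM

section RAAGemb

variable [DecidableEq V] [Fintype V]

/-- The commutation graph of the doubled vertex set. -/
def octGr (L : SCplx V) : RAM.Gr where
  S := V × Bool
  fin := inferInstance
  adj s t := s.1 ≠ t.1 ∧ ({s.1, t.1} : Finset V) ∈ L.faces
  symm := by
    rintro s t ⟨h1, h2⟩
    exact ⟨h1.symm, by rwa [Finset.pair_comm]⟩
  irr := fun s h => h.1 rfl

omit [Fintype V] in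
theorem raag_comm (L : SCplx V) {u w : V} (h : u ≠ w) (hf : ({u, w} : Finset V) ∈ L.faces) :
    (PresentedGroup.of u : PresentedGroup (raagRels L)) * PresentedGroup.of w
      = PresentedGroup.of w * PresentedGroup.of u := by
  have : PresentedGroup.mk (raagRels L) (FreeGroup.of u * FreeGroup.of w * (FreeGroup.of u)⁻¹ * (FreeGroup.of w)⁻¹) = 1 :=
    PresentedGroup.one_of_mem ⟨u, w, h, hf, rfl⟩
  simp only [map_mul, map_inv] at this
  rw [mul_inv_eq_one, mul_inv_eq_iff_eq_mul] at this
  exact this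

/-- The automorphism inverting one generator. -/
def raagInv (L : SCplx V) (v : V) :
    PresentedGroup (raagRels L) →* PresentedGroup (raagRels L) :=
  PresentedGroup.toGroup
    (f := fun u => if u = v then (PresentedGroup.of u)⁻¹ else PresentedGroup.of u) (by
    rintro r ⟨u, w, h, hf, rfl⟩
    have hc : Commute (PresentedGroup.of u : PresentedGroup (raagRels L)) (PresentedGroup.of w) :=
      raag_comm L h hf
    simp only [map_mul, map_inv, FreeGroup.lift_apply_of]
    rw [mul_inv_eq_one, mul_inv_eq_iff_eq_mul]
    split_ifs
    · exact hc.inv_inv.eq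
    · exact hc.inv_left.eq
    · exact hc.inv_right.eq
    · exact hc.eq)

omit [Fintype V] in
theorem raagInv_of (L : SCplx V) (v u : V) : raagInv L v (PresentedGroup.of u) =
    if u = v then (PresentedGroup.of u)⁻¹ else PresentedGroup.of u := by
  simp [raagInv]

omit [Fintype V] in
theorem raagInv_invol (L : SCplx V) (v : V) (x) : raagInv L v (raagInv L v x) = x := by
  have : (raagInv L v).comp (raagInv L v) = MonoidHom.id _ := by
    apply PresentedGroup.ext
    intro u
    simp only [MonoidHom.comp_apply, raagInv_of, MonoidHom.id_apply]
    split_ifs with h <;> simp [raagInv_of, h]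
  exact DFunLike.congr_fun this x

omit [Fintype V] in
theorem raagInv_comm (L : SCplx V) (v w : V) (x) :
    raagInv L v (raagInv L w x) = raagInv L w (raagInv L v x) := by
  have : (raagInv L v).comp (raagInv L w) = (raagInv L w).comp (raagInv L v) := by
    apply PresentedGroup.ext
    intro u
    by_cases h : u = v
    · subst h
      by_cases h2 : u = w
      · subst h2; rfl
      · simp [raagInv_of, h2]
    · by_cases h2 : u = w
      · subst h2; simp [raagInv_of, h]
      · simp [raagInv_of, h2, h]
  exact DFunLike.congr_fun this x

def raagInvPerm (L : SCplx V) (v : V) : Equiv.Perm (PresentedGroup (raagRels L)) where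
  toFun := raagInv L v
  invFun := raagInv L v
  left_inv := raagInv_invol L v
  right_inv := raagInv_invol L v

def raagRefl (L : SCplx V) (s : V × Bool) : Equiv.Perm (PresentedGroup (raagRels L)) :=
  if s.2 then (Equiv.mulLeft (PresentedGroup.of s.1)) * raagInvPerm L s.1 else raagInvPerm L s.1

def coxToPerm (L : SCplx V) : RAM.W (octGr L) →* Equiv.Perm (PresentedGroup (raagRels L)) :=
  RAM.lift (G := octGr L) (raagRefl L) (by
    rintro ⟨v, b⟩
    ext x
    cases b <;> simp [raagRefl, raagInvPerm, raagInv_of, raagInv_invol]) (by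
    rintro ⟨v, b⟩ ⟨w, c⟩ ⟨h1, h2⟩
    simp only at h1 h2
    ext x
    have hc := raag_comm L h1 h2
    cases b <;> cases c <;>
      simp [raagRefl, raagInvPerm, raagInv_of, h1, h1.symm, raagInv_comm L v w]
    rw [← mul_assoc, hc, mul_assoc])

theorem coxToPerm_gen (L : SCplx V) (s : V × Bool) :
    coxToPerm L (RAM.gen (G := octGr L) s) = raagRefl L s :=
  RAM.lift_gen (G := octGr L) _ _ _ s

def raagToCox' (L : SCplx V) : PresentedGroup (raagRels L) →* RAM.W (octGr L) :=
  PresentedGroup.toGroup (rels := raagRels L)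
    (f := fun v => RAM.gen (G := octGr L) (v, true) * RAM.gen (G := octGr L) (v, false)) (by
    rintro r ⟨u, w, h, hf, rfl⟩
    simp only [map_mul, map_inv, FreeGroup.lift_apply_of]
    rw [mul_inv_eq_one, mul_inv_eq_iff_eq_mul]
    have key : ∀ b c : Bool, Commute (RAM.gen (G := octGr L) (u, b)) (RAM.gen (G := octGr L) (w, c)) :=
      fun b c => RAM.gen_comm (G := octGr L) (s := (u, b)) (t := (w, c)) ⟨h, hf⟩
    exact (((key _ _).mul_right (key _ _)).mul_left ((key _ _).mul_right (key _ _))).eq)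

theorem raagToCox'_injective (L : SCplx V) : Function.Injective (raagToCox' L) := by
  have key : ∀ x : PresentedGroup (raagRels L), coxToPerm L (raagToCox' L x) 1 = x := by
    intro x
    have : (coxToPerm L).comp (raagToCox' L) = (MulAction.toPermHom (PresentedGroup (raagRels L)) (PresentedGroup (raagRels L)) : PresentedGroup (raagRels L) →* _) := by
      apply PresentedGroup.ext
      intro v
      have : raagToCox' L (PresentedGroup.of v) = RAM.gen (G := octGr L) (v, true) * RAM.gen (G := octGr L) (v, false) :=
        PresentedGroup.toGroup.of _
      rw [MonoidHom.comp_apply, this]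
      ext y
      rw [map_mul, coxToPerm_gen, coxToPerm_gen]
      simp [raagRefl, raagInvPerm, raagInv_invol]
    have h2 := DFunLike.congr_fun this x
    rw [MonoidHom.comp_apply] at h2
    rw [h2]
    simp
  intro x y hxy
  rw [← key x, hxy, key y]

def raagToCox (L : SCplx V) : RAAG L →* RAM.W (octGr L) := raagToCox' L

theorem raagToCox_injective (L : SCplx V) : Function.Injective (raagToCox L) :=
  raagToCox'_injective L

end RAAGemb


/-! ### The Davis complex -/
namespace RAM

variable {G : Gr}

/-- The standard subgroup of a set of generators. -/
def std (T : Set G.S) : Subgroup (W G) := Subgroup.closure (gen '' T)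

theorem gen_mem_std {T : Set G.S} {s : G.S} (h : s ∈ T) : gen s ∈ std T :=
  Subgroup.subset_closure ⟨s, h, rfl⟩

theorem std_induction {T : Set G.S} {P : W G → Prop} (h1 : P 1)
    (h2 : ∀ w s, s ∈ T → P w → P (w * gen s)) {w : W G} (hw : w ∈ std T) : P w := by
  unfold std at hw
  induction hw using Subgroup.closure_induction_right with
  | one => exact h1
  | mul_right x hx y hy ih => obtain ⟨s, hs, rfl⟩ := hy; exact h2 _ s hs ih
  | mul_inv_cancel x hx y hy ih => obtain ⟨s, hs, rfl⟩ := hy; rw [gen_inv]; exact h2 _ s hs ih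

theorem std_mono {T T' : Set G.S} (h : T ⊆ T') : std T ≤ std T' :=
  Subgroup.closure_mono (Set.image_mono h)

theorem std_mul_gen_iff {T : Set G.S} {s : G.S} (h : s ∈ T) (w : W G) :
    w * gen s ∈ std T ↔ w ∈ std T :=
  Subgroup.mul_mem_cancel_right _ (gen_mem_std h)

theorem chi_std {T : Set G.S} {s : G.S} (hs : s ∉ T) {w : W G} (hw : w ∈ std T) : chi s w = 1 := by
  classical
  refine std_induction (P := fun w => chi s w = 1) (by simp) ?_ hw
  intro w t ht ih
  rw [map_mul, ih, chi_gen, if_neg (by rintro rfl; exact hs ht), one_mul]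

def Clq (T : Set G.S) : Prop := ∀ s ∈ T, ∀ t ∈ T, s ≠ t → G.adj s t

theorem std_diff_singleton {T : Set G.S} (hT : Clq T) {s : G.S} {w : W G} (hw : w ∈ std T)
    (hs : chi s w = 1) : w ∈ std (T \ {s}) := by
  classical
  by_cases hsT : s ∈ T
  swap
  · rwa [Set.sdiff_singleton_eq_self hsT]
  have key : w ∈ std (T \ {s}) ∨ w * gen s ∈ std (T \ {s}) := by
    clear hs
    refine std_induction (P := fun w => w ∈ std (T \ {s}) ∨ w * gen s ∈ std (T \ {s}))
      (Or.inl (one_mem _)) ?_ hw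
    intro w t ht ih
    by_cases hts : t = s
    · subst hts
      rw [mul_gen_gen]; exact ih.symm
    · have hm : t ∈ T \ {s} := ⟨ht, hts⟩
      rw [mul_assoc, gen_comm (hT t ht s hsT hts), ← mul_assoc, std_mul_gen_iff hm,
          std_mul_gen_iff hm]
      exact ih
  rcases key with h | h
  · exact h
  · exfalso
    have h1 := chi_std (s := s) (by simp) h
    rw [map_mul, hs, chi_gen] at h1
    simp at h1

theorem std_diff {T : Set G.S} (hT : Clq T) {w : W G} (hw : w ∈ std T) (B : Finset G.S)
    (hs : ∀ s ∈ B, chi s w = 1) : w ∈ std (T \ B) := by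
  classical
  induction B using Finset.induction_on with
  | empty => simpa using hw
  | insert a B ha ih =>
    have h1 := ih (fun s hs' => hs s (Finset.mem_insert_of_mem hs'))
    have h2 := std_diff_singleton (T := T \ B) (fun s h t h' => hT s h.1 t h'.1) h1
      (hs a (Finset.mem_insert_self _ _))
    rw [Set.sdiff_sdiff] at h2
    rw [Finset.coe_insert, Set.insert_eq, Set.union_comm]
    exact h2

/-- Elements of a spherical subgroup are separated by the characters. -/
theorem std_of_chi {T T' : Set G.S} (hT : Clq T) {w : W G} (hw : w ∈ std T)
    (hs : ∀ s, s ∉ T' → chi s w = 1) : w ∈ std T' := by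
  classical
  have := std_diff hT hw (Finset.univ.filter (· ∉ T')) (fun s h => hs s (by simpa using h))
  refine std_mono ?_ this
  rintro s ⟨_, h2⟩
  simpa using h2

theorem std_empty : std (∅ : Set G.S) = ⊥ := by simp [std]

theorem std_finite {T : Set G.S} (hT : Clq T) : (std T : Set (W G)).Finite := by
  have hinj : Set.InjOn (fun w : W G => fun s => chi s w) (std T : Set (W G)) := by
    intro u hu w hw h
    have h1 : u⁻¹ * w ∈ std T := mul_mem (inv_mem hu) hw
    have h2 := std_of_chi (T' := ∅) hT h1 (fun s _ => by
      have := congrFun h s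
      simp only at this
      simp [this])
    rw [std_empty, Subgroup.mem_bot] at h2
    exact (inv_mul_eq_one.1 h2)
  exact Set.Finite.of_finite_image (Set.toFinite _) hinj

open Classical in
theorem exists_chi (B : Finset G.S) : ∃ u ∈ std (B : Set G.S), ∀ s, chi s u = if s ∈ B then -1 else 1 := by
  induction B using Finset.induction_on with
  | empty => exact ⟨1, one_mem _, by simp⟩
  | insert a B ha ih =>
    obtain ⟨u, hu, h⟩ := ih
    refine ⟨u * gen a, mul_mem (std_mono (by simp) hu) (gen_mem_std (by simp)), fun s => ?_⟩
    rw [map_mul, h, chi_gen]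
    by_cases hs : s = a
    · subst hs; simp [ha]
    · simp [hs, Ne.symm hs]

/-! the chamber -/

variable (G) in
def Ch : Set (G.S → ℝ) :=
  {c | (∀ s, 0 ≤ c s) ∧ (∀ s, c s ≤ 1) ∧ ∀ s t, s ≠ t → c s ≠ 0 → c t ≠ 0 → G.adj s t}

def one' (a : G.S → ℝ) : Set G.S := {s | a s = 1}

theorem one'_clq (a : Ch G) : Clq (one' a.1) := by
  intro s hs t ht hst
  have hs' : a.1 s = 1 := hs
  have ht' : a.1 t = 1 := ht
  exact a.2.2.2 s t hst (by simp [hs']) (by simp [ht'])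

theorem continuous_coord (s : G.S) : Continuous fun a : Ch G => a.1 s :=
  (continuous_apply s).comp continuous_subtype_val

variable (G) in
def sigSetoid : Setoid (W G × Ch G) where
  r x y := x.2 = y.2 ∧ x.1⁻¹ * y.1 ∈ std (one' x.2.1)
  iseqv := {
    refl := fun x => ⟨rfl, by simp [one_mem]⟩
    symm := by
      rintro ⟨x, a⟩ ⟨y, b⟩ ⟨h1, h2⟩
      simp only at h1 h2 ⊢
      subst h1
      refine ⟨rfl, ?_⟩
      have := inv_mem h2
      simpa using this
    trans := by
      rintro ⟨x, a⟩ ⟨y, b⟩ ⟨z, c⟩ ⟨h1, h2⟩ ⟨h3, h4⟩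
      simp only at h1 h2 h3 h4 ⊢
      subst h1 h3
      refine ⟨rfl, ?_⟩
      have := mul_mem h2 h4
      simpa [mul_assoc] using this }

variable (G) in
/-- The Davis complex. -/
def Sig : Type := Quotient (sigSetoid G)

instance : TopologicalSpace (W G) := ⊥
instance : DiscreteTopology (W G) := ⟨rfl⟩
instance : TopologicalSpace (Sig G) := inferInstanceAs (TopologicalSpace (Quotient (sigSetoid G)))

def mk (w : W G) (a : Ch G) : Sig G := Quotient.mk (sigSetoid G) (w, a)

theorem mk_eq {w w' : W G} {a a' : Ch G} :
    mk w a = mk w' a' ↔ a = a' ∧ w⁻¹ * w' ∈ std (one' a.1) := Quotient.eq (r := sigSetoid G)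

theorem mk_gen (w : W G) (a : Ch G) {s : G.S} (h : a.1 s = 1) : mk (w * gen s) a = mk w a := by
  symm
  rw [mk_eq]
  refine ⟨rfl, ?_⟩
  rw [← mul_assoc, inv_mul_cancel, one_mul]
  exact gen_mem_std h

theorem ind {P : Sig G → Prop} (h : ∀ w a, P (mk w a)) (z : Sig G) : P z :=
  Quotient.ind (s := sigSetoid G) (fun x => h x.1 x.2) z

theorem continuous_mk (w : W G) : Continuous (mk w) :=
  (continuous_quotient_mk' (s := sigSetoid G)).comp (Continuous.prodMk_right w)

def slift {X : Type*} (f : W G → Ch G → X)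
    (h : ∀ w a s, a.1 s = 1 → f (w * gen s) a = f w a) : Sig G → X :=
  Quotient.lift (s := sigSetoid G) (fun x => f x.1 x.2) (by
    rintro ⟨w, a⟩ ⟨w', b⟩ ⟨h1, h2⟩
    simp only at h1 h2 ⊢
    subst h1
    have : ∀ u ∈ std (one' a.1), f (w * u) a = f w a := by
      intro u hu
      refine std_induction (P := fun u => f (w * u) a = f w a) (by simp) ?_ hu
      intro x s hs ih
      rw [← mul_assoc, h _ _ _ hs, ih]
    have h3 := this _ h2
    rw [mul_inv_cancel_left] at h3
    exact h3.symm)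

@[simp] theorem slift_mk {X : Type*} (f : W G → Ch G → X) (h) (w : W G) (a : Ch G) :
    slift f h (mk w a) = f w a := rfl

theorem continuous_slift {X : Type*} [TopologicalSpace X] (f : W G → Ch G → X) (h)
    (hf : ∀ w, Continuous (f w)) : Continuous (slift f h) := by
  apply Continuous.quotient_lift (s := sigSetoid G)
  rw [continuous_prod_of_discrete_left]
  exact hf

/-- projection to the chamber -/
def qS : Sig G → Ch G := slift (fun _ a => a) (fun _ _ _ _ => rfl)

@[simp] theorem qS_mk (w : W G) (a : Ch G) : qS (mk w a) = a := rfl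

theorem continuous_qS : Continuous (qS (G := G)) := continuous_slift _ _ (fun _ => continuous_id)

def actS (g : W G) : Sig G → Sig G :=
  slift (fun w a => mk (g * w) a) (fun w a s h => by rw [← mul_assoc, mk_gen _ _ h])

@[simp] theorem actS_mk (g w : W G) (a : Ch G) : actS g (mk w a) = mk (g * w) a := rfl

theorem continuous_actS (g : W G) : Continuous (actS g) :=
  continuous_slift _ _ (fun _ => continuous_mk _)

@[simp] theorem qS_actS (g : W G) (z : Sig G) : qS (actS g z) = qS z := by
  induction z using ind with | h w a => rfl

theorem actS_actS (g g' : W G) (z : Sig G) : actS g (actS g' z) = actS (g * g') z := by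
  induction z using ind with | h w a => simp [mul_assoc]

theorem actS_one (z : Sig G) : actS 1 z = z := by
  induction z using ind with | h w a => simp

noncomputable def YS (s : G.S) : Sig G → ℝ :=
  slift (fun w a => ((chi s w : ℤˣ) : ℤ) * (1 - a.1 s)) (fun w a t h => by
    classical
    rw [map_mul, chi_gen]
    split_ifs with h1
    · subst h1; simp [h]
    · simp)

theorem YS_mk (s : G.S) (w : W G) (a : Ch G) :
    YS s (mk w a) = ((chi s w : ℤˣ) : ℤ) * (1 - a.1 s) := rfl

theorem continuous_YS (s : G.S) : Continuous (YS s) :=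
  continuous_slift _ _ (fun w => by
    exact continuous_const.mul (continuous_const.sub (continuous_coord s)))

open Classical in
noncomputable def fS (w : W G) (T : Set G.S) : Sig G → ℝ :=
  slift (fun u a => if w⁻¹ * u ∈ std T then ∏ s ∈ Finset.univ.filter (· ∉ T), (1 - a.1 s) else 0)
   (fun u a t h => by
    by_cases ht : t ∈ T
    · rw [← mul_assoc, std_mul_gen_iff ht]
    · have : ∏ s ∈ Finset.univ.filter (· ∉ T), (1 - a.1 s) = 0 :=
        Finset.prod_eq_zero (i := t) (by simp [ht]) (by simp [h])
      rw [this]; simp)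

theorem continuous_fS (w : W G) (T : Set G.S) : Continuous (fS w T) := by
  classical
  refine continuous_slift _ _ (fun u => ?_)
  split_ifs
  · refine continuous_finsetProd _ (fun s _ => ?_)
    exact continuous_const.sub (continuous_coord s)
  · exact continuous_const

theorem fS_pos {w u : W G} {T : Set G.S} {a : Ch G} :
    0 < fS w T (mk u a) ↔ w⁻¹ * u ∈ std T ∧ one' a.1 ⊆ T := by
  classical
  simp only [fS, slift_mk]
  split_ifs with h
  · simp only [h, true_and]
    constructor
    · intro hp s hs
      by_contra hsT
      rw [Finset.prod_eq_zero (i := s) (by simp [hsT]) (by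
        have : a.1 s = 1 := hs
        simp [this])] at hp
      exact lt_irrefl _ hp
    · intro hs
      refine Finset.prod_pos (fun s hsT => ?_)
      have h1 := a.2.2.1 s
      have h2 : a.1 s ≠ 1 := fun h => (Finset.mem_filter.1 hsT).2 (hs h)
      have : a.1 s < 1 := lt_of_le_of_ne h1 h2
      linarith
  · simp [h]

instance : T2Space (Sig G) := by
  refine ⟨fun x y hxy => ?_⟩
  induction x using ind with | h w a => ?_
  induction y using ind with | h w' a' => ?_
  by_cases h : a = a'
  · subst h
    have h1 : 0 < fS w (one' a.1) (mk w a) := by rw [fS_pos]; simp [one_mem]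
    have h2 : ¬ 0 < fS w (one' a.1) (mk w' a) := by
      rw [fS_pos]
      rintro ⟨h, -⟩
      exact hxy (mk_eq.2 ⟨rfl, h⟩)
    exact separated_by_continuous (continuous_fS w (one' a.1)) (fun h => h2 (h ▸ h1))
  · exact separated_by_continuous continuous_qS (x := mk w a) (y := mk w' a') h

/-- A compact set meets finitely many chambers. -/
theorem compact_chambers {K : Set (Sig G)} (hK : IsCompact K) :
    ∃ F : Set (W G), F.Finite ∧ ∀ u a, mk u a ∈ K → u ∈ F := by
  let ι := {p : W G × Set G.S // Clq p.2}
  obtain ⟨t, ht⟩ := hK.elim_finite_subcover (fun i : ι => {z | 0 < fS i.1.1 i.1.2 z})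
    (fun i => isOpen_lt continuous_const (continuous_fS _ _)) (by
      intro z _
      induction z using ind with | h w a => ?_
      rw [Set.mem_iUnion]
      refine ⟨⟨(w, one' a.1), one'_clq a⟩, ?_⟩
      show (0 : ℝ) < _
      rw [fS_pos]; simp [one_mem])
  refine ⟨⋃ i ∈ t, (fun u => i.1.1 * u) '' (std i.1.2 : Set (W G)),
    t.finite_toSet.biUnion (fun i _ => (std_finite i.2).image _), ?_⟩
  intro u a hu
  have := ht hu
  simp only [Set.mem_iUnion] at this ⊢
  obtain ⟨i, hi, h⟩ := this
  refine ⟨i, hi, i.1.1⁻¹ * u, ?_, by simp⟩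
  exact (fS_pos.1 h).1

theorem proper_actS {K L : Set (Sig G)} (hK : IsCompact K) (hL : IsCompact L) :
    {g : W G | (actS g '' K ∩ L).Nonempty}.Finite := by
  obtain ⟨F, hF, h1⟩ := compact_chambers hK
  obtain ⟨F', hF', h2⟩ := compact_chambers hL
  refine ((hF'.prod hF).image (fun p => p.1 * p.2⁻¹)).subset ?_
  rintro g ⟨_, ⟨z, hz, rfl⟩, hg⟩
  induction z using ind with | h w a => ?_
  exact ⟨(g * w, w), ⟨h2 _ _ hg, h1 _ _ hz⟩, by simp⟩

end RAM


/-! ### Contractibility of the Davis complex -/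
namespace RAM

variable {G : Gr}

section Retr

variable (T : Finset G.S) (hT : T.Nonempty)

noncomputable def mu (a : G.S → ℝ) : ℝ := T.sup' hT a

theorem le_mu {a : G.S → ℝ} {s : G.S} (hs : s ∈ T) : a s ≤ mu T hT a := Finset.le_sup' a hs

theorem exists_mu (a : G.S → ℝ) : ∃ s ∈ T, mu T hT a = a s := Finset.exists_mem_eq_sup' hT a

open Classical in
noncomputable def dfm (a : G.S → ℝ) (τ : ℝ) : G.S → ℝ := fun s =>
  if s ∈ T then
    a s + max (2 * τ - 1) 0 * (1 - (mu T hT a - a s) / max (mu T hT a) (1/2) - a s)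
  else a s * (1 - min (2 * τ) 1 * (2 - 2 * max (mu T hT a) (1/2)))

theorem dfm_mem (hc : Clq (T : Set G.S)) {a : G.S → ℝ} (ha : a ∈ Ch G) {τ : ℝ} (h0 : 0 ≤ τ) (h1 : τ ≤ 1) :
    dfm T hT a τ ∈ Ch G := by
  obtain ⟨ha0, ha1, hac⟩ := ha
  obtain ⟨s0, hs0, hmu⟩ := exists_mu T hT a
  set m := mu T hT a with hm
  have hm0 : 0 ≤ m := by rw [hmu]; exact ha0 _
  have hm1 : m ≤ 1 := by rw [hmu]; exact ha1 _
  set ν := max m (1/2) with hν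
  have hν1 : ν ≤ 1 := max_le hm1 (by norm_num)
  have hν2 : 1/2 ≤ ν := le_max_right _ _
  have hνm : m ≤ ν := le_max_left _ _
  have hm2 : 0 ≤ min (2 * τ) 1 := le_min (by linarith) (by norm_num)
  have hm3 : min (2 * τ) 1 ≤ 1 := min_le_right _ _
  have hx0 : 0 ≤ max (2 * τ - 1) 0 := le_max_right _ _
  have hx1 : max (2 * τ - 1) 0 ≤ 1 := max_le (by linarith) (by norm_num)
  have hf0 : 0 ≤ 1 - min (2 * τ) 1 * (2 - 2 * ν) := by nlinarith
  have hf1 : 1 - min (2 * τ) 1 * (2 - 2 * ν) ≤ 1 := by nlinarith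
  have hr0 : ∀ s ∈ T, 0 ≤ 1 - (m - a s) / ν := by
    intro s _
    have : (m - a s) / ν ≤ 1 := by
      rw [div_le_one (by linarith)]; have := ha0 s; linarith
    linarith
  have hr1 : ∀ s ∈ T, 1 - (m - a s) / ν ≤ 1 := by
    intro s hs
    have h1 : a s ≤ m := le_mu T hT hs
    have : 0 ≤ (m - a s) / ν := div_nonneg (by linarith) (by linarith)
    linarith
  refine ⟨fun s => ?_, fun s => ?_, ?_⟩
  · unfold dfm
    split_ifs with hs
    · have := hr0 s hs; have := ha0 s
      rw [← hm, ← hν]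
      nlinarith
    · exact mul_nonneg (ha0 s) hf0
  · unfold dfm
    split_ifs with hs
    · have := hr1 s hs; have := ha1 s
      rw [← hm, ← hν]
      nlinarith
    · have := ha1 s; have := ha0 s
      rw [← hm, ← hν]
      nlinarith
  · have key : ∀ s t, s ∈ T → t ∉ T → dfm T hT a τ s ≠ 0 → dfm T hT a τ t ≠ 0 → G.adj s t := by
      intro s t hs ht hds hdt
      simp only [dfm, hs, ht, if_true, if_false] at hds hdt
      rw [← hm, ← hν] at hds hdt
      have hat : a t ≠ 0 := left_ne_zero_of_mul hdt
      have hst : s ≠ t := by rintro rfl; exact ht hs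
      by_cases has : a s = 0
      · exfalso
        have hf := right_ne_zero_of_mul hdt
        rw [has] at hds
        simp only [zero_add, sub_zero] at hds
        have h2 := left_ne_zero_of_mul hds
        have h3 := right_ne_zero_of_mul hds
        have h4 : 1 < 2 * τ := by
          by_contra h
          exact h2 (max_eq_right (by linarith))
        have h5 : m < 1/2 := by
          by_contra h
          apply h3
          have : ν = m := max_eq_left (by linarith)
          rw [this, div_self (by linarith)]; ring
        apply hf
        have h6 : ν = 1/2 := max_eq_right h5.le
        rw [h6, min_eq_right h4.le]; norm_num
      · exact hac s t hst has hat
    intro s t hst hds hdt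
    by_cases hs : s ∈ T <;> by_cases ht : t ∈ T
    · exact hc s hs t ht hst
    · exact key s t hs ht hds hdt
    · exact G.symm _ _ (key t s ht hs hdt hds)
    · simp only [dfm, hs, ht, if_false] at hds hdt
      exact hac s t hst (left_ne_zero_of_mul hds) (left_ne_zero_of_mul hdt)

theorem dfm_zero (a : G.S → ℝ) : dfm T hT a 0 = a := by
  funext s
  unfold dfm
  split_ifs <;> simp

theorem dfm_fix {a : G.S → ℝ} (ha : a ∈ Ch G) {s : G.S} (hs : s ∈ T) (h1 : a s = 1) (τ : ℝ) :
    dfm T hT a τ = a := by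
  have hm : mu T hT a = 1 := by
    apply le_antisymm
    · obtain ⟨s0, _, h⟩ := exists_mu T hT a
      rw [h]; exact ha.2.1 _
    · rw [← h1]; exact le_mu T hT hs
  have hx : max (1:ℝ) (1/2) = 1 := max_eq_left (by norm_num)
  funext t
  unfold dfm
  rw [hm, hx]
  split_ifs <;> simp

theorem dfm_one (a : G.S → ℝ) : ∃ s ∈ T, dfm T hT a 1 s = 1 := by
  obtain ⟨s, hs, h⟩ := exists_mu T hT a
  refine ⟨s, hs, ?_⟩
  simp only [dfm, hs, if_true]
  rw [h]
  norm_num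

theorem continuous_dfm {X : Type} [TopologicalSpace X] {f : X → G.S → ℝ} {g : X → ℝ}
    (hf : Continuous f) (hg : Continuous g) : Continuous fun x => dfm T hT (f x) (g x) := by
  have hfs : ∀ s, Continuous fun x => f x s := fun s => (continuous_apply s).comp hf
  have hmu : Continuous fun x => mu T hT (f x) := by
    unfold mu
    exact Continuous.finset_sup'_apply hT (fun s _ => hfs s)
  refine continuous_pi (fun s => ?_)
  unfold dfm
  have := hfs s
  split_ifs
  · refine this.add (Continuous.mul (by fun_prop) (Continuous.sub (Continuous.sub continuous_const ?_) this))
    refine (hmu.sub this).div (hmu.max continuous_const) (fun x => ?_)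
    have : (1/2 : ℝ) ≤ max (mu T hT (f x)) (1/2) := le_max_right _ _
    linarith
  · fun_prop

end Retr

open Classical in
noncomputable def InF (w : W G) : Finset G.S := Finset.univ.filter (· ∈ In w)

theorem mem_InF {w : W G} {s : G.S} : s ∈ InF w ↔ s ∈ In w := by simp [InF]

theorem InF_clq (w : W G) : Clq (InF w : Set G.S) := fun _ hs _ ht hst =>
  In_clique w (mem_InF.1 hs) (mem_InF.1 ht) hst

theorem InF_nonempty {w : W G} {n : ℕ} (h : len w = n + 1) : (InF w).Nonempty := by
  by_contra hn
  rw [Finset.not_nonempty_iff_eq_empty] at hn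
  have : w = 1 := eq_one_of_In w (by
    ext s
    rw [← mem_InF, hn]; simp)
  rw [this, len_one] at h
  omega

noncomputable def clampI (x : ℝ) : ℝ := max 0 (min 1 x)

/-- The deformation of a chamber to the faces toward the base chamber. -/
noncomputable def DD (w : W G) (a : Ch G) (x : ℝ) : Ch G :=
  if h : (InF w).Nonempty then
    ⟨dfm (InF w) h a.1 (clampI x), dfm_mem _ h (InF_clq w) a.2 (le_max_left _ _)
      (max_le zero_le_one (min_le_left _ _))⟩
  else a

theorem DD_nonpos (w : W G) (a : Ch G) {x : ℝ} (hx : x ≤ 0) : DD w a x = a := by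
  unfold DD
  split_ifs with h
  · have : clampI x = 0 := by
      unfold clampI; rw [min_eq_right (by linarith), max_eq_left hx]
    apply Subtype.ext
    simp only [this, dfm_zero]
  · rfl

theorem DD_fix (w : W G) (a : Ch G) (x : ℝ) {s : G.S} (hs : s ∈ In w) (h1 : a.1 s = 1) :
    DD w a x = a := by
  have hs' := mem_InF.2 hs
  unfold DD
  rw [dif_pos ⟨s, hs'⟩]
  exact Subtype.ext (dfm_fix _ _ a.2 hs' h1 _)

theorem DD_one (w : W G) (a : Ch G) {n : ℕ} (hn : len w = n + 1) :
    ∃ s ∈ In w, (DD w a 1).1 s = 1 := by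
  have hne := InF_nonempty hn
  have : clampI 1 = 1 := by simp [clampI]
  obtain ⟨s, hs, h⟩ := dfm_one (InF w) hne a.1
  refine ⟨s, mem_InF.1 hs, ?_⟩
  unfold DD
  rw [dif_pos hne]
  simp only [this]
  exact h

theorem continuous_DD (w : W G) {X : Type} [TopologicalSpace X] {f : X → Ch G} {g : X → ℝ}
    (hf : Continuous f) (hg : Continuous g) : Continuous fun x => DD w (f x) (g x) := by
  unfold DD
  split_ifs with h
  · refine Continuous.subtype_mk (continuous_dfm _ h (continuous_subtype_val.comp hf) ?_) _
    unfold clampI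
    fun_prop
  · exact hf

open Classical in
noncomputable def stp (w : W G) (b : Ch G) : W G :=
  if h : ∃ s, s ∈ In w ∧ b.1 s = 1 then w * gen h.choose else w

theorem stp_spec {w : W G} {b : Ch G} (h : ∃ s ∈ In w, b.1 s = 1) :
    ∃ s ∈ In w, b.1 s = 1 ∧ stp w b = w * gen s := by
  unfold stp
  rw [dif_pos h]
  exact ⟨_, h.choose_spec.1, h.choose_spec.2, rfl⟩

open Classical in
noncomputable def Fl : ℕ → W G → Ch G → ℝ → Sig G
  | 0, w, a, _ => mk w a
  | n + 1, w, a, t => if (n : ℝ) ≤ t then mk w (DD w a (n + 1 - t))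
      else Fl n (stp w (DD w a 1)) (DD w a 1) t

open Classical in
theorem Fl_succ (n : ℕ) (w : W G) (a : Ch G) (t : ℝ) : Fl (n + 1) w a t =
    if (n : ℝ) ≤ t then mk w (DD w a (n + 1 - t))
      else Fl n (stp w (DD w a 1)) (DD w a 1) t := rfl

theorem Fl_ge (n : ℕ) (w : W G) (a : Ch G) {t : ℝ} (h : (n : ℝ) ≤ t) : Fl n w a t = mk w a := by
  cases n with
  | zero => rfl
  | succ n =>
    push_cast at h
    rw [Fl, if_pos (by linarith), DD_nonpos _ _ (by linarith)]

theorem len_stp {w : W G} {s : G.S} {n : ℕ} (hn : len w = n + 1) (hs : s ∈ In w) :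
    len (w * gen s) = n := by
  have := len_mul_of_mem w s hs
  omega

theorem Fl_compat (n : ℕ) : ∀ (w : W G) (a : Ch G) (t : ℝ) (s : G.S), len w = n + 1 → s ∈ In w →
    a.1 s = 1 → Fl (n + 1) w a t = Fl n (w * gen s) a t := by
  induction n with
  | zero =>
    intro w a t s hn hs h1
    by_cases ht : ((0 : ℕ) : ℝ) ≤ t
    · rw [Fl_succ, if_pos ht, DD_fix w a _ hs h1, Fl, mk_gen _ _ h1]
    · rw [Fl_succ, if_neg ht, DD_fix w a _ hs h1, Fl, Fl]
      obtain ⟨s', _, h2, h3⟩ := stp_spec ⟨s, hs, h1⟩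
      rw [h3, mk_gen _ _ h2, mk_gen _ _ h1]
  | succ n ih =>
    intro w a t s hn hs h1
    by_cases ht : ((n + 1 : ℕ) : ℝ) ≤ t
    · rw [Fl_succ, if_pos ht, DD_fix w a _ hs h1, Fl_ge _ _ _ ht, mk_gen _ _ h1]
    · rw [Fl_succ, if_neg ht, DD_fix w a _ hs h1]
      obtain ⟨s', hs', h2, h3⟩ := stp_spec ⟨s, hs, h1⟩
      rw [h3]
      by_cases hss : s = s'
      · rw [hss]
      · have ha := In_clique w hs hs' hss
        rw [ih (w * gen s') a t s (len_stp hn hs') ((mem_In_mul_adj w (G.symm _ _ ha)).2 hs) h1,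
          ih (w * gen s) a t s' (len_stp hn hs) ((mem_In_mul_adj w ha).2 hs') h2,
          mul_assoc, mul_assoc, gen_comm ha]

theorem Fl_lt {n : ℕ} {w : W G} {a : Ch G} {t : ℝ} {s : G.S} (hn : len w = n + 1) (hs : s ∈ In w)
    (h1 : (DD w a 1).1 s = 1) (ht : t ≤ n) : Fl (n + 1) w a t = Fl n (w * gen s) (DD w a 1) t := by
  rcases ht.lt_or_eq with ht | ht
  · rw [Fl, if_neg (by linarith)]
    obtain ⟨s', hs', h2, h3⟩ := stp_spec ⟨s, hs, h1⟩
    rw [h3, ← Fl_compat n w _ t s hn hs h1, ← Fl_compat n w _ t s' hn hs' h2]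
  · subst ht
    rw [Fl, if_pos le_rfl, Fl_ge _ _ _ le_rfl, mk_gen _ _ h1]
    simp

theorem continuous_Fl (n : ℕ) : ∀ (w : W G), len w = n →
    Continuous fun x : Ch G × ℝ => Fl n w x.1 x.2 := by
  induction n with
  | zero => intro w _; exact (continuous_mk w).comp continuous_fst
  | succ n ih =>
    intro w hn
    have hD : Continuous fun x : Ch G × ℝ => DD w x.1 1 := continuous_DD w continuous_fst continuous_const
    let A : Option (InF w) → Set (Ch G × ℝ) := fun o => match o with
      | none => {x | (n : ℝ) ≤ x.2}
      | some s => {x | x.2 ≤ n ∧ (DD w x.1 1).1 s = 1}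
    refine LocallyFinite.continuous (f := A) (locallyFinite_of_finite _) ?_ ?_ ?_
    · rw [Set.eq_univ_iff_forall]
      intro x
      rw [Set.mem_iUnion]
      by_cases hx : (n : ℝ) ≤ x.2
      · exact ⟨none, hx⟩
      · obtain ⟨s, hs, h1⟩ := DD_one w x.1 hn
        exact ⟨some ⟨s, mem_InF.2 hs⟩, (not_le.1 hx).le, h1⟩
    · rintro (_ | s)
      · exact isClosed_le continuous_const continuous_snd
      · exact (isClosed_le continuous_snd continuous_const).inter
          (isClosed_eq ((continuous_coord s.1).comp hD) continuous_const)
    · rintro (_ | s)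
      · have : Continuous fun x : Ch G × ℝ => mk w (DD w x.1 (n + 1 - x.2)) :=
          (continuous_mk w).comp (continuous_DD w continuous_fst (by fun_prop))
        refine this.continuousOn.congr (fun x hx => ?_)
        have hx' : (n : ℝ) ≤ x.2 := hx
        simp only [Fl]
        rw [if_pos hx']
      · have hs := mem_InF.1 s.2
        have : Continuous fun x : Ch G × ℝ => Fl n (w * gen s.1) (DD w x.1 1) x.2 :=
          (ih (w * gen s.1) (len_stp hn hs)).comp (hD.prodMk continuous_snd)
        refine this.continuousOn.congr (fun x hx => ?_)
        have hx' : x.2 ≤ n ∧ (DD w x.1 1).1 s = 1 := hx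
        exact Fl_lt hn hs hx'.2 hx'.1

theorem Fl_zero_mem (n : ℕ) : ∀ (w : W G) (a : Ch G), len w = n → ∃ b, Fl n w a 0 = mk 1 b := by
  induction n with
  | zero =>
    intro w a hn
    have : w = 1 := by
      apply eq_one_of_In
      by_contra h
      obtain ⟨s, hs⟩ := Set.nonempty_iff_ne_empty.2 h
      have := len_mul_of_mem w s hs
      omega
    exact ⟨a, by rw [this, Fl]⟩
  | succ n ih =>
    intro w a hn
    obtain ⟨s, hs, h1⟩ := DD_one w a hn
    rw [Fl_lt hn hs h1 (by positivity)]
    exact ih _ _ (len_stp hn hs)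

noncomputable def theta (n : ℕ) (τ : ℝ) : ℝ := 1 / max τ (1 / (n + 1)) - 1

theorem continuous_theta (n : ℕ) : Continuous (theta n) := by
  unfold theta
  refine (continuous_const.div (by fun_prop) (fun x => ?_)).sub continuous_const
  have : (0 : ℝ) < 1 / (n + 1) := by positivity
  exact (lt_of_lt_of_le this (le_max_right _ _)).ne'

theorem theta_ge {n : ℕ} {τ : ℝ} (hτ : τ ≤ 1 / (n + 1)) : theta n τ = n := by
  unfold theta
  rw [max_eq_right hτ]; simp

theorem theta_succ {n : ℕ} {τ : ℝ} (hτ : 1 / ((n : ℝ) + 1) ≤ τ) : theta (n + 1) τ = theta n τ := by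
  unfold theta
  rw [max_eq_left hτ, max_eq_left]
  refine le_trans ?_ hτ
  push_cast
  exact one_div_le_one_div_of_le (by positivity) (by linarith)

theorem theta_succ_ge {n : ℕ} {τ : ℝ} (hτ : τ ≤ 1 / ((n : ℝ) + 1)) : n ≤ theta (n + 1) τ := by
  unfold theta
  have h0 : (0 : ℝ) < 1 / ((n + 1 : ℕ) + 1) := by positivity
  have : max τ (1 / ((n + 1 : ℕ) + 1)) ≤ 1 / ((n : ℝ) + 1) := by
    refine max_le hτ ?_
    push_cast
    exact one_div_le_one_div_of_le (by positivity) (by linarith)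
  have h2 := one_div_le_one_div_of_le (lt_of_lt_of_le h0 (le_max_right _ _)) this
  rw [one_div_one_div] at h2
  linarith

noncomputable def FH (w : W G) (a : Ch G) (τ : ℝ) : Sig G := Fl (len w) w a (theta (len w) τ)

theorem FH_aux {w : W G} {a : Ch G} {s : G.S} (hs : s ∈ In w) (h1 : a.1 s = 1) (τ : ℝ) :
    FH (w * gen s) a τ = FH w a τ := by
  have hl := len_mul_of_mem w s hs
  unfold FH
  generalize hn : len (w * gen s) = n at hl
  rw [← hl, Fl_compat n w a _ s hl.symm hs h1]
  rcases le_total τ (1 / ((n : ℝ) + 1)) with h | h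
  · rw [Fl_ge _ _ _ (theta_succ_ge h), Fl_ge _ _ _ (theta_ge h).ge]
  · rw [theta_succ h]

theorem FH_compat (w : W G) (a : Ch G) (s : G.S) (h1 : a.1 s = 1) (τ : ℝ) :
    FH (w * gen s) a τ = FH w a τ := by
  by_cases hs : s ∈ In w
  · exact FH_aux hs h1 τ
  · have hs' : s ∈ In (w * gen s) := (mem_In_mul_self w s).2 hs
    have := FH_aux hs' h1 τ
    rw [mul_gen_gen] at this
    exact this.symm

theorem continuous_FH (w : W G) : Continuous fun x : Ch G × ℝ => FH w x.1 x.2 :=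
  (continuous_Fl (len w) w rfl).comp (continuous_fst.prodMk ((continuous_theta _).comp continuous_snd))

noncomputable def FC : Sig G → C(unitInterval, Sig G) :=
  slift (fun w a => ⟨fun τ => FH w a τ, (continuous_FH w).comp
      (continuous_const.prodMk continuous_subtype_val)⟩)
    (fun w a s h => by ext τ; exact FH_compat w a s h τ)

theorem continuous_FC : Continuous (FC (G := G)) := by
  refine continuous_slift _ _ (fun w => ?_)
  refine ContinuousMap.continuous_of_continuous_uncurry _ ?_
  exact (continuous_FH w).comp (continuous_fst.prodMk (continuous_subtype_val.comp continuous_snd))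

theorem FC_zero (z : Sig G) : FC z 0 = z := by
  induction z using ind with | h w a => ?_
  show FH w a 0 = mk w a
  unfold FH
  rw [theta_ge (by positivity), Fl_ge _ _ _ le_rfl]

theorem FC_one (z : Sig G) : FC z 1 = mk 1 (qS (FC z 1)) := by
  have : ∃ b, FC z 1 = mk 1 b := by
    induction z using ind with | h w a => ?_
    show ∃ b, FH w a 1 = mk 1 b
    unfold FH
    have : theta (len w) 1 = 0 := by
      unfold theta
      rw [max_eq_left]
      · norm_num
      · rw [div_le_one (by positivity)]; linarith [(Nat.cast_nonneg (len w) : (0:ℝ) ≤ len w)]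
    rw [this]
    exact Fl_zero_mem _ w a rfl
  obtain ⟨b, hb⟩ := this
  rw [hb, qS_mk]

noncomputable def scl (τ : unitInterval) (a : Ch G) : Ch G :=
  ⟨fun s => (1 - τ.1) * a.1 s, by
    have h0 := τ.2.1
    have h1 := τ.2.2
    refine ⟨fun s => mul_nonneg (by linarith) (a.2.1 s), fun s => ?_, fun s t hst hs ht => ?_⟩
    · have := a.2.1 s; have := a.2.2.1 s
      nlinarith
    · exact a.2.2.2 s t hst (right_ne_zero_of_mul hs) (right_ne_zero_of_mul ht)⟩

instance : ContractibleSpace (Sig G) := by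
  rw [contractible_iff_id_nullhomotopic]
  have h0 : (0 : G.S → ℝ) ∈ Ch G := ⟨by simp, by simp, by simp⟩
  refine ⟨mk 1 ⟨0, h0⟩, ?_⟩
  let f1 : C(Sig G, Sig G) := ⟨fun z => FC z 1, by
    exact (continuous_eval_const (F := C(unitInterval, Sig G)) 1).comp continuous_FC⟩
  have e1 : (ContinuousMap.id (Sig G)).Homotopic f1 := ⟨{
    toFun := fun x => FC x.2 x.1
    continuous_toFun := by
      exact (continuous_FC.comp continuous_snd).eval continuous_fst
    map_zero_left := fun z => FC_zero z
    map_one_left := fun z => rfl }⟩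
  have e2 : f1.Homotopic (ContinuousMap.const _ (mk 1 ⟨0, h0⟩)) := ⟨{
    toFun := fun x => mk 1 (scl x.1 (qS (f1 x.2)))
    continuous_toFun := by
      refine (continuous_mk 1).comp ?_
      refine Continuous.subtype_mk (continuous_pi (fun s => ?_)) _
      have h1 : Continuous fun x : unitInterval × Sig G => qS (f1 x.2) :=
        continuous_qS.comp (f1.continuous.comp continuous_snd)
      refine Continuous.mul ?_ ((continuous_coord s).comp h1)
      exact continuous_const.sub (continuous_subtype_val.comp continuous_fst)
    map_zero_left := fun z => by
      have : scl 0 (qS (f1 z)) = qS (f1 z) := by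
        apply Subtype.ext; funext s; simp [scl]
      simp only [this]
      exact (FC_one z).symm
    map_one_left := fun z => by
      have : scl 1 (qS (f1 z)) = ⟨0, h0⟩ := by
        apply Subtype.ext; funext s; simp [scl]
      simp only [this]
      rfl }⟩
  exact e1.trans e2

end RAM


/-! ### The manifold -/
namespace RAM

variable {G : Gr}

structure KData (G : Gr) (E : Type) [NormedAddCommGroup E] [NormedSpace ℝ E] where
  κ : E → G.S → ℝ
  cont : Continuous κ
  nonneg : ∀ p s, 0 ≤ κ p s
  clq : ∀ p s t, s ≠ t → κ p s ≠ 0 → κ p t ≠ 0 → G.adj s t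
  i : Ch G → E
  icont : Continuous i
  κi : ∀ a, κ (i a) = a.1
  h : ℝ → E → E
  hcont : Continuous fun x : ℝ × E => h x.1 x.2
  κh : ∀ τ p, 0 ≤ τ → τ ≤ 1 → κ (h τ p) = κ p
  h0 : ∀ p, h 0 p = p
  h1 : ∀ p (a : Ch G), κ p = a.1 → h 1 p = i a
  tr : ∀ p, (∀ s, κ p s ≤ 1) → ∃ El : ({s // κ p s = 1} → ℝ) →ₗ[ℝ] E, ∃ U : Set E, IsOpen U ∧ p ∈ U ∧
    ∀ p' ∈ U, ∀ h, p' + El h ∈ U → ∀ s, κ (p' + El h) s.1 = κ p' s.1 + h s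

section Mfd

variable {E : Type} [NormedAddCommGroup E] [NormedSpace ℝ E] [FiniteDimensional ℝ E] (D : KData G E)

def kc (p : E) : Ch G := ⟨fun s => min (D.κ p s) 1, by
  refine ⟨fun s => le_min (D.nonneg p s) zero_le_one, fun s => min_le_right _ _, ?_⟩
  intro s t hst hs ht
  refine D.clq p s t hst ?_ ?_
  · exact fun h => hs (by simp [h])
  · exact fun h => ht (by simp [h])⟩

omit [FiniteDimensional ℝ E] in
theorem continuous_kc : Continuous (kc D) := by
  refine Continuous.subtype_mk (continuous_pi fun s => ?_) _
  exact ((continuous_apply s).comp D.cont).min continuous_const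

def Mf : Type := {x : Sig G × E // (qS x.1).1 = D.κ x.2}

instance : TopologicalSpace (Mf D) := inferInstanceAs (TopologicalSpace {x : Sig G × E // (qS x.1).1 = D.κ x.2})
instance : T2Space (Mf D) := inferInstanceAs (T2Space {x : Sig G × E // (qS x.1).1 = D.κ x.2})

omit [FiniteDimensional ℝ E] in
theorem mem_ch (x : Mf D) : ∀ s, D.κ x.1.2 s ≤ 1 := by
  intro s; rw [← x.2]; exact (qS x.1.1).2.2.1 s

/-- The chart at a point. -/
theorem exists_chart (x0 : Mf D) : ∃ e : OpenPartialHomeomorph (Mf D) E, x0 ∈ e.source := by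
  classical
  obtain ⟨⟨z0, p⟩, hz0⟩ := x0
  obtain ⟨w, a, rfl⟩ : ∃ w a, z0 = mk w a := by
    induction z0 using ind with | h w a => exact ⟨w, a, rfl⟩
  simp only [qS_mk] at hz0
  have hle : ∀ s, D.κ p s ≤ 1 := by rw [← hz0]; exact a.2.2.1
  obtain ⟨El, U, hUo, hpU, hU⟩ := D.tr p hle
  have hTc : Clq {s | D.κ p s = 1} := by
    have := one'_clq a; rw [hz0] at this; exact this
  have hker : LinearMap.ker El = ⊥ := by
    rw [LinearMap.ker_eq_bot']
    intro h hh
    funext s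
    have := hU p hpU h (by rw [hh, add_zero]; exact hpU) s
    rw [hh, add_zero] at this
    simpa using this
  obtain ⟨g, hg⟩ := El.exists_leftInverse_of_injective hker
  have hg' : ∀ h, g (El h) = h := fun h => DFunLike.congr_fun hg h
  have hEc : Continuous El := El.continuous_of_finiteDimensional
  have hgc : Continuous g := g.continuous_of_finiteDimensional
  -- base point, displacement
  let base : E → E := fun q => p + (q - El (g q))
  let hh : E → {s // D.κ p s = 1} → ℝ := fun q s => 1 - |g q s| - D.κ (base q) s.1
  let pt : E → E := fun q => base q + El (hh q)
  have hbc : Continuous base := by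
    exact continuous_const.add (continuous_id.sub (hEc.comp hgc))
  have hhc : Continuous hh := by
    refine continuous_pi (fun s => ?_)
    have h1 : Continuous fun q => g q s := (continuous_apply s).comp hgc
    have h2 : Continuous fun q => D.κ (base q) s.1 := (continuous_apply s.1).comp (D.cont.comp hbc)
    exact (continuous_const.sub h1.abs).sub h2
  have hptc : Continuous pt := hbc.add (hEc.comp hhc)
  let tgt : Set E := {q | base q ∈ U ∧ pt q ∈ U ∧ ∀ s, D.κ p s ≠ 1 → D.κ (pt q) s < 1}
  choose uB huB hchi using fun B : Finset G.S => exists_chi (G := G) B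
  let neg : E → Finset G.S := fun q => Finset.univ.filter (fun s => ∃ h : D.κ p s = 1, g q ⟨s, h⟩ < 0)
  let zz : E → Sig G := fun q => mk (w * uB (neg q)) (kc D (pt q))
  have hκT : ∀ q ∈ tgt, ∀ s, D.κ (pt q) s.1 = 1 - |g q s| := by
    intro q hq s
    have := hU (base q) hq.1 (hh q) hq.2.1 s
    rw [this]; simp only [hh]; ring
  have hκ1 : ∀ q ∈ tgt, ∀ s, D.κ (pt q) s ≤ 1 := by
    intro q hq s
    by_cases h : D.κ p s = 1
    · rw [hκT q hq ⟨s, h⟩]; linarith [abs_nonneg (g q ⟨s, h⟩)]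
    · exact (hq.2.2 s h).le
  have hkc : ∀ q ∈ tgt, (kc D (pt q)).1 = D.κ (pt q) := by
    intro q hq; funext s; exact min_eq_left (hκ1 q hq s)
  let Yw : Sig G → {s // D.κ p s = 1} → ℝ := fun z s => YS s.1 (actS w⁻¹ z)
  have hYc : Continuous Yw := continuous_pi fun s => (continuous_YS s.1).comp (continuous_actS _)
  let Φ : Mf D → E := fun x => (x.1.2 - p) - El (g (x.1.2 - p)) + El (Yw x.1.1)
  have hp2 : Continuous fun x : Mf D => x.1.2 := continuous_snd.comp continuous_subtype_val
  have hp1 : Continuous fun x : Mf D => x.1.1 := continuous_fst.comp continuous_subtype_val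
  have hΦc : Continuous Φ :=
    ((hp2.sub continuous_const).sub (hEc.comp (hgc.comp (hp2.sub continuous_const)))).add
      (hEc.comp (hYc.comp hp1))
  have hgΦ : ∀ x, g (Φ x) = Yw x.1.1 := by
    intro x; simp only [Φ, map_add, map_sub, hg']; abel
  have hbΦ : ∀ x, base (Φ x) = x.1.2 - El (g (x.1.2 - p)) := by
    intro x; simp only [base]; rw [hgΦ]; simp only [Φ]; abel
  let src : Set (Mf D) := {x | 0 < fS w {s | D.κ p s = 1} x.1.1 ∧ x.1.2 ∈ U ∧ x.1.2 - El (g (x.1.2 - p)) ∈ U}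
  -- sign comparison
  have hcmp : ∀ (B : Finset G.S) (v : W G) (b : Ch G), (∀ s ∈ B, D.κ p s = 1) → v ∈ std {s | D.κ p s = 1} →
      (∀ s, D.κ p s = 1 → b.1 s ≠ 1 → ((s ∈ B) ↔ chi s v = -1)) →
      mk (w * uB B) b = mk (w * v) b := by
    intro B v b hB hv hs
    rw [mk_eq]
    refine ⟨rfl, ?_⟩
    have e : (w * uB B)⁻¹ * (w * v) = (uB B)⁻¹ * v := by group
    rw [e]
    refine std_of_chi hTc (mul_mem (inv_mem (std_mono ?_ (huB B))) hv) ?_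
    · exact fun s hs => hB s hs
    · intro s hsb
      have hsb' : b.1 s ≠ 1 := hsb
      by_cases hsT : D.κ p s = 1
      · rw [map_mul, map_inv, hchi]
        have := hs s hsT hsb'
        rcases Int.units_eq_one_or (chi s v) with h | h
        · rw [if_neg (fun h' => by rw [this.1 h'] at h; exact absurd h (by decide)), h]; simp
        · rw [if_pos (this.2 h), h]; simp
      · rw [map_mul, map_inv, hchi, if_neg (fun h => hsT (hB s h)), chi_std hsT hv]; simp
  have hYabs : ∀ z s, |Yw z s| = 1 - (qS z).1 s.1 := by
    intro z s
    induction z using ind with | h v b => ?_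
    simp only [Yw, actS_mk, YS_mk, qS_mk]
    have : 0 ≤ 1 - b.1 s.1 := by linarith [b.2.2.1 s.1]
    rcases Int.units_eq_one_or (chi s.1 (w⁻¹ * v)) with h | h
    · rw [h]; simpa using abs_of_nonneg this
    · rw [h]; simp only [Units.val_neg, Units.val_one, Int.cast_neg, Int.cast_one, neg_mul, one_mul, abs_neg]; exact abs_of_nonneg this
  have hptΦ : ∀ x ∈ src, pt (Φ x) = x.1.2 := by
    intro x hx
    have h1 : hh (Φ x) = g (x.1.2 - p) := by
      funext s
      simp only [hh]
      rw [hgΦ, hbΦ, hYabs, x.2]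
      have := hU _ hx.2.2 (g (x.1.2 - p)) (by rw [sub_add_cancel]; exact hx.2.1) s
      rw [sub_add_cancel] at this
      rw [this]; ring
    simp only [pt]
    rw [h1, hbΦ, sub_add_cancel]
  have hsrctgt : ∀ x ∈ src, Φ x ∈ tgt := by
    intro x hx
    refine ⟨by rw [hbΦ]; exact hx.2.2, by rw [hptΦ x hx]; exact hx.2.1, ?_⟩
    intro s hs
    rw [hptΦ x hx]
    have h1 := hx.1
    refine lt_of_le_of_ne (mem_ch D x s) (fun h => hs ?_)
    obtain ⟨⟨z, p'⟩, hz⟩ := x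
    induction z using ind with | h v b => ?_
    have h2 := (fS_pos.1 h1).2
    simp only [qS_mk] at hz
    rw [hz] at h2
    exact h2 h
  have hmem : ∀ q ∈ tgt, (qS (zz q)).1 = D.κ (pt q) := by
    intro q hq; simp only [zz, qS_mk]; exact hkc q hq
  let Ψ : E → Mf D := fun q => if hq : q ∈ tgt then ⟨(zz q, pt q), hmem q hq⟩ else ⟨(mk w a, p), hz0⟩
  have hΨ : ∀ q (hq : q ∈ tgt), Ψ q = ⟨(zz q, pt q), hmem q hq⟩ := fun q hq => dif_pos hq
  have hYz : ∀ q ∈ tgt, Yw (zz q) = g q := by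
    intro q hq
    funext s
    simp only [Yw, zz, actS_mk, YS_mk, inv_mul_cancel_left]
    rw [hkc q hq, hκT q hq s, hchi]
    have : s.1 ∈ neg q ↔ g q s < 0 := by
      simp only [neg, Finset.mem_filter, Finset.mem_univ, true_and]
      exact ⟨fun ⟨_, h⟩ => h, fun h => ⟨s.2, h⟩⟩
    by_cases h : g q s < 0
    · rw [if_pos (this.2 h), abs_of_neg h]; simp
    · rw [if_neg (fun h' => h (this.1 h')), abs_of_nonneg (not_lt.1 h)]; simp
  have hgpt : ∀ q, g (pt q - p) = hh q := by
    intro q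
    have : pt q - p = (q - El (g q)) + El (hh q) := by simp only [pt, base]; abel
    rw [this, map_add, map_sub, hg', hg']; simp
  have hbpt : ∀ q, pt q - El (g (pt q - p)) = base q := by
    intro q; rw [hgpt]; simp only [pt]; abel
  have htgtsrc : ∀ q ∈ tgt, Ψ q ∈ src := by
    intro q hq
    rw [hΨ q hq]
    refine ⟨?_, hq.2.1, ?_⟩
    · simp only [zz]
      rw [fS_pos]
      refine ⟨?_, ?_⟩
      · rw [inv_mul_cancel_left]
        refine std_mono ?_ (huB _)
        intro s hs
        obtain ⟨h, _⟩ := (Finset.mem_filter.1 hs).2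
        exact h
      · intro s hs
        by_contra h
        have h1 : (kc D (pt q)).1 s = 1 := hs
        rw [hkc q hq] at h1
        exact (hq.2.2 s h).ne h1
    · simp only
      rw [hbpt]; exact hq.1
  refine ⟨{ toFun := Φ
            invFun := Ψ
            source := src
            target := tgt
            map_source' := fun x hx => hsrctgt x hx
            map_target' := fun q hq => htgtsrc q hq
            left_inv' := ?_
            right_inv' := ?_
            open_source := ?_
            open_target := ?_
            continuousOn_toFun := hΦc.continuousOn
            continuousOn_invFun := ?_ }, ?_⟩
  · intro x hx
    rw [hΨ _ (hsrctgt x hx)]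
    apply Subtype.ext
    refine Prod.ext ?_ (hptΦ x hx)
    simp only [zz]
    rw [hptΦ x hx]
    have hneg : neg (Φ x) = Finset.univ.filter (fun s => ∃ h : D.κ p s = 1, Yw x.1.1 ⟨s, h⟩ < 0) := by
      simp only [neg, hgΦ]
    rw [hneg]
    have h1 := hx.1
    have hkx : kc D x.1.2 = qS x.1.1 := by
      apply Subtype.ext
      rw [x.2]; funext s; exact min_eq_left (mem_ch D x s)
    rw [hkx]
    clear hneg hkx hx
    obtain ⟨⟨z, p'⟩, hz⟩ := x
    induction z using ind with | h v b => ?_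
    obtain ⟨h2, h3⟩ := fS_pos.1 h1
    simp only [qS_mk]
    rw [hcmp _ (w⁻¹ * v) b (fun s hs => (Finset.mem_filter.1 hs).2.1) h2 ?_, mul_inv_cancel_left]
    intro s hs hb
    have hb' : 0 < 1 - b.1 s := by
      have := lt_of_le_of_ne (b.2.2.1 s) hb; linarith
    have e : (s ∈ Finset.univ.filter (fun s => ∃ h : D.κ p s = 1, Yw (mk v b) ⟨s, h⟩ < 0)) ↔
        YS s (mk (w⁻¹ * v) b) < 0 := by
      rw [Finset.mem_filter]
      exact ⟨fun h => h.2.2, fun h => ⟨Finset.mem_univ _, hs, h⟩⟩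
    refine Iff.trans e ?_
    rw [YS_mk]
    rcases Int.units_eq_one_or (chi s (w⁻¹ * v)) with h | h
    · rw [h]
      refine iff_of_false ?_ (by decide)
      simp only [Units.val_one, Int.cast_one, one_mul]
      linarith
    · rw [h]
      refine iff_of_true ?_ rfl
      simp only [Units.val_neg, Units.val_one, Int.cast_neg, Int.cast_one, neg_mul, one_mul]
      linarith
  · intro q hq
    rw [hΨ q hq]
    simp only [Φ]
    rw [hYz q hq, hgpt]
    simp only [pt, base]; abel
  · rw [continuousOn_iff_continuous_domRestrict]
    refine Topology.IsInducing.subtypeVal.continuous_iff.2 ?_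
    have hz : Continuous fun q : tgt => zz q.1 := by
      let A : Finset G.S → Set tgt := fun B => {q | (∀ s ∈ B, D.κ p s = 1) ∧ ∀ s : {s // D.κ p s = 1},
        (s.1 ∈ B → g q.1 s ≤ 0) ∧ (s.1 ∉ B → 0 ≤ g q.1 s)}
      have hgs : ∀ s, Continuous fun q : tgt => g q.1 s := fun s =>
        (continuous_apply s).comp (hgc.comp continuous_subtype_val)
      refine LocallyFinite.continuous (f := A) (locallyFinite_of_finite _) ?_ ?_ ?_
      · rw [Set.eq_univ_iff_forall]
        intro q
        rw [Set.mem_iUnion]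
        refine ⟨neg q.1, fun s hs => (Finset.mem_filter.1 hs).2.1, fun s => ⟨fun hs => ?_, fun hs => ?_⟩⟩
        · exact (Finset.mem_filter.1 hs).2.2.le
        · by_contra h
          exact hs (Finset.mem_filter.2 ⟨Finset.mem_univ _, s.2, not_le.1 h⟩)
      · intro B
        by_cases hB : ∀ s ∈ B, D.κ p s = 1
        · have e : A B = ⋂ s : {s // D.κ p s = 1}, {q : tgt | (s.1 ∈ B → g q.1 s ≤ 0) ∧ (s.1 ∉ B → 0 ≤ g q.1 s)} := by
            ext q
            rw [Set.mem_iInter]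
            exact ⟨fun h => h.2, fun h => ⟨hB, h⟩⟩
          rw [e]
          refine isClosed_iInter fun s => ?_
          by_cases hsB : s.1 ∈ B
          · have e2 : {q : tgt | (s.1 ∈ B → g q.1 s ≤ 0) ∧ (s.1 ∉ B → 0 ≤ g q.1 s)} = {q : tgt | g q.1 s ≤ 0} := by
              ext q; exact ⟨fun h => h.1 hsB, fun h => ⟨fun _ => h, fun h' => absurd hsB h'⟩⟩
            rw [e2]; exact isClosed_le (hgs s) continuous_const
          · have e2 : {q : tgt | (s.1 ∈ B → g q.1 s ≤ 0) ∧ (s.1 ∉ B → 0 ≤ g q.1 s)} = {q : tgt | 0 ≤ g q.1 s} := by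
              ext q; exact ⟨fun h => h.2 hsB, fun h => ⟨fun h' => absurd h' hsB, fun _ => h⟩⟩
            rw [e2]; exact isClosed_le continuous_const (hgs s)
        · have e : A B = ∅ := by
            ext q; exact ⟨fun h => hB h.1, fun h => h.elim⟩
          rw [e]; exact isClosed_empty
      · intro B
        have hc : Continuous fun q : tgt => mk (w * uB B) (kc D (pt q.1)) :=
          (continuous_mk _).comp ((continuous_kc D).comp (hptc.comp continuous_subtype_val))
        refine hc.continuousOn.congr ?_
        intro q hq
        symm
        refine hcmp B (uB (neg q.1)) _ hq.1 (std_mono ?_ (huB _)) ?_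
        · intro s hs; exact (Finset.mem_filter.1 hs).2.1
        · intro s hs hb
          have hb2 : g q.1 ⟨s, hs⟩ ≠ 0 := by
            intro h0
            apply hb
            rw [hkc q.1 q.2, hκT q.1 q.2 ⟨s, hs⟩, h0]; simp
          have hm : s ∈ neg q.1 ↔ g q.1 ⟨s, hs⟩ < 0 := by
            rw [Finset.mem_filter]
            exact ⟨fun h => h.2.2, fun h => ⟨Finset.mem_univ _, hs, h⟩⟩
          have e1 : (s ∈ B) ↔ g q.1 ⟨s, hs⟩ < 0 :=
            ⟨fun h => lt_of_le_of_ne ((hq.2 ⟨s, hs⟩).1 h) hb2, fun h => by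
              by_contra h'
              exact absurd h (not_lt.2 ((hq.2 ⟨s, hs⟩).2 h'))⟩
          rw [e1, ← hm, hchi]
          by_cases h : s ∈ neg q.1
          · rw [if_pos h]; exact iff_of_true h rfl
          · rw [if_neg h]; exact iff_of_false h (by decide)
    have e : (Subtype.val ∘ tgt.domRestrict Ψ) = fun q : tgt => (zz q.1, pt q.1) := by
      funext q
      change (Ψ q.1).1 = _
      rw [hΨ q.1 q.2]
    exact e ▸ hz.prodMk (hptc.comp continuous_subtype_val)
  · exact (isOpen_lt continuous_const ((continuous_fS _ _).comp hp1)).inter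
      ((hUo.preimage hp2).inter (hUo.preimage
        (hp2.sub (hEc.comp (hgc.comp (hp2.sub continuous_const))))))
  · have e : tgt = base ⁻¹' U ∩ (pt ⁻¹' U ∩ ⋂ s : {s // D.κ p s ≠ 1}, {q | D.κ (pt q) s.1 < 1}) := by
      ext q
      simp only [tgt, Set.mem_inter_iff, Set.mem_preimage, Set.mem_iInter, Set.mem_ofPred_eq, Subtype.forall]
    rw [e]
    exact (hUo.preimage hbc).inter ((hUo.preimage hptc).inter (isOpen_iInter_of_finite (fun s =>
      isOpen_lt ((continuous_apply s.1).comp (D.cont.comp hptc)) continuous_const)))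
  · refine ⟨?_, hpU, ?_⟩
    · change 0 < fS w _ (mk w a)
      rw [fS_pos]
      refine ⟨by rw [inv_mul_cancel]; exact one_mem _, ?_⟩
      intro s hs
      rw [← hz0]; exact hs
    · change p - El (g (p - p)) ∈ U
      rw [sub_self, map_zero, map_zero, sub_zero]; exact hpU

end Mfd
end RAM


/-! ### Contractibility of the manifold and the action -/
namespace RAM

variable {G : Gr}

section Mfd2

variable {E : Type} [NormedAddCommGroup E] [NormedSpace ℝ E] (D : KData G E)

def mfEquiv : ContinuousMap.HomotopyEquiv (Mf D) (Sig G) where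
  toFun := ⟨fun x => x.1.1, continuous_fst.comp continuous_subtype_val⟩
  invFun := ⟨fun z => ⟨(z, D.i (qS z)), (D.κi _).symm⟩,
    Continuous.subtype_mk (continuous_id.prodMk (D.icont.comp continuous_qS)) _⟩
  right_inv := by
    refine ContinuousMap.Homotopic.refl _
  left_inv := by
    symm
    refine ⟨⟨⟨fun x => ⟨(x.2.1.1, D.h x.1 x.2.1.2), ?_⟩, ?_⟩, ?_, ?_⟩⟩
    · rw [D.κh _ _ x.1.2.1 x.1.2.2]; exact x.2.2
    · refine Continuous.subtype_mk ?_ _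
      have h1 : Continuous fun x : unitInterval × Mf D => x.2.1 :=
        continuous_subtype_val.comp continuous_snd
      refine (continuous_fst.comp h1).prodMk ?_
      exact D.hcont.comp ((continuous_subtype_val.comp continuous_fst).prodMk (continuous_snd.comp h1))
    · intro x
      apply Subtype.ext
      refine Prod.ext rfl ?_
      exact D.h0 _
    · intro x
      apply Subtype.ext
      refine Prod.ext rfl ?_
      exact D.h1 _ _ x.2.symm

theorem contractible_Mf : ContractibleSpace (Mf D) := (mfEquiv D).contractibleSpace

@[reducible] noncomputable def charted_Mf [FiniteDimensional ℝ E] : ChartedSpace E (Mf D) where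
  atlas := Set.range fun x => (exists_chart D x).choose
  chartAt x := (exists_chart D x).choose
  mem_chart_source x := (exists_chart D x).choose_spec
  chart_mem_atlas x := ⟨x, rfl⟩

def actM : W G →* Equiv.Perm (Mf D) where
  toFun w := 
    { toFun := fun x => ⟨(actS w x.1.1, x.1.2), by rw [qS_actS]; exact x.2⟩
      invFun := fun x => ⟨(actS w⁻¹ x.1.1, x.1.2), by rw [qS_actS]; exact x.2⟩
      left_inv := fun x => by
        apply Subtype.ext; refine Prod.ext ?_ rfl
        change actS w⁻¹ (actS w x.1.1) = x.1.1
        rw [actS_actS, inv_mul_cancel, actS_one]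
      right_inv := fun x => by
        apply Subtype.ext; refine Prod.ext ?_ rfl
        change actS w (actS w⁻¹ x.1.1) = x.1.1
        rw [actS_actS, mul_inv_cancel, actS_one] }
  map_one' := by
    ext x; apply Subtype.ext; refine Prod.ext ?_ rfl
    exact actS_one _
  map_mul' w w' := by
    ext x; apply Subtype.ext; refine Prod.ext ?_ rfl
    exact (actS_actS _ _ _).symm

theorem continuous_actM (w : W G) : Continuous (actM D w) := by
  refine Continuous.subtype_mk ?_ _
  exact ((continuous_actS w).comp (continuous_fst.comp continuous_subtype_val)).prodMk
    (continuous_snd.comp continuous_subtype_val)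

theorem proper_actM {K L : Set (Mf D)} (hK : IsCompact K) (hL : IsCompact L) :
    {w | (actM D w '' K ∩ L).Nonempty}.Finite := by
  have hc : Continuous fun x : Mf D => x.1.1 := continuous_fst.comp continuous_subtype_val
  refine (proper_actS (hK.image hc) (hL.image hc)).subset ?_
  rintro w ⟨_, ⟨x, hx, rfl⟩, hy⟩
  exact ⟨actS w x.1.1, ⟨_, ⟨x, hx, rfl⟩, rfl⟩, ⟨_, hy, rfl⟩⟩

end Mfd2
end RAM

theorem actdim_le_of_KData [DecidableEq V] [Fintype V] (L : SCplx V) (d : ℕ)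
    (D : RAM.KData (octGr L) (EuclideanSpace ℝ (Fin d))) : actdim (RAAG L) ≤ (d : ℕ∞) := by
  refine sInf_le ⟨d, rfl, RAM.Mf D, inferInstance, inferInstance, RAM.charted_Mf D,
    (RAM.actM D).comp (raagToCox L), RAM.contractible_Mf D, fun γ => RAM.continuous_actM D _, ?_⟩
  intro K L' hK hL'
  have h1 := (RAM.proper_actM D hK hL').preimage (f := raagToCox L) (raagToCox_injective L).injOn
  exact h1


/-! ### Finitely generated cones -/
namespace RAM

section Cone

variable {X Y : Type*} [AddCommGroup X] [Module ℝ X] [AddCommGroup Y] [Module ℝ Y]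

def cone (F : Finset X) : Set X := {x | ∃ a : X → ℝ, (∀ y, 0 ≤ a y) ∧ x = ∑ y ∈ F, a y • y}

theorem zero_mem_cone (F : Finset X) : (0 : X) ∈ cone F := ⟨fun _ => 0, by simp, by simp⟩

theorem add_mem_cone {F : Finset X} {x y : X} (hx : x ∈ cone F) (hy : y ∈ cone F) : x + y ∈ cone F := by
  obtain ⟨a, ha, rfl⟩ := hx
  obtain ⟨b, hb, rfl⟩ := hy
  exact ⟨fun y => a y + b y, fun y => add_nonneg (ha y) (hb y), by simp [add_smul, Finset.sum_add_distrib]⟩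

theorem smul_mem_cone {F : Finset X} {x : X} {t : ℝ} (ht : 0 ≤ t) (hx : x ∈ cone F) : t • x ∈ cone F := by
  obtain ⟨a, ha, rfl⟩ := hx
  exact ⟨fun y => t * a y, fun y => mul_nonneg ht (ha y), by simp [mul_smul, Finset.smul_sum]⟩

theorem sum_mem_cone {F : Finset X} {ι : Type*} (s : Finset ι) {f : ι → X} (h : ∀ i ∈ s, f i ∈ cone F) :
    ∑ i ∈ s, f i ∈ cone F := by
  classical
  induction s using Finset.induction_on with
  | empty => simpa using zero_mem_cone F
  | insert i s hi ih =>
    rw [Finset.sum_insert hi]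
    exact add_mem_cone (h i (by simp)) (ih fun j hj => h j (by simp [hj]))

theorem mem_cone {F : Finset X} {x : X} (hx : x ∈ F) : x ∈ cone F := by
  classical
  refine ⟨fun y => if y = x then 1 else 0, fun y => by dsimp only; split_ifs <;> norm_num, ?_⟩
  simp [hx]

theorem cone_min {F : Finset X} {S : Set X} (h0 : 0 ∈ S) (ha : ∀ x ∈ S, ∀ y ∈ S, x + y ∈ S)
    (hs : ∀ t : ℝ, 0 ≤ t → ∀ x ∈ S, t • x ∈ S) (hF : ∀ x ∈ F, x ∈ S) : cone F ⊆ S := by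
  classical
  rintro x ⟨a, ha', rfl⟩
  have : ∀ F' ⊆ F, ∑ y ∈ F', a y • y ∈ S := by
    intro F'
    induction F' using Finset.induction_on with
    | empty => intro _; simpa using h0
    | insert i s hi ih =>
      intro h
      rw [Finset.sum_insert hi]
      exact ha _ (hs _ (ha' i) _ (hF i (h (by simp)))) _ (ih fun j hj => h (by simp [hj]))
  exact this F subset_rfl

theorem cone_mono {F F' : Finset X} (h : F ⊆ F') : cone F ⊆ cone F' :=
  cone_min (zero_mem_cone _) (fun _ h _ h' => add_mem_cone h h') (fun _ ht _ h => smul_mem_cone ht h)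
    (fun _ hx => mem_cone (h hx))

theorem mem_cone_image [DecidableEq Y] (f : X →ₗ[ℝ] Y) (F : Finset X) {y : Y} :
    y ∈ cone (F.image f) ↔ ∃ x ∈ cone F, f x = y := by
  constructor
  · intro h
    refine cone_min (S := {y | ∃ x ∈ cone F, f x = y}) ⟨0, zero_mem_cone _, by simp⟩ ?_ ?_ ?_ h
    · rintro _ ⟨x, hx, rfl⟩ _ ⟨x', hx', rfl⟩
      exact ⟨x + x', add_mem_cone hx hx', by simp⟩
    · rintro t ht _ ⟨x, hx, rfl⟩
      exact ⟨t • x, smul_mem_cone ht hx, by simp⟩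
    · intro y hy
      obtain ⟨x, hx, rfl⟩ := Finset.mem_image.1 hy
      exact ⟨x, mem_cone hx, rfl⟩
  · rintro ⟨x, hx, rfl⟩
    refine cone_min (S := {x | f x ∈ cone (F.image f)}) ?_ ?_ ?_ ?_ hx
    · simpa using zero_mem_cone _
    · intro x hx y hy
      simpa using add_mem_cone hx hy
    · intro t ht x hx
      simpa using smul_mem_cone ht hx
    · intro x hx
      exact mem_cone (Finset.mem_image_of_mem _ hx)

theorem mem_cone_insert [DecidableEq X] {F : Finset X} {v x : X} :
    x ∈ cone (insert v F) ↔ ∃ t : ℝ, 0 ≤ t ∧ x - t • v ∈ cone F := by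
  constructor
  · intro h
    refine cone_min (S := {x | ∃ t : ℝ, 0 ≤ t ∧ x - t • v ∈ cone F}) ⟨0, le_rfl, by simpa using zero_mem_cone _⟩ ?_ ?_ ?_ h
    · rintro x ⟨t, ht, hx⟩ y ⟨t', ht', hy⟩
      refine ⟨t + t', add_nonneg ht ht', ?_⟩
      have := add_mem_cone hx hy
      have e : x + y - (t + t') • v = x - t • v + (y - t' • v) := by rw [add_smul]; abel
      rwa [e]
    · rintro r hr x ⟨t, ht, hx⟩
      refine ⟨r * t, mul_nonneg hr ht, ?_⟩
      have := smul_mem_cone hr hx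
      rwa [smul_sub, smul_smul] at this
    · intro x hx
      rcases Finset.mem_insert.1 hx with rfl | hx
      · exact ⟨1, zero_le_one, by simpa using zero_mem_cone _⟩
      · exact ⟨0, le_rfl, by simpa using mem_cone hx⟩
  · rintro ⟨t, ht, h⟩
    have := add_mem_cone (cone_mono (Finset.subset_insert v F) h) (smul_mem_cone ht (mem_cone (Finset.mem_insert_self v F)))
    simpa using this

/-- Fourier-Motzkin elimination: a finitely generated cone is a finite intersection of halfspaces. -/
theorem exists_halfspaces [FiniteDimensional ℝ X] (F : Finset X) :
    ∃ J : Finset (X →ₗ[ℝ] ℝ), ∀ p, p ∈ cone F ↔ ∀ l ∈ J, 0 ≤ l p := by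
  classical
  induction F using Finset.induction_on with
  | empty =>
    let b := Module.finBasis ℝ X
    refine ⟨Finset.univ.image (fun i => b.coord i) ∪ Finset.univ.image (fun i => -b.coord i), fun p => ?_⟩
    constructor
    · rintro ⟨a, -, rfl⟩ l _; simp
    · intro h
      have : p = 0 := by
        rw [← b.forall_coord_eq_zero_iff]
        intro i
        have h1 := h (b.coord i) (Finset.mem_union_left _ (Finset.mem_image_of_mem _ (Finset.mem_univ i)))
        have h2 := h (-b.coord i) (Finset.mem_union_right _ (Finset.mem_image_of_mem (fun i => -b.coord i) (Finset.mem_univ i)))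
        rw [LinearMap.neg_apply] at h2
        linarith
      rw [this]; exact zero_mem_cone _
  | insert v F hv ih =>
    obtain ⟨J, hJ⟩ := ih
    refine ⟨J.filter (fun l => 0 ≤ l v) ∪ Finset.image₂ (fun l l' => l v • l' - l' v • l)
      (J.filter (fun l => 0 < l v)) (J.filter (fun l => l v < 0)), fun p => ?_⟩
    have key : p ∈ cone (insert v F) ↔ ∃ t : ℝ, 0 ≤ t ∧ ∀ l ∈ J, t * l v ≤ l p := by
      rw [mem_cone_insert]
      refine exists_congr fun t => and_congr_right fun _ => ?_
      rw [hJ]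
      refine forall₂_congr fun l _ => ?_
      rw [map_sub, map_smul, smul_eq_mul, sub_nonneg]
    rw [key]
    constructor
    · rintro ⟨t, ht, h⟩ l hl
      rcases Finset.mem_union.1 hl with hl | hl
      · obtain ⟨h1, h2⟩ := Finset.mem_filter.1 hl
        exact le_trans (mul_nonneg ht h2) (h l h1)
      · obtain ⟨l1, h1, l2, h2, rfl⟩ := Finset.mem_image₂.1 hl
        obtain ⟨h1, h1'⟩ := Finset.mem_filter.1 h1
        obtain ⟨h2, h2'⟩ := Finset.mem_filter.1 h2
        have e1 := h l1 h1
        have e2 := h l2 h2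
        simp only [LinearMap.sub_apply, LinearMap.smul_apply, smul_eq_mul]
        nlinarith
    · intro h
      let T := insert 0 ((J.filter (fun l => l v < 0)).image (fun l => l p / l v))
      have hT : T.Nonempty := ⟨0, by simp [T]⟩
      refine ⟨T.max' hT, T.le_max' 0 (by simp [T]), fun l hl => ?_⟩
      rcases lt_trichotomy (l v) 0 with hv | hv | hv
      · have : l p / l v ≤ T.max' hT := T.le_max' _ (Finset.mem_insert_of_mem
          (Finset.mem_image_of_mem (fun l : X →ₗ[ℝ] ℝ => l p / l v) (Finset.mem_filter.2 ⟨hl, hv⟩)))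
        rwa [div_le_iff_of_neg hv] at this
      · rw [hv, mul_zero]
        exact h l (Finset.mem_union_left _ (Finset.mem_filter.2 ⟨hl, hv.ge⟩))
      · have hpos := h l (Finset.mem_union_left _ (Finset.mem_filter.2 ⟨hl, hv.le⟩))
        rw [← le_div_iff₀ hv]
        refine Finset.max'_le _ _ _ fun y hy => ?_
        rcases Finset.mem_insert.1 hy with rfl | hy
        · exact div_nonneg hpos hv.le
        · obtain ⟨l', hl', rfl⟩ := Finset.mem_image.1 hy
          obtain ⟨hl', hv'⟩ := Finset.mem_filter.1 hl'
          have := h (l v • l' - l' v • l) (Finset.mem_union_right _ (Finset.mem_image₂.2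
            ⟨l, Finset.mem_filter.2 ⟨hl, hv⟩, l', Finset.mem_filter.2 ⟨hl', hv'⟩, rfl⟩))
          simp only [LinearMap.sub_apply, LinearMap.smul_apply, smul_eq_mul] at this
          rw [div_le_iff_of_neg hv', div_mul_eq_mul_div, div_le_iff₀ hv]
          nlinarith

end Cone
end RAM


/-! ### Barycentric coordinates of a hyperplane arrangement -/
namespace RAM

theorem continuous_inv_of_proper {X Y : Type*} [TopologicalSpace X] [TopologicalSpace Y] [T2Space Y]
    [WeaklyLocallyCompactSpace Y] {f : X → Y} {g : Y → X} (hf : Continuous f) (hfg : ∀ y, f (g y) = y)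
    (hgf : ∀ x, g (f x) = x) (hp : ∀ K, IsCompact K → IsCompact (f ⁻¹' K)) : Continuous g := by
  have h : IsProperMap f := isProperMap_iff_isCompact_preimage.2 ⟨hf, fun {K} hK => hp K hK⟩
  let e : X ≃ Y := ⟨f, g, hgf, hfg⟩
  exact (e.toHomeomorphOfContinuousClosed hf h.isClosedMap).symm.continuous

section Fan

variable {E : Type*} [NormedAddCommGroup E] [NormedSpace ℝ E] {ι : Type*} [Fintype ι]
  (l : ι → E →ₗ[ℝ] ℝ)

noncomputable def sgn (p : E) : ι → SignType := fun j => SignType.sign (l j p)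

def sle (σ τ : ι → SignType) : Prop := ∀ j, σ j = 0 ∨ σ j = τ j

omit [Fintype ι] in
theorem sle_refl (σ : ι → SignType) : sle σ σ := fun _ => Or.inr rfl

omit [Fintype ι] in
theorem sle_trans {σ τ ρ : ι → SignType} (h : sle σ τ) (h' : sle τ ρ) : sle σ ρ := by
  intro j
  rcases h j with h | h
  · exact Or.inl h
  · rw [h]; exact h' j

def Fp : Type _ := {σ : ι → SignType // ∃ p : E, p ≠ 0 ∧ sgn l p = σ}

noncomputable instance : Fintype (Fp l) := by
  classical
  exact inferInstanceAs (Fintype {σ : ι → SignType // ∃ p : E, p ≠ 0 ∧ sgn l p = σ})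

noncomputable def bb (σ : Fp l) : E := σ.2.choose

omit [Fintype ι] in
theorem bb_ne (σ : Fp l) : bb l σ ≠ 0 := σ.2.choose_spec.1

omit [Fintype ι] in
theorem sgn_bb (σ : Fp l) (j : ι) : SignType.sign (l j (bb l σ)) = σ.1 j :=
  congrFun σ.2.choose_spec.2 j

def Bx : Set (Fp l → ℝ) := {x | (∀ σ, 0 ≤ x σ) ∧ ∀ σ τ, x σ ≠ 0 → x τ ≠ 0 → sle σ.1 τ.1 ∨ sle τ.1 σ.1}

noncomputable def Lam (x : Fp l → ℝ) : E := ∑ σ, x σ • bb l σ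

omit [Fintype ι] in
theorem Bx_of_supp {x y : Fp l → ℝ} (hx : x ∈ Bx l) (hy : ∀ σ, 0 ≤ y σ) (h : ∀ σ, x σ = 0 → y σ = 0) : y ∈ Bx l :=
  ⟨hy, fun σ τ hs ht => hx.2 σ τ (fun h' => hs (h _ h')) (fun h' => ht (h _ h'))⟩

/-- All terms of a chain have compatible signs. -/
theorem Bx_sign {x : Fp l → ℝ} (hx : x ∈ Bx l) {σ : Fp l} (hs : x σ ≠ 0) {j : ι} (hj : σ.1 j ≠ 0) :
    ∃ ε : ℝ, (ε = 1 ∧ σ.1 j = 1 ∨ ε = -1 ∧ σ.1 j = -1) ∧ 0 < ε * l j (bb l σ) ∧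
      x σ * (ε * l j (bb l σ)) ≤ ε * l j (Lam l x) := by
  obtain ⟨ε, hε⟩ : ∃ ε : ℝ, (ε = 1 ∧ σ.1 j = 1 ∨ ε = -1 ∧ σ.1 j = -1) := by
    rcases SignType.trichotomy (σ.1 j) with h | h | h
    · exact ⟨-1, Or.inr ⟨rfl, h⟩⟩
    · exact absurd h hj
    · exact ⟨1, Or.inl ⟨rfl, h⟩⟩
  have h1 : ∀ τ : Fp l, τ.1 j = σ.1 j → 0 < ε * l j (bb l τ) := by
    intro τ ht
    have := sgn_bb l τ j
    rw [ht] at this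
    rcases hε with ⟨rfl, h⟩ | ⟨rfl, h⟩
    · rw [h, sign_eq_one_iff] at this; linarith
    · rw [h, sign_eq_neg_one_iff] at this; linarith
  have h2 : ∀ τ, 0 ≤ x τ * (ε * l j (bb l τ)) := by
    intro τ
    by_cases ht : x τ = 0
    · rw [ht, zero_mul]
    · refine mul_nonneg (hx.1 τ) ?_
      by_cases h0 : τ.1 j = 0
      · have := sgn_bb l τ j
        rw [h0, sign_eq_zero_iff] at this
        rw [this, mul_zero]
      · refine (h1 τ ?_).le
        rcases hx.2 σ τ hs ht with h | h
        · exact ((h j).resolve_left hj).symm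
        · exact (h j).resolve_left h0
  refine ⟨ε, hε, h1 σ rfl, ?_⟩
  have : ε * l j (Lam l x) = ∑ τ, x τ * (ε * l j (bb l τ)) := by
    rw [Lam, map_sum, Finset.mul_sum]
    refine Finset.sum_congr rfl fun τ _ => ?_
    rw [map_smul, smul_eq_mul]; ring
  rw [this]
  exact Finset.single_le_sum (f := fun τ => x τ * (ε * l j (bb l τ))) (fun τ _ => h2 τ) (Finset.mem_univ σ)

theorem Bx_sle {x : Fp l → ℝ} (hx : x ∈ Bx l) {σ : Fp l} (hs : x σ ≠ 0) : sle σ.1 (sgn l (Lam l x)) := by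
  intro j
  by_cases hj : σ.1 j = 0
  · exact Or.inl hj
  · right
    obtain ⟨ε, hε, h1, h2⟩ := Bx_sign l hx hs hj
    have h3 : 0 < ε * l j (Lam l x) := lt_of_lt_of_le (mul_pos (lt_of_le_of_ne (hx.1 σ) (Ne.symm hs)) h1) h2
    rcases hε with ⟨rfl, h⟩ | ⟨rfl, h⟩
    · rw [h]; symm; exact sign_eq_one_iff.2 (by linarith)
    · rw [h]; symm; exact sign_eq_neg_one_iff.2 (by linarith)

theorem sle_max (s : Finset (Fp l)) (hs : s.Nonempty) (hc : ∀ σ ∈ s, ∀ τ ∈ s, sle σ.1 τ.1 ∨ sle τ.1 σ.1) :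
    ∃ σ ∈ s, ∀ τ ∈ s, sle τ.1 σ.1 := by
  classical
  obtain ⟨σ, h1, h2⟩ := s.exists_max_image (fun σ => (Finset.univ.filter (fun j => σ.1 j ≠ 0)).card) hs
  refine ⟨σ, h1, fun τ ht => ?_⟩
  rcases hc τ ht σ h1 with h | h
  · exact h
  · have hsub : Finset.univ.filter (fun j => σ.1 j ≠ 0) ⊆ Finset.univ.filter (fun j => τ.1 j ≠ 0) := by
      intro j hj
      rw [Finset.mem_filter] at hj ⊢
      refine ⟨hj.1, ?_⟩
      rw [← (h j).resolve_left hj.2]; exact hj.2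
    have heq := Finset.eq_of_subset_of_card_le hsub (h2 τ ht)
    intro j
    by_cases hj : τ.1 j = 0
    · exact Or.inl hj
    · right
      have : j ∈ Finset.univ.filter (fun j => σ.1 j ≠ 0) := by rw [heq]; simpa using hj
      exact ((h j).resolve_left (Finset.mem_filter.1 this).2).symm

theorem Bx_max {x : Fp l → ℝ} (hx : x ∈ Bx l) (h0 : ∃ σ, x σ ≠ 0) : ∃ σ : Fp l, x σ ≠ 0 ∧ σ.1 = sgn l (Lam l x) := by
  classical
  obtain ⟨σ0, hσ0⟩ := h0
  obtain ⟨σ, hs, hm⟩ := sle_max l (Finset.univ.filter (fun σ => x σ ≠ 0)) ⟨σ0, by simpa using hσ0⟩ (by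
    intro σ hs τ ht
    exact hx.2 σ τ (Finset.mem_filter.1 hs).2 (Finset.mem_filter.1 ht).2)
  have hs' := (Finset.mem_filter.1 hs).2
  refine ⟨σ, hs', ?_⟩
  funext j
  rcases Bx_sle l hx hs' j with h | h
  · rw [h]
    symm
    rw [sgn, sign_eq_zero_iff, Lam, map_sum]
    refine Finset.sum_eq_zero fun τ _ => ?_
    by_cases ht : x τ = 0
    · rw [ht, zero_smul, map_zero]
    · have h4 : τ.1 j = 0 := by
        rcases hm τ (by simpa using ht) j with h' | h'
        · exact h'
        · rw [h', h]
      have := sgn_bb l τ j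
      rw [h4, sign_eq_zero_iff] at this
      rw [map_smul, this, smul_zero]
  · exact h

variable (hl : ∀ p, (∀ j, l j p = 0) → p = 0)
include hl

omit [Fintype ι] in
theorem exists_ne (σ : Fp l) : ∃ j, σ.1 j ≠ 0 := by
  by_contra! h
  refine bb_ne l σ (hl _ fun j => ?_)
  have := sgn_bb l σ j
  rwa [h, sign_eq_zero_iff] at this

theorem Bx_zero {x : Fp l → ℝ} (hx : x ∈ Bx l) (h : Lam l x = 0) (σ : Fp l) : x σ = 0 := by
  by_contra hs
  obtain ⟨j, hj⟩ := exists_ne l hl σ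
  rcases Bx_sle l hx hs j with h' | h'
  · exact hj h'
  · rw [h] at h'
    simp [sgn] at h'
    exact hj h'

theorem Lam_inj : ∀ (n : ℕ) (x y : Fp l → ℝ), x ∈ Bx l → y ∈ Bx l → Lam l x = Lam l y →
    (open Classical in (Finset.univ.filter (fun σ => x σ ≠ 0)).card + (Finset.univ.filter (fun σ => y σ ≠ 0)).card ≤ n) → x = y := by
  classical
  intro n
  induction n with
  | zero =>
    intro x y _ _ _ hn
    have h1 : (Finset.univ.filter (fun σ => x σ ≠ 0)) = ∅ := Finset.card_eq_zero.1 (by omega)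
    have h2 : (Finset.univ.filter (fun σ => y σ ≠ 0)) = ∅ := Finset.card_eq_zero.1 (by omega)
    funext σ
    have h3 := Finset.filter_eq_empty_iff.1 h1 (Finset.mem_univ σ)
    have h4 := Finset.filter_eq_empty_iff.1 h2 (Finset.mem_univ σ)
    simp only [not_not] at h3 h4
    rw [h3, h4]
  | succ n ih =>
    intro x y hx hy hxy hn
    by_cases h0 : Lam l x = 0
    · funext σ
      rw [Bx_zero l hl hx h0, Bx_zero l hl hy (hxy ▸ h0)]
    · have hne : ∀ z : Fp l → ℝ, Lam l z ≠ 0 → ∃ σ, z σ ≠ 0 := by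
        intro z hz
        by_contra! h
        exact hz (by simp [Lam, h])
      obtain ⟨σ, hs, hs'⟩ := Bx_max l hx (hne x h0)
      obtain ⟨τ, ht, ht'⟩ := Bx_max l hy (hne y (hxy ▸ h0))
      obtain rfl : σ = τ := Subtype.ext (by rw [hs', ht', hxy])
      let m := min (x σ) (y σ)
      let D : (Fp l → ℝ) → Fp l → ℝ := fun z ρ => if ρ = σ then z ρ - m else z ρ
      have hLD : ∀ z, Lam l (D z) = Lam l z - m • bb l σ := by
        intro z
        have : ∀ ρ, D z ρ • bb l ρ = z ρ • bb l ρ - (if ρ = σ then m • bb l ρ else 0) := by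
          intro ρ
          simp only [D]
          split_ifs
          · rw [sub_smul]
          · rw [sub_zero]
        simp only [Lam, this, Finset.sum_sub_distrib]
        simp
      have hm : 0 ≤ m := le_min (hx.1 σ) (hy.1 σ)
      have hmx : ∀ z : Fp l → ℝ, z ∈ Bx l → m ≤ z σ → z σ ≠ 0 → D z ∈ Bx l := by
        intro z hz hmz hz0
        refine Bx_of_supp l hz ?_ ?_
        · intro ρ; simp only [D]; split_ifs with h
          · rw [h]; linarith
          · exact hz.1 ρ
        · intro ρ hρ; simp only [D]; split_ifs with h
          · rw [h] at hρ; exact absurd hρ hz0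
          · exact hρ
      have hsub : ∀ z : Fp l → ℝ, z σ ≠ 0 → Finset.univ.filter (fun ρ => D z ρ ≠ 0) ⊆ Finset.univ.filter (fun ρ => z ρ ≠ 0) := by
        intro z hz ρ hρ
        rw [Finset.mem_filter] at hρ ⊢
        refine ⟨hρ.1, fun h => ?_⟩
        have := hρ.2
        simp only [D] at this
        split_ifs at this with h'
        · rw [h'] at h; exact hz h
        · exact this h
      have hlt : ∀ z : Fp l → ℝ, z σ ≠ 0 → m = z σ → (Finset.univ.filter (fun ρ => D z ρ ≠ 0)).card < (Finset.univ.filter (fun ρ => z ρ ≠ 0)).card := by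
        intro z hz hmz
        refine Finset.card_lt_card ⟨hsub z hz, fun h => ?_⟩
        have := h (show σ ∈ _ by simpa using hz)
        simp [D, hmz] at this
      have key : D x = D y := by
        refine ih _ _ (hmx x hx (min_le_left _ _) hs) (hmx y hy (min_le_right _ _) ht) (by rw [hLD, hLD, hxy]) ?_
        have a1 := Finset.card_le_card (hsub x hs)
        have a2 := Finset.card_le_card (hsub y ht)
        rcases min_choice (x σ) (y σ) with h | h
        · have := hlt x hs h; omega
        · have := hlt y ht h; omega
      funext ρ
      have := congrFun key ρ
      simp only [D] at this
      split_ifs at this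
      · linarith
      · exact this

theorem Lam_surj : ∀ (n : ℕ) (p : E), 
    (open Classical in (Finset.univ.filter (fun j => l j p ≠ 0)).card ≤ n) →
    ∃ x ∈ Bx l, Lam l x = p ∧ ∀ σ, x σ ≠ 0 → sle σ.1 (sgn l p) := by
  classical
  intro n
  have hz : ∃ x ∈ Bx l, Lam l x = 0 ∧ ∀ σ, x σ ≠ 0 → sle σ.1 (sgn l (0 : E)) :=
    ⟨0, ⟨fun _ => le_rfl, fun _ _ h => absurd rfl h⟩, by simp [Lam], fun _ h => absurd rfl h⟩
  induction n with
  | zero =>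
    intro p hp
    have : p = 0 := by
      refine hl p fun j => ?_
      have h1 := Finset.card_eq_zero.1 (Nat.le_zero.1 hp)
      have := Finset.filter_eq_empty_iff.1 h1 (Finset.mem_univ j)
      simpa using this
    rw [this]; exact hz
  | succ n ih =>
    intro p hp
    by_cases h0 : p = 0
    · rw [h0]; exact hz
    let σ : Fp l := ⟨sgn l p, p, h0, rfl⟩
    have hσ : ∀ j, SignType.sign (l j (bb l σ)) = SignType.sign (l j p) := fun j => sgn_bb l σ j
    let N := Finset.univ.filter (fun j => l j p ≠ 0)
    have hN : N.Nonempty := by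
      by_contra h
      rw [Finset.not_nonempty_iff_eq_empty] at h
      refine h0 (hl p fun j => ?_)
      have := Finset.filter_eq_empty_iff.1 h (Finset.mem_univ j)
      simpa using this
    obtain ⟨j0, hj0, hmin⟩ := N.exists_min_image (fun j => l j p / l j (bb l σ)) hN
    have hpos : ∀ j, l j p ≠ 0 → 0 < l j p / l j (bb l σ) := by
      intro j hj
      have := hσ j
      rcases lt_or_gt_of_ne hj with h | h
      · rw [sign_neg h, sign_eq_neg_one_iff] at this
        exact div_pos_of_neg_of_neg h this
      · rw [sign_pos h, sign_eq_one_iff] at this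
        exact div_pos h this
    let t := l j0 p / l j0 (bb l σ)
    have ht : 0 < t := hpos j0 (Finset.mem_filter.1 hj0).2
    have hb0 : ∀ j, l j p = 0 → l j (bb l σ) = 0 := by
      intro j hj
      have := hσ j
      rwa [hj, sign_zero, sign_eq_zero_iff] at this
    let p' := p - t • bb l σ
    have hlp : ∀ j, l j p' = l j p - t * l j (bb l σ) := fun j => by
      simp only [p', map_sub, map_smul, smul_eq_mul]
    have hle : sle (sgn l p') (sgn l p) := by
      intro j
      simp only [sgn]
      by_cases hj : l j p = 0
      · left; rw [hlp, hj, hb0 j hj]; simp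
      · have h1 : t ≤ l j p / l j (bb l σ) := hmin j (by simpa [N] using hj)
        have h2 := hσ j
        rcases lt_or_gt_of_ne hj with h | h
        · rw [sign_neg h, sign_eq_neg_one_iff] at h2
          rw [le_div_iff_of_neg h2] at h1
          have h3 : l j p' ≤ 0 := by rw [hlp]; linarith
          rcases h3.eq_or_lt with h3 | h3
          · left; rw [h3, sign_zero]
          · right; rw [sign_neg h3, sign_neg h]
        · rw [sign_pos h, sign_eq_one_iff] at h2
          rw [le_div_iff₀ h2] at h1
          have h3 : 0 ≤ l j p' := by rw [hlp]; linarith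
          rcases h3.eq_or_lt with h3 | h3
          · left; rw [← h3, sign_zero]
          · right; rw [sign_pos h3, sign_pos h]
    have hlt : (Finset.univ.filter (fun j => l j p' ≠ 0)).card < (Finset.univ.filter (fun j => l j p ≠ 0)).card := by
      refine Finset.card_lt_card ⟨fun j hj => ?_, fun h => ?_⟩
      · rw [Finset.mem_filter] at hj ⊢
        refine ⟨hj.1, fun h => hj.2 ?_⟩
        rw [hlp, h, hb0 j h]; simp
      · have := h hj0
        rw [Finset.mem_filter] at this
        apply this.2
        rw [hlp]
        have hb : l j0 (bb l σ) ≠ 0 := by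
          intro h
          have : t = 0 := by simp only [t, h, div_zero]
          exact ht.ne' this
        simp only [t]
        field_simp
        ring
    obtain ⟨x, hx, hxp, hxs⟩ := ih p' (by omega)
    have hsle : ∀ τ : Fp l, x τ + (if τ = σ then t else 0) ≠ 0 → sle τ.1 σ.1 := by
      intro τ h
      by_cases hτ : τ = σ
      · rw [hτ]; exact sle_refl _
      · rw [if_neg hτ, add_zero] at h
        exact sle_trans (hxs τ h) hle
    refine ⟨fun τ => x τ + if τ = σ then t else 0, ⟨?_, ?_⟩, ?_, hsle⟩
    · intro τ
      dsimp only
      have := hx.1 τ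
      split_ifs <;> linarith
    · intro τ ρ h1 h2
      by_cases hτ : τ = σ
      · right; rw [hτ]; exact hsle ρ h2
      · by_cases hρ : ρ = σ
        · left; rw [hρ]; exact hsle τ h1
        · simp only [if_neg hτ, if_neg hρ, add_zero] at h1 h2
          exact hx.2 τ ρ h1 h2
    · simp only [Lam, add_smul, Finset.sum_add_distrib] at hxp ⊢
      rw [hxp]
      simp [p']

end Fan
end RAM


namespace RAM

section Fan2

variable {E : Type*} [NormedAddCommGroup E] [NormedSpace ℝ E] {ι : Type*} [Fintype ι]
  (l : ι → E →ₗ[ℝ] ℝ)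

omit [Fintype ι] in
theorem Bx_closed [Finite ι] : IsClosed (Bx l) := by
  have e : Bx l = (⋂ σ, {x : Fp l → ℝ | 0 ≤ x σ}) ∩
      ⋂ σ : Fp l, ⋂ τ : Fp l, {x : Fp l → ℝ | x σ ≠ 0 → x τ ≠ 0 → sle σ.1 τ.1 ∨ sle τ.1 σ.1} := by
    ext x; simp only [Bx, Set.mem_inter_iff, Set.mem_iInter, Set.mem_ofPred_eq]
  rw [e]
  refine (isClosed_iInter fun σ => isClosed_le continuous_const (continuous_apply σ)).inter
    (isClosed_iInter fun σ => isClosed_iInter fun τ => ?_)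
  by_cases h : sle σ.1 τ.1 ∨ sle τ.1 σ.1
  · have : {x : Fp l → ℝ | x σ ≠ 0 → x τ ≠ 0 → sle σ.1 τ.1 ∨ sle τ.1 σ.1} = Set.univ := by
      ext x; exact ⟨fun _ => trivial, fun _ _ _ => h⟩
    rw [this]; exact isClosed_univ
  · have : {x : Fp l → ℝ | x σ ≠ 0 → x τ ≠ 0 → sle σ.1 τ.1 ∨ sle τ.1 σ.1} = {x : Fp l → ℝ | x σ = 0} ∪ {x | x τ = 0} := by
      ext x
      constructor
      · intro hx
        by_contra h'
        have h1 : x σ ≠ 0 := fun h2 => h' (Or.inl h2)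
        have h2 : x τ ≠ 0 := fun h2 => h' (Or.inr h2)
        exact h (hx h1 h2)
      · rintro (hx | hx) h1 h2
        · exact absurd hx h1
        · exact absurd hx h2
    rw [this]
    exact (isClosed_eq (continuous_apply σ) continuous_const).union (isClosed_eq (continuous_apply τ) continuous_const)

theorem exists_coords [FiniteDimensional ℝ E] (hl : ∀ p, (∀ j, l j p = 0) → p = 0) :
    ∃ X : E → Fp l → ℝ, Continuous X ∧ (∀ p, X p ∈ Bx l) ∧ (∀ p, Lam l (X p) = p) ∧
      ∀ x ∈ Bx l, X (Lam l x) = x := by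
  have : ProperSpace E := FiniteDimensional.proper_real E
  choose X hX hLX _ using fun p => Lam_surj l hl _ p le_rfl
  have hXL : ∀ x ∈ Bx l, X (Lam l x) = x := fun x hx => Lam_inj l hl _ _ _ (hX _) hx (hLX _) le_rfl
  refine ⟨X, ?_, hX, hLX, hXL⟩
  have hLc : Continuous (Lam l) := by
    unfold Lam
    exact continuous_finsetSum _ fun σ _ => (continuous_apply σ).smul continuous_const
  have key : Continuous fun p => (⟨X p, hX p⟩ : Bx l) := by
    refine continuous_inv_of_proper (f := fun x : Bx l => Lam l x.1) (hLc.comp continuous_subtype_val) hLX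
      (fun x => Subtype.ext (hXL x.1 x.2)) ?_
    intro K hK
    choose j hj using exists_ne l hl
    have hlc : ∀ j, Continuous (l j) := fun j => (l j).continuous_of_finiteDimensional
    choose C hC using fun σ : Fp l => hK.exists_bound_of_continuousOn (f := fun p => l (j σ) p) (hlc (j σ)).continuousOn
    have hcomp : IsCompact (Set.pi Set.univ fun σ : Fp l => Set.Icc (0:ℝ) (max 0 (C σ / |l (j σ) (bb l σ)|))) :=
      isCompact_univ_pi fun σ => isCompact_Icc
    rw [Topology.IsEmbedding.subtypeVal.isCompact_iff]
    refine hcomp.of_isClosed_subset ?_ ?_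
    · have e : (Subtype.val '' ((fun x : Bx l => Lam l x.1) ⁻¹' K) : Set (Fp l → ℝ)) = Bx l ∩ Lam l ⁻¹' K := by
        ext x
        constructor
        · rintro ⟨y, hy, rfl⟩; exact ⟨y.2, hy⟩
        · rintro ⟨h1, h2⟩; exact ⟨⟨x, h1⟩, h2, rfl⟩
      rw [e]
      exact (Bx_closed l).inter (hK.isClosed.preimage hLc)
    · rintro _ ⟨x, hx, rfl⟩ σ _
      refine ⟨x.2.1 σ, ?_⟩
      by_cases hs : x.1 σ = 0
      · rw [hs]; exact le_max_left _ _
      · refine le_trans ?_ (le_max_right _ _)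
        obtain ⟨ε, hε, h1, h2⟩ := Bx_sign l x.2 hs (hj σ)
        have h3 := hC σ _ hx
        rw [Real.norm_eq_abs] at h3
        have hab : ∀ r : ℝ, |ε * r| = |r| := by
          intro r; rcases hε with ⟨rfl, _⟩ | ⟨rfl, _⟩ <;> simp
        have h4 : |l (j σ) (bb l σ)| = ε * l (j σ) (bb l σ) := by rw [← hab, abs_of_pos h1]
        rw [h4, le_div_iff₀ h1]
        exact h2.trans ((le_abs_self _).trans ((hab _).le.trans h3))
  exact continuous_subtype_val.comp key

theorem coords_translate {X : E → Fp l → ℝ} (hX : ∀ p, X p ∈ Bx l) (hLX : ∀ p, Lam l (X p) = p)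
    (hXL : ∀ x ∈ Bx l, X (Lam l x) = x) (D : Finset (Fp l)) {p q : E} (hp : ∀ σ ∈ D, X p σ ≠ 0)
    (hq : ∀ σ ∈ D, X q σ ≠ 0) (U : Fp l → ℝ) (h : q = p + ∑ σ ∈ D, U σ • bb l σ) (σ : Fp l) :
    X q σ = X p σ + (open Classical in if σ ∈ D then U σ else 0) := by
  classical
  obtain ⟨t, ht0, ht⟩ : ∃ t : ℝ, 0 ≤ t ∧ ∀ σ ∈ D, 0 ≤ U σ + t := by
    refine ⟨∑ σ ∈ D, |U σ|, Finset.sum_nonneg fun _ _ => abs_nonneg _, fun σ hs => ?_⟩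
    have := Finset.single_le_sum (f := fun σ => |U σ|) (fun _ _ => abs_nonneg _) hs
    have h2 := neg_abs_le (U σ)
    linarith
  let x : Fp l → ℝ := fun σ => X q σ + if σ ∈ D then t else 0
  let y : Fp l → ℝ := fun σ => X p σ + if σ ∈ D then U σ + t else 0
  have hx : x ∈ Bx l := by
    refine Bx_of_supp l (hX q) (fun σ => ?_) (fun σ hs => ?_)
    · have := (hX q).1 σ
      simp only [x]; split_ifs <;> linarith
    · have : σ ∉ D := fun h => hq σ h hs
      simp only [x]; rw [if_neg this, hs, zero_add]
  have hy : y ∈ Bx l := by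
    refine Bx_of_supp l (hX p) (fun σ => ?_) (fun σ hs => ?_)
    · have := (hX p).1 σ
      simp only [y]; split_ifs with h
      · linarith [ht σ h]
      · linarith
    · have : σ ∉ D := fun h => hp σ h hs
      simp only [y]; rw [if_neg this, hs, zero_add]
  have e : Lam l x = Lam l y := by
    have e1 := hLX p
    have e2 := hLX q
    simp only [Lam, x, y, add_smul, Finset.sum_add_distrib, ite_smul, zero_smul, Finset.sum_ite_mem, Finset.univ_inter] at e1 e2 ⊢
    rw [e1, e2, h]
    abel
  have := congrFun ((hXL x hx).symm.trans ((congrArg X e).trans (hXL y hy))) σ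
  simp only [x, y] at this
  split_ifs at this ⊢ <;> linarith

end Fan2

theorem exists_generic {S : Type*} [Fintype S] (H : Finset (Submodule ℝ (S → ℝ))) :
    ∃ μ : S → ℝ, (∀ s, 0 < μ s) ∧ ∀ h ∈ H, μ ∈ h → h = ⊤ := by
  classical
  have h1 : ⋃ p ∈ H.filter (fun h => h ≠ ⊤), (p : Set (S → ℝ)) ≠ Set.univ :=
    Subspace.biUnion_ne_univ_of_top_notMem (by simp)
  obtain ⟨ν, hν⟩ := (Set.ne_univ_iff_exists_notMem _).1 h1
  have hν' : ∀ h ∈ H, h ≠ ⊤ → ν ∉ h := by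
    intro h hh ht hn
    exact hν (Set.mem_biUnion (Finset.mem_coe.2 (Finset.mem_filter.2 ⟨hh, ht⟩)) hn)
  let μ : ℝ → S → ℝ := fun t s => 1 + t * ν s
  have hfin : (⋃ h ∈ H.filter (fun h => h ≠ ⊤), {t : ℝ | μ t ∈ h}).Finite := by
    refine Set.Finite.biUnion (Finset.finite_toSet _) fun h hh => Set.Subsingleton.finite ?_
    obtain ⟨hh, ht⟩ := Finset.mem_filter.1 hh
    intro t h1 t' h2
    by_contra hne
    apply hν' h hh ht
    have h3 := h.smul_mem (t - t')⁻¹ (h.sub_mem h1 h2)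
    convert h3 using 1
    funext s
    have : t - t' ≠ 0 := sub_ne_zero.2 hne
    simp only [Pi.smul_apply, Pi.sub_apply, μ, smul_eq_mul]
    field_simp
    ring
  have hδ : (0:ℝ) < 1 / (1 + ∑ s, |ν s|) := by
    have : 0 ≤ ∑ s, |ν s| := Finset.sum_nonneg fun _ _ => abs_nonneg _
    positivity
  obtain ⟨t, ⟨ht0, ht1⟩, ht2⟩ := ((Set.Ioo_infinite hδ).sdiff hfin).nonempty
  refine ⟨μ t, fun s => ?_, fun h hh hm => ?_⟩
  · have h1 : |ν s| ≤ ∑ s, |ν s| := Finset.single_le_sum (f := fun s => |ν s|) (fun _ _ => abs_nonneg _) (Finset.mem_univ s)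
    have h2 : 0 ≤ ∑ s, |ν s| := Finset.sum_nonneg fun _ _ => abs_nonneg _
    rw [lt_div_iff₀ (by linarith)] at ht1
    have h3 := neg_abs_le (ν s)
    simp only [μ]
    nlinarith
  · by_contra hne
    exact ht2 (Set.mem_biUnion (Finset.mem_coe.2 (Finset.mem_filter.2 ⟨hh, hne⟩)) hm)

end RAM


namespace RAM

/-- Nonnegative functions supported on cliques. -/
def CC (G : Gr) : Set (G.S → ℝ) := {c | (∀ s, 0 ≤ c s) ∧ ∀ s t, s ≠ t → c s ≠ 0 → c t ≠ 0 → G.adj s t}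

set_option maxHeartbeats 3000000 in
theorem exists_KData (G : Gr) (E : Type) [NormedAddCommGroup E] [NormedSpace ℝ E] [FiniteDimensional ℝ E]
    (Gs : Finset (Finset ((G.S → ℝ) × E)))
    (R1 : ∀ g ∈ Gs, ∀ x ∈ cone g, x.1 ∈ CC G)
    (R2 : ∀ c ∈ CC G, ∃ g ∈ Gs, ∃ v, (c, v) ∈ cone g)
    (R3 : ∀ g ∈ Gs, ∀ g' ∈ Gs, ∀ x ∈ cone g, ∀ y ∈ cone g', x.1 = y.1 ↔ x.2 = y.2) :
    Nonempty (KData G E) := by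
  classical
  -- the functionals
  have hQ : ∀ g : Finset ((G.S → ℝ) × E), ∃ J : Finset (E →ₗ[ℝ] ℝ),
      ∀ p, (∃ c, (c, p) ∈ cone g) ↔ ∀ l ∈ J, 0 ≤ l p := by
    intro g
    obtain ⟨J, hJ⟩ := exists_halfspaces (g.image (LinearMap.snd ℝ (G.S → ℝ) E))
    refine ⟨J, fun p => ?_⟩
    rw [← hJ, mem_cone_image]
    constructor
    · rintro ⟨c, hc⟩; exact ⟨_, hc, rfl⟩
    · rintro ⟨⟨c, q⟩, hc, rfl⟩; exact ⟨c, hc⟩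
  choose J hJ using hQ
  let bs := Module.finBasis ℝ E
  let Jt : Finset (E →ₗ[ℝ] ℝ) := Gs.biUnion J ∪ Finset.univ.image (fun i => bs.coord i)
  let l : {f // f ∈ Jt} → E →ₗ[ℝ] ℝ := Subtype.val
  have hl : ∀ p, (∀ j, l j p = 0) → p = 0 := by
    intro p hp
    rw [← bs.forall_coord_eq_zero_iff]
    intro i
    exact hp ⟨bs.coord i, Finset.mem_union_right _ (Finset.mem_image_of_mem _ (Finset.mem_univ i))⟩
  obtain ⟨X, hXc, hX, hLX, hXL⟩ := exists_coords l hl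
  have hdown : ∀ g ∈ Gs, ∀ p q, (∃ c, (c, p) ∈ cone g) → sle (sgn l q) (sgn l p) → ∃ c, (c, q) ∈ cone g := by
    intro g hg p q hp hs
    rw [hJ] at hp ⊢
    intro f hf
    have h1 := hp f hf
    have h2 := hs ⟨f, Finset.mem_union_left _ (Finset.mem_biUnion.2 ⟨g, hg, hf⟩)⟩
    simp only [sgn, l] at h2
    rcases h2 with h2 | h2
    · rw [sign_eq_zero_iff] at h2; rw [h2]
    · rcases h1.eq_or_lt with h1 | h1
      · rw [← h1, sign_zero, sign_eq_zero_iff] at h2; rw [h2]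
      · rw [sign_pos h1, sign_eq_one_iff] at h2; exact h2.le
  let P : Set E := {v | ∃ g ∈ Gs, ∃ c, (c, v) ∈ cone g}
  have hφ0 : ∀ v, ∃ c, v ∈ P → ∃ g ∈ Gs, (c, v) ∈ cone g := by
    intro v
    by_cases h : v ∈ P
    · obtain ⟨g, hg, c, hc⟩ := h; exact ⟨c, fun _ => ⟨g, hg, hc⟩⟩
    · exact ⟨0, fun h' => absurd h' h⟩
  choose φ hφ using hφ0
  have hφu : ∀ g ∈ Gs, ∀ c v, (c, v) ∈ cone g → φ v = c := by
    intro g hg c v hc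
    obtain ⟨g', hg', h⟩ := hφ v ⟨g, hg, c, hc⟩
    exact (R3 g' hg' g hg _ h _ hc).2 rfl
  have hφg : ∀ g ∈ Gs, ∀ v, (∃ c, (c, v) ∈ cone g) → (φ v, v) ∈ cone g := by
    rintro g hg v ⟨c, hc⟩
    rw [hφu g hg c v hc]; exact hc
  have hC0 : (0 : G.S → ℝ) ∈ CC G := ⟨fun _ => le_rfl, fun _ _ _ h => absurd rfl h⟩
  obtain ⟨g0, hg0, -⟩ := R2 0 hC0
  let DP : Finset (Fp l) := Finset.univ.filter (fun σ => bb l σ ∈ P)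
  let aa : (Fp l → ℝ) → E := fun x => ∑ σ ∈ DP, x σ • bb l σ
  let ft : (Fp l → ℝ) → G.S → ℝ := fun x => ∑ σ ∈ DP, x σ • φ (bb l σ)
  have hsgn : ∀ σ : Fp l, sgn l (bb l σ) = σ.1 := fun σ => funext fun j => sgn_bb l σ j
  have hchain : ∀ x ∈ Bx l, ∃ g ∈ Gs, (ft x, aa x) ∈ cone g := by
    intro x hx
    have hpair : (ft x, aa x) = ∑ σ ∈ DP, x σ • ((φ (bb l σ), bb l σ) : (G.S → ℝ) × E) := by
      refine Prod.ext ?_ ?_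
      · rw [Prod.fst_sum]; rfl
      · rw [Prod.snd_sum]; rfl
    rw [hpair]
    by_cases hs : (DP.filter (fun σ => x σ ≠ 0)).Nonempty
    · obtain ⟨σ, h1, h2⟩ := sle_max l _ hs (fun σ h τ h' => hx.2 σ τ (Finset.mem_filter.1 h).2 (Finset.mem_filter.1 h').2)
      obtain ⟨g, hg, hc⟩ := (Finset.mem_filter.1 (Finset.mem_filter.1 h1).1).2
      refine ⟨g, hg, sum_mem_cone _ fun τ hτ => ?_⟩
      by_cases h0 : x τ = 0
      · rw [h0, zero_smul]; exact zero_mem_cone _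
      · refine smul_mem_cone (hx.1 τ) (hφg g hg _ (hdown g hg _ _ hc ?_))
        rw [hsgn, hsgn]
        exact h2 τ (Finset.mem_filter.2 ⟨hτ, h0⟩)
    · refine ⟨g0, hg0, sum_mem_cone _ fun τ hτ => ?_⟩
      have h0 : x τ = 0 := by
        by_contra h
        exact hs ⟨τ, Finset.mem_filter.2 ⟨hτ, h⟩⟩
      rw [h0, zero_smul]; exact zero_mem_cone _
  have hP : ∀ p ∈ P, aa (X p) = p := by
    rintro p ⟨g, hg, hc⟩
    conv_rhs => rw [← hLX p]
    refine Finset.sum_subset (Finset.subset_univ _) fun σ _ hσ => ?_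
    have : X p σ = 0 := by
      by_contra h
      apply hσ
      refine Finset.mem_filter.2 ⟨Finset.mem_univ _, g, hg, hdown g hg p _ hc ?_⟩
      rw [hsgn]
      have := Bx_sle l (hX p) h
      rwa [hLX] at this
    rw [this, zero_smul]
  have hftP : ∀ g ∈ Gs, ∀ c v, (c, v) ∈ cone g → ft (X v) = c := by
    intro g hg c v hc
    obtain ⟨g', hg', h⟩ := hchain (X v) (hX v)
    rw [hP v ⟨g, hg, c, hc⟩] at h
    exact (R3 g' hg' g hg _ h _ hc).2 rfl
  have hφne : ∀ σ ∈ DP, ∃ s, 0 < φ (bb l σ) s := by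
    intro σ hσ
    obtain ⟨g, hg, h⟩ := hφ _ (Finset.mem_filter.1 hσ).2
    by_contra! hn
    have h0 : φ (bb l σ) = 0 := funext fun s => le_antisymm (hn s) ((R1 g hg _ h).1 s)
    exact bb_ne l σ ((R3 g hg g0 hg0 _ h 0 (zero_mem_cone _)).1 h0)
  have hφ0 : ∀ σ ∈ DP, ∀ s, 0 ≤ φ (bb l σ) s := by
    intro σ hσ
    obtain ⟨g, hg, h⟩ := hφ _ (Finset.mem_filter.1 hσ).2
    exact (R1 g hg _ h).1
  -- generic scaling
  let Hs : Finset (Fp l) → Finset G.S → Submodule ℝ (G.S → ℝ) := fun D T =>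
    { carrier := {f | ∃ u : Fp l → ℝ, ∀ s ∈ T, f s = ∑ σ ∈ D, u σ * φ (bb l σ) s}
      zero_mem' := ⟨0, by simp⟩
      add_mem' := by
        rintro a b ⟨u, hu⟩ ⟨v, hv⟩
        exact ⟨u + v, fun s hs => by simp [hu s hs, hv s hs, add_mul, Finset.sum_add_distrib]⟩
      smul_mem' := by
        rintro r a ⟨u, hu⟩
        exact ⟨r • u, fun s hs => by simp [hu s hs, Finset.mul_sum, mul_assoc]⟩ }
  obtain ⟨μ, hμ0, hμ⟩ := exists_generic (Finset.image₂ Hs Finset.univ Finset.univ)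
  let κ : E → G.S → ℝ := fun p s => ft (X p) s / μ s
  have hftc : Continuous ft := by
    refine continuous_finsetSum _ fun σ _ => (continuous_apply σ).smul continuous_const
  have haac : Continuous aa := by
    refine continuous_finsetSum _ fun σ _ => (continuous_apply σ).smul continuous_const
  have hκc : Continuous κ := continuous_pi fun s => ((continuous_apply s).comp (hftc.comp hXc)).div_const _
  have hfts : ∀ x s, ft x s = ∑ σ ∈ DP, x σ * φ (bb l σ) s := by
    intro x s; simp only [ft, Finset.sum_apply, Pi.smul_apply, smul_eq_mul]
  have hκμ : ∀ p (c : G.S → ℝ), (∀ s, κ p s = c s) ↔ ft (X p) = fun s => μ s * c s := by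
    intro p c
    rw [funext_iff]
    refine forall_congr' fun s => ?_
    simp only [κ]
    rw [div_eq_iff (hμ0 s).ne', mul_comm]
  -- the section
  have hi : ∀ a : Ch G, ∃ v, ∃ g ∈ Gs, ((fun s => μ s * a.1 s), v) ∈ cone g := by
    intro a
    obtain ⟨g, hg, v, h⟩ := R2 (fun s => μ s * a.1 s) ⟨fun s => mul_nonneg (hμ0 s).le (a.2.1 s),
      fun s t hst h1 h2 => a.2.2.2 s t hst (right_ne_zero_of_mul h1) (right_ne_zero_of_mul h2)⟩
    exact ⟨v, g, hg, h⟩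
  choose i hi using hi
  have hκi : ∀ a, κ (i a) = a.1 := by
    intro a
    obtain ⟨g, hg, h⟩ := hi a
    exact funext ((hκμ _ _).2 (hftP g hg _ _ h))
  have hiu : ∀ p, ∀ a : Ch G, κ p = a.1 → aa (X p) = i a := by
    intro p a hpa
    obtain ⟨g, hg, h⟩ := hi a
    obtain ⟨g', hg', h'⟩ := hchain (X p) (hX p)
    exact (R3 g' hg' g hg _ h' _ h).1 ((hκμ _ _).1 (congrFun hpa))
  have hκCC : ∀ p, κ p ∈ CC G := by
    intro p
    obtain ⟨g', hg', h'⟩ := hchain (X p) (hX p)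
    have := R1 g' hg' _ h'
    refine ⟨fun s => div_nonneg (this.1 s) (hμ0 s).le, fun s t hst h1 h2 => this.2 s t hst ?_ ?_⟩
    · exact fun h => h1 (by simp only [κ]; rw [show ft (X p) s = 0 from h, zero_div])
    · exact fun h => h2 (by simp only [κ]; rw [show ft (X p) t = 0 from h, zero_div])
  have hPclosed : IsClosed P := by
    have e : P = ⋃ g ∈ Gs, ⋂ f ∈ J g, {p | 0 ≤ f p} := by
      ext p
      simp only [P, Set.mem_iUnion, Set.mem_iInter, Set.mem_ofPred_eq, hJ, exists_prop]
    rw [e]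
    refine Set.Finite.isClosed_biUnion (Finset.finite_toSet _) fun g _ => isClosed_biInter fun f _ => ?_
    exact isClosed_le continuous_const f.continuous_of_finiteDimensional
  have hic : Continuous i := by
    let Z : Set E := {v | v ∈ P ∧ ∀ s, κ v s ≤ 1}
    have hZc : IsCompact Z := by
      have hb : ∀ σ, ∃ C : ℝ, ∀ v ∈ Z, σ ∈ DP → X v σ ≤ C := by
        intro σ
        by_cases hσ : σ ∈ DP
        · obtain ⟨s, hs⟩ := hφne σ hσ
          refine ⟨μ s / φ (bb l σ) s, fun v hv _ => ?_⟩
          rw [le_div_iff₀ hs]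
          have h1 := hv.2 s
          simp only [κ] at h1
          rw [div_le_one (hμ0 s), hfts] at h1
          refine le_trans ?_ h1
          exact Finset.single_le_sum (f := fun σ => X v σ * φ (bb l σ) s)
            (fun τ hτ => mul_nonneg ((hX v).1 τ) (hφ0 τ hτ s)) hσ
        · exact ⟨0, fun _ _ h => absurd h hσ⟩
      choose C hC using hb
      have hK2 : IsCompact (aa '' (Set.pi Set.univ fun σ => Set.Icc (0:ℝ) (max 0 (C σ)))) :=
        (isCompact_univ_pi fun σ => isCompact_Icc).image haac
      refine hK2.of_isClosed_subset ?_ ?_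
      · have e : Z = P ∩ ⋂ s, {v | κ v s ≤ 1} := by
          ext v; simp only [Z, Set.mem_inter_iff, Set.mem_iInter, Set.mem_ofPred_eq]
        rw [e]
        exact hPclosed.inter (isClosed_iInter fun s => isClosed_le ((continuous_apply s).comp hκc) continuous_const)
      · intro v hv
        refine ⟨fun σ => if σ ∈ DP then X v σ else 0, ?_, ?_⟩
        · intro σ _
          dsimp only
          split_ifs with h
          · exact ⟨(hX v).1 σ, (hC σ v hv h).trans (le_max_right _ _)⟩
          · exact ⟨le_rfl, le_max_left _ _⟩
        · refine Eq.trans ?_ (hP v hv.1)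
          exact Finset.sum_congr rfl fun σ hσ => by dsimp only; rw [if_pos hσ]
    have : CompactSpace Z := isCompact_iff_compactSpace.1 hZc
    have hiZ : ∀ a, i a ∈ Z := by
      intro a
      obtain ⟨g, hg, h⟩ := hi a
      exact ⟨⟨g, hg, _, h⟩, fun s => by rw [hκi]; exact a.2.2.1 s⟩
    let e : Z ≃ Ch G :=
      { toFun := fun v => ⟨κ v.1, (hκCC v.1).1, v.2.2, (hκCC v.1).2⟩
        invFun := fun a => ⟨i a, hiZ a⟩
        left_inv := fun v => Subtype.ext ((hiu v.1 ⟨κ v.1, (hκCC v.1).1, v.2.2, (hκCC v.1).2⟩ rfl).symm.trans (hP v.1 v.2.1))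
        right_inv := fun a => Subtype.ext (hκi a) }
    have he : Continuous e := Continuous.subtype_mk (hκc.comp continuous_subtype_val) _
    have := (he.homeoOfEquivCompactToT2).symm.continuous
    exact continuous_subtype_val.comp this
  -- homotopy
  let xh : ℝ → E → Fp l → ℝ := fun τ p σ => if σ ∈ DP then X p σ else (1 - τ) * X p σ
  let h : ℝ → E → E := fun τ p => Lam l (xh τ p)
  have hXh : ∀ τ p, 0 ≤ τ → τ ≤ 1 → X (h τ p) = xh τ p := by
    intro τ p h0 h1
    refine hXL _ (Bx_of_supp l (hX p) (fun σ => ?_) (fun σ hs => ?_))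
    · simp only [xh]; split_ifs
      · exact (hX p).1 σ
      · exact mul_nonneg (by linarith) ((hX p).1 σ)
    · simp only [xh]; rw [hs]; simp
  have hftx : ∀ x y : Fp l → ℝ, (∀ σ ∈ DP, x σ = y σ) → ft x = ft y := fun x y hxy =>
    Finset.sum_congr rfl fun σ hσ => by rw [hxy σ hσ]
  refine ⟨{ κ := κ, cont := hκc, nonneg := fun p => (hκCC p).1, clq := fun p => (hκCC p).2, i := i, icont := hic,
            κi := hκi, h := h, hcont := ?_, κh := ?_, h0 := ?_, h1 := ?_, tr := ?_ }⟩
  · have : Continuous fun x : ℝ × E => xh x.1 x.2 := by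
      refine continuous_pi fun σ => ?_
      have hc : Continuous fun x : ℝ × E => X x.2 σ := (continuous_apply σ).comp (hXc.comp continuous_snd)
      simp only [xh]
      split_ifs
      · exact hc
      · exact (continuous_const.sub continuous_fst).mul hc
    simp only [h, Lam]
    exact continuous_finsetSum _ fun σ _ => ((continuous_apply σ).comp this).smul continuous_const
  · intro τ p h0 h1
    funext s
    simp only [κ]
    rw [hXh τ p h0 h1, hftx (xh τ p) (X p) (fun σ hσ => if_pos hσ)]
  · intro p
    have : xh 0 p = X p := by
      funext σ; simp only [xh]; split_ifs <;> simp
    simp only [h]; rw [this, hLX]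
  · intro p a hpa
    rw [← hiu p a hpa]
    simp only [h, Lam, aa, xh]
    symm
    refine Finset.sum_subset_zero_on_sdiff (Finset.subset_univ _) ?_ ?_
    · intro σ hσ
      rw [if_neg (Finset.mem_sdiff.1 hσ).2]; simp
    · intro σ hσ; rw [if_pos hσ]
  · intro p _
    let D := DP.filter (fun σ => X p σ ≠ 0)
    let T : Finset G.S := Finset.univ.filter (fun s => κ p s = 1)
    have hmem : μ ∈ Hs D T := by
      refine ⟨X p, fun s hs => ?_⟩
      have h1 : κ p s = 1 := (Finset.mem_filter.1 hs).2
      simp only [κ] at h1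
      rw [div_eq_one_iff_eq (hμ0 s).ne', hfts] at h1
      rw [← h1]
      symm
      refine Finset.sum_subset (Finset.filter_subset _ _) fun σ hσ hn => ?_
      have : X p σ = 0 := by
        by_contra h; exact hn (Finset.mem_filter.2 ⟨hσ, h⟩)
      rw [this, zero_mul]
    have htop := hμ _ (Finset.mem_image₂_of_mem (Finset.mem_univ D) (Finset.mem_univ T)) hmem
    have hex : ∀ s : {s // κ p s = 1}, ∃ u : Fp l → ℝ, ∀ s' ∈ T,
        (Pi.single s.1 (μ s.1) : G.S → ℝ) s' = ∑ σ ∈ D, u σ * φ (bb l σ) s' := by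
      intro s
      have : (Pi.single s.1 (μ s.1) : G.S → ℝ) ∈ Hs D T := by rw [htop]; trivial
      exact this
    choose u hu using hex
    let El : ({s // κ p s = 1} → ℝ) →ₗ[ℝ] E := ∑ s, (LinearMap.proj s).smulRight (∑ σ ∈ D, u s σ • bb l σ)
    have hEl : ∀ h, El h = ∑ σ ∈ D, (∑ s, h s * u s σ) • bb l σ := by
      intro h
      simp only [El, LinearMap.sum_apply, LinearMap.smulRight_apply, LinearMap.proj_apply, Finset.smul_sum,
        Finset.sum_smul, smul_smul]
      exact Finset.sum_comm
    refine ⟨El, ⋂ σ ∈ D, {q | X q σ ≠ 0}, ?_, ?_, ?_⟩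
    · refine isOpen_biInter_finset fun σ _ => ?_
      exact isOpen_ne_fun ((continuous_apply σ).comp hXc) continuous_const
    · simp only [Set.mem_iInter]
      exact fun σ hσ => (Finset.mem_filter.1 hσ).2
    · intro q hq h hq' s'
      simp only [Set.mem_iInter] at hq hq'
      have htr := coords_translate l hX hLX hXL D hq hq' (fun σ => ∑ s, h s * u s σ) (by rw [hEl])
      have hs' : s'.1 ∈ T := Finset.mem_filter.2 ⟨Finset.mem_univ _, s'.2⟩
      have e1 : ft (X (q + El h)) s'.1 = ft (X q) s'.1 + μ s'.1 * h s' := by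
        rw [hfts, hfts]
        simp only [htr, add_mul, Finset.sum_add_distrib]
        congr 1
        simp only [ite_mul, zero_mul, Finset.sum_ite_mem]
        rw [Finset.inter_eq_right.2 (Finset.filter_subset _ _)]
        simp only [Finset.sum_mul]
        rw [Finset.sum_comm]
        have : ∀ s, ∑ σ ∈ D, h s * u s σ * φ (bb l σ) s'.1 = h s * (Pi.single s.1 (μ s.1) : G.S → ℝ) s'.1 := by
          intro s
          rw [hu s s'.1 hs', Finset.mul_sum]
          exact Finset.sum_congr rfl fun σ _ => by ring
        refine (Finset.sum_congr rfl fun s _ => this s).trans ?_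
        rw [Finset.sum_eq_single s']
        · rw [Pi.single_eq_same]; ring
        · intro s _ hne
          rw [Pi.single_eq_of_ne (fun h => hne (Subtype.ext h.symm)), mul_zero]
        · intro h; exact absurd (Finset.mem_univ _) h
      simp only [κ]
      rw [e1, add_div, mul_div_cancel_left₀ _ (hμ0 _).ne']

end RAM


/-! ### Isolated vertices -/
namespace RAM

/-- Cone data relative to a set of isolated vertices not yet handled. -/
def PH (G : Gr) (E : Type) [NormedAddCommGroup E] [NormedSpace ℝ E] (N : Finset G.S) : Prop :=
  ∃ (Gs : Finset (Finset ((G.S → ℝ) × E))) (Ss : Finset (Submodule ℝ E)),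
    (∀ W ∈ Ss, W ≠ ⊤) ∧ (∀ g ∈ Gs, ∀ x ∈ cone g, ∃ W ∈ Ss, x.2 ∈ W) ∧
    (∀ g ∈ Gs, ∀ x ∈ cone g, x.1 ∈ CC G ∧ ∀ s ∈ N, x.1 s = 0) ∧
    (∀ c ∈ CC G, (∀ s ∈ N, c s = 0) → ∃ g ∈ Gs, ∃ v, (c, v) ∈ cone g) ∧
    (∀ g ∈ Gs, ∀ g' ∈ Gs, ∀ x ∈ cone g, ∀ y ∈ cone g', x.1 = y.1 ↔ x.2 = y.2)

theorem mem_cone_singleton {X : Type*} [AddCommGroup X] [Module ℝ X] {v x : X} :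
    x ∈ cone ({v} : Finset X) ↔ ∃ t : ℝ, 0 ≤ t ∧ x = t • v := by
  constructor
  · rintro ⟨a, ha, rfl⟩
    exact ⟨a v, ha v, by simp⟩
  · rintro ⟨t, ht, rfl⟩
    exact smul_mem_cone ht (mem_cone (by simp))

open Classical in
theorem PH_step (G : Gr) (E : Type) [NormedAddCommGroup E] [NormedSpace ℝ E]
    (hE : ∀ u : E, Submodule.span ℝ {u} ≠ ⊤)
    (N : Finset G.S) (s : G.S) (hs : s ∉ N) (hiso : ∀ t, ¬ G.adj s t) (h : PH G E (insert s N)) :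
    PH G E N := by
  obtain ⟨Gs, Ss, h1, h2, h3, h4, h5⟩ := h
  have hex : ∃ u : E, ∀ W ∈ Ss, u ∉ W := by
    have := Subspace.biUnion_ne_univ_of_top_notMem (k := ℝ) (E := E) (s := Ss) (fun h => h1 _ h rfl)
    by_contra hcon
    push Not at hcon
    refine this (Set.eq_univ_of_forall fun u => ?_)
    obtain ⟨W, hW, hu⟩ := hcon u
    exact Set.mem_biUnion hW hu
  obtain ⟨u, hu⟩ := hex
  obtain ⟨g0, hg0, -⟩ := h4 0 ⟨fun _ => le_rfl, fun s t _ h => absurd rfl h⟩ (fun _ _ => rfl)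
  have hu0 : u ≠ 0 := by
    rintro rfl
    obtain ⟨W, hW, -⟩ := h2 g0 hg0 0 (zero_mem_cone _)
    exact hu W hW W.zero_mem
  let e : G.S → ℝ := Pi.single s 1
  have he0 : e ≠ 0 := fun h => by simpa [e] using congrFun h s
  let r : Finset ((G.S → ℝ) × E) := {(e, u)}
  have key : ∀ g ∈ Gs, ∀ x ∈ cone g, ∀ y ∈ cone r, x.1 = y.1 ↔ x.2 = y.2 := by
    intro g hg x hx y hy
    obtain ⟨t, ht, rfl⟩ := mem_cone_singleton.1 hy
    constructor
    · intro h
      have : t = 0 := by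
        have h' := congrFun h s
        rw [(h3 g hg x hx).2 s (by simp)] at h'
        simpa [e] using h'.symm
      subst this
      have := (h5 g hg g hg x hx 0 (zero_mem_cone _)).1 (by simpa using h)
      simpa using this
    · intro h
      have : t = 0 := by
        obtain ⟨W, hW, hxW⟩ := h2 g hg x hx
        rw [h] at hxW
        by_contra ht0
        exact hu W hW ((W.smul_mem_iff ht0).1 hxW)
      subst this
      have := (h5 g hg g hg x hx 0 (zero_mem_cone _)).2 (by simpa using h)
      simpa using this
  refine ⟨insert r Gs, insert (Submodule.span ℝ {u}) Ss, ?_, ?_, ?_, ?_, ?_⟩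
  · intro W hW
    rcases Finset.mem_insert.1 hW with rfl | hW
    · exact hE u
    · exact h1 W hW
  · intro g hg x hx
    rcases Finset.mem_insert.1 hg with rfl | hg
    · obtain ⟨t, ht, rfl⟩ := mem_cone_singleton.1 hx
      exact ⟨_, Finset.mem_insert_self _ _, Submodule.smul_mem _ _ (Submodule.mem_span_singleton_self u)⟩
    · obtain ⟨W, hW, h⟩ := h2 g hg x hx
      exact ⟨W, Finset.mem_insert_of_mem hW, h⟩
  · intro g hg x hx
    rcases Finset.mem_insert.1 hg with rfl | hg
    · obtain ⟨t, ht, rfl⟩ := mem_cone_singleton.1 hx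
      have hz : ∀ s', s' ≠ s → (t • (e, u)).1 s' = 0 := fun s' h => by simp [e, h]
      refine ⟨⟨fun s' => ?_, fun s' t' hst ha hb => ?_⟩, fun s' hs' => hz s' (fun h => hs (h ▸ hs'))⟩
      · by_cases h : s' = s
        · subst h; simpa [e] using ht
        · rw [hz s' h]
      · have e1 : s' = s := by by_contra h; exact ha (hz _ h)
        have e2 : t' = s := by by_contra h; exact hb (hz _ h)
        exact absurd (e1.trans e2.symm) hst
    · exact ⟨(h3 g hg x hx).1, fun s' hs' => (h3 g hg x hx).2 s' (Finset.mem_insert_of_mem hs')⟩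
  · intro c hc hN
    by_cases hcs : c s = 0
    · obtain ⟨g, hg, h⟩ := h4 c hc (by
        intro s' hs'
        rcases Finset.mem_insert.1 hs' with rfl | h
        · exact hcs
        · exact hN _ h)
      exact ⟨g, Finset.mem_insert_of_mem hg, h⟩
    · refine ⟨r, Finset.mem_insert_self _ _, c s • u, mem_cone_singleton.2 ⟨c s, hc.1 s, ?_⟩⟩
      refine Prod.ext ?_ rfl
      funext t
      by_cases h : t = s
      · subst h; simp [e]
      · have : c t = 0 := by
          by_contra h'
          exact hiso t (hc.2 s t (Ne.symm h) hcs h')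
        simp [e, h, this]
  · intro g hg g' hg' x hx y hy
    rcases Finset.mem_insert.1 hg with rfl | hg <;> rcases Finset.mem_insert.1 hg' with rfl | hg'
    · obtain ⟨t, ht, rfl⟩ := mem_cone_singleton.1 hx
      obtain ⟨t', ht', rfl⟩ := mem_cone_singleton.1 hy
      simp only [Prod.smul_mk]
      rw [smul_left_injective ℝ he0 |>.eq_iff, smul_left_injective ℝ hu0 |>.eq_iff]
    · rw [eq_comm, key g' hg' y hy x hx, eq_comm]
    · exact key g hg x hx y hy
    · exact h5 g hg g' hg' x hx y hy

open Classical in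
theorem PH_empty (G : Gr) (E : Type) [NormedAddCommGroup E] [NormedSpace ℝ E]
    (hE : ∀ u : E, Submodule.span ℝ {u} ≠ ⊤)
    (N : Finset G.S) (hiso : ∀ s ∈ N, ∀ t, ¬ G.adj s t) (h : PH G E N) : PH G E ∅ := by
  induction N using Finset.induction_on with
  | empty => exact h
  | insert s N hs ih =>
    exact ih (fun s' hs' => hiso s' (Finset.mem_insert_of_mem hs'))
      (PH_step G E hE N s hs (hiso s (Finset.mem_insert_self _ _)) h)

theorem exists_KData_of_PH (G : Gr) (E : Type) [NormedAddCommGroup E] [NormedSpace ℝ E] [FiniteDimensional ℝ E]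
    (h : PH G E ∅) : Nonempty (KData G E) := by
  obtain ⟨Gs, Ss, h1, h2, h3, h4, h5⟩ := h
  exact exists_KData G E Gs (fun g hg x hx => (h3 g hg x hx).1) (fun c hc => h4 c hc (by simp)) h5

/-! ### Cones over convex hulls -/

theorem cone_of_hull {X : Type*} [AddCommGroup X] [Module ℝ X] {t : Finset X} {x : X} (hx : x ∈ cone t) :
    x = 0 ∨ ∃ r : ℝ, 0 < r ∧ ∃ p ∈ convexHull ℝ (t : Set X), x = r • p := by
  refine cone_min (S := {x | x = 0 ∨ ∃ r : ℝ, 0 < r ∧ ∃ p ∈ convexHull ℝ (t : Set X), x = r • p})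
    (Or.inl rfl) ?_ ?_ ?_ hx
  · rintro x (rfl | ⟨r, hr, p, hp, rfl⟩) y (rfl | ⟨r', hr', p', hp', rfl⟩)
    · left; simp
    · right; exact ⟨r', hr', p', hp', by simp⟩
    · right; exact ⟨r, hr, p, hp, by simp⟩
    · right
      refine ⟨r + r', by positivity, (r / (r + r')) • p + (r' / (r + r')) • p',
        (convex_convexHull ℝ _) hp hp' (by positivity) (by positivity) (by field_simp), ?_⟩
      have : r + r' ≠ 0 := by positivity
      rw [smul_add, smul_smul, smul_smul, mul_div_cancel₀ _ this, mul_div_cancel₀ _ this]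
  · rintro a ha x (rfl | ⟨r, hr, p, hp, rfl⟩)
    · left; simp
    · rcases ha.eq_or_lt with rfl | ha
      · left; simp
      · right; exact ⟨a * r, by positivity, p, hp, by rw [smul_smul]⟩
  · intro x hx
    right
    exact ⟨1, one_pos, x, subset_convexHull ℝ _ hx, by simp⟩

theorem hull_cone {X : Type*} [AddCommGroup X] [Module ℝ X] {t : Finset X} {p : X}
    (hp : p ∈ convexHull ℝ (t : Set X)) : p ∈ cone t :=
  convexHull_min (fun _ h => mem_cone h)
    (fun _ hx _ hy _ _ ha hb _ => add_mem_cone (smul_mem_cone ha hx) (smul_mem_cone hb hy)) hp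

theorem span_cone {X : Type*} [AddCommGroup X] [Module ℝ X] {t : Finset X} {p : X}
    (hp : p ∈ Submodule.span ℝ (t : Set X)) : ∃ x ∈ cone t, ∃ y ∈ cone t, p = x - y := by
  induction hp using Submodule.span_induction with
  | mem x h => exact ⟨x, mem_cone h, 0, zero_mem_cone _, by simp⟩
  | zero => exact ⟨0, zero_mem_cone _, 0, zero_mem_cone _, by simp⟩
  | add x y _ _ hx hy =>
    obtain ⟨a, ha, b, hb, rfl⟩ := hx
    obtain ⟨a', ha', b', hb', rfl⟩ := hy
    exact ⟨a + a', add_mem_cone ha ha', b + b', add_mem_cone hb hb', by abel⟩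
  | smul r x _ hx =>
    obtain ⟨a, ha, b, hb, rfl⟩ := hx
    rcases le_total 0 r with hr | hr
    · exact ⟨r • a, smul_mem_cone hr ha, r • b, smul_mem_cone hr hb, by rw [smul_sub]⟩
    · refine ⟨(-r) • b, smul_mem_cone (by linarith) hb, (-r) • a, smul_mem_cone (by linarith) ha, ?_⟩
      rw [smul_sub, neg_smul, neg_smul]; abel

end RAM

theorem mem_hull_stdVert [Fintype V] [DecidableEq V] {s : Finset V} {c : V → ℝ} :
    c ∈ convexHull ℝ (stdVert '' (s : Set V)) ↔ (∀ v, 0 ≤ c v) ∧ ∑ v, c v = 1 ∧ ∀ v, v ∉ s → c v = 0 := by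
  constructor
  · intro h
    refine convexHull_min (t := {c : V → ℝ | (∀ v, 0 ≤ c v) ∧ ∑ v, c v = 1 ∧ ∀ v, v ∉ s → c v = 0}) ?_ ?_ h
    · rintro _ ⟨v, hv, rfl⟩
      refine ⟨fun w => ?_, ?_, fun w hw => ?_⟩
      · simp only [stdVert]; split_ifs <;> norm_num
      · simp [stdVert]
      · simp only [stdVert]; rw [if_neg]; rintro rfl; exact hw hv
    · rintro x ⟨h1, h2, h3⟩ y ⟨g1, g2, g3⟩ a b ha hb hab
      refine ⟨fun v => ?_, ?_, fun v hv => ?_⟩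
      · have := h1 v
        have := g1 v
        simp only [Pi.add_apply, Pi.smul_apply, smul_eq_mul]
        positivity
      · simp only [Pi.add_apply, Pi.smul_apply, smul_eq_mul, Finset.sum_add_distrib, ← Finset.mul_sum, h2, g2]
        linarith
      · simp [h3 v hv, g3 v hv]
  · rintro ⟨h1, h2, h3⟩
    have e : c = ∑ v ∈ s, c v • stdVert v := by
      funext w
      simp only [Finset.sum_apply, Pi.smul_apply, stdVert, smul_eq_mul, mul_ite, mul_one, mul_zero,
        Finset.sum_ite_eq]
      split_ifs with hw
      · rfl
      · exact h3 w hw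
    rw [e]
    refine (convex_convexHull ℝ _).sum_mem (fun v _ => h1 v) ?_
      (fun v hv => subset_convexHull ℝ _ ⟨v, hv, rfl⟩)
    rw [← h2]
    exact Finset.sum_subset (Finset.subset_univ _) fun v _ hv => h3 v hv

theorem mem_realization [Fintype V] [DecidableEq V] {K : SCplx V} {c : V → ℝ} :
    c ∈ realization K ↔ ∃ s ∈ K.faces, (∀ v, 0 ≤ c v) ∧ ∑ v, c v = 1 ∧ ∀ v, v ∉ s → c v = 0 := by
  simp only [realization, Set.mem_iUnion, mem_hull_stdVert, exists_prop]

/-- The linear coordinates on the boundary of the simplex. -/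
noncomputable def sphT (m : ℕ) : (Fin (m + 2) → ℝ) →ₗ[ℝ] EuclideanSpace ℝ (Fin (m + 1)) where
  toFun y := WithLp.toLp 2 fun i => y i.castSucc - y (Fin.last _)
  map_add' x y := by
    ext i; simp; ring
  map_smul' r x := by
    ext i; simp; ring

theorem sphT_inj {m : ℕ} {x y : Fin (m + 2) → ℝ} (hx : ∀ i, 0 ≤ x i) (hy : ∀ i, 0 ≤ y i)
    (hx0 : ∃ i, x i = 0) (hy0 : ∃ i, y i = 0) (h : sphT m x = sphT m y) : x = y := by
  have h' : ∀ i, x i - x (Fin.last _) = y i - y (Fin.last _) := by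
    intro i
    refine Fin.lastCases ?_ (fun j => ?_) i
    · simp
    · have := congrArg (fun z : EuclideanSpace ℝ (Fin (m + 1)) => z j) h
      simpa [sphT] using this
  obtain ⟨i, hi⟩ := hx0
  obtain ⟨j, hj⟩ := hy0
  funext k
  have a1 := h' i
  have a2 := h' j
  have a3 := h' k
  have := hx j
  have := hy i
  linarith


open Classical in
theorem PH_base [Fintype V] [DecidableEq V] (L : SCplx V) (k m : ℕ)
    (hflag : IsFlag L) (hdim : IsDimOf L k) (h : k + 2 < m) (hemb : PLEmbedsInSphere (oct L) m) :
    RAM.PH (octGr L) (EuclideanSpace ℝ (Fin (m + 1)))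
      (Finset.univ.filter fun s : V × Bool => ({s.1} : Finset V) ∉ L.faces) := by
  obtain ⟨f, hinj, hsub, F0, hF0⟩ := hemb
  let F : Finset (Finset ((V × Bool → ℝ) × (Fin (m + 2) → ℝ))) := insert ∅ F0
  have hF : {p : ((V × Bool → ℝ) × (Fin (m + 2) → ℝ)) | p.1 ∈ realization (oct L) ∧ p.2 = f p.1} = ⋃ t ∈ F, convexHull ℝ (t : Set ((V × Bool → ℝ) × (Fin (m + 2) → ℝ))) := by
    rw [hF0]; simp [F]
  have hul : ∀ t ∈ F, ∀ p ∈ convexHull ℝ (t : Set ((V × Bool → ℝ) × (Fin (m + 2) → ℝ))), p.1 ∈ realization (oct L) ∧ p.2 = f p.1 := by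
    intro t ht p hp
    have : p ∈ ⋃ t ∈ F, convexHull ℝ (t : Set ((V × Bool → ℝ) × (Fin (m + 2) → ℝ))) := Set.mem_biUnion ht hp
    rwa [← hF] at this
  have hy : ∀ t ∈ F, ∀ p ∈ convexHull ℝ (t : Set ((V × Bool → ℝ) × (Fin (m + 2) → ℝ))),
      (∀ i, 0 ≤ p.2 i) ∧ ∑ i, p.2 i = 1 ∧ ∃ i, p.2 i = 0 := by
    intro t ht p hp
    obtain ⟨h1, h2⟩ := hul t ht p hp
    have : p.2 ∈ realization (sphereCplx m) := hsub ⟨p.1, h1, h2.symm⟩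
    obtain ⟨s, hs, a, b, c⟩ := mem_realization.1 this
    refine ⟨a, b, ?_⟩
    have hs2 : s ≠ Finset.univ := hs.2
    by_contra hcon
    push Not at hcon
    exact hs2 (Finset.eq_univ_of_forall fun i => by
      by_contra hi; exact hcon i (c i hi))
  have hc : ∀ t ∈ F, ∀ p ∈ convexHull ℝ (t : Set ((V × Bool → ℝ) × (Fin (m + 2) → ℝ))),
      (∀ s, 0 ≤ p.1 s) ∧ ∑ s, p.1 s = 1 ∧ ∃ σ ∈ (oct L).faces, ∀ s, s ∉ σ → p.1 s = 0 := by
    intro t ht p hp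
    obtain ⟨s, hs, a, b, c⟩ := mem_realization.1 (hul t ht p hp).1
    exact ⟨a, b, s, hs, c⟩
  -- uniqueness
  have sc1 : ∀ t ∈ F, ∀ t' ∈ F, ∀ r r' : ℝ, ∀ p ∈ convexHull ℝ (t : Set ((V × Bool → ℝ) × (Fin (m + 2) → ℝ))), ∀ p' ∈ convexHull ℝ (t' : Set ((V × Bool → ℝ) × (Fin (m + 2) → ℝ))),
      (r • p).1 = (r' • p').1 → r = r' := by
    intro t ht t' ht' r r' p hp p' hp' e
    have := congrArg (fun c : V × Bool → ℝ => ∑ s, c s) e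
    simp only [Prod.smul_fst, Pi.smul_apply, smul_eq_mul, ← Finset.mul_sum, (hc t ht p hp).2.1,
      (hc t' ht' p' hp').2.1, mul_one] at this
    exact this
  have sc2 : ∀ t ∈ F, ∀ t' ∈ F, ∀ r r' : ℝ, ∀ p ∈ convexHull ℝ (t : Set ((V × Bool → ℝ) × (Fin (m + 2) → ℝ))), ∀ p' ∈ convexHull ℝ (t' : Set ((V × Bool → ℝ) × (Fin (m + 2) → ℝ))),
      (r • p).2 = (r' • p').2 → r = r' := by
    intro t ht t' ht' r r' p hp p' hp' e
    have := congrArg (fun c : Fin (m + 2) → ℝ => ∑ s, c s) e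
    simp only [Prod.smul_snd, Pi.smul_apply, smul_eq_mul, ← Finset.mul_sum, (hy t ht p hp).2.1,
      (hy t' ht' p' hp').2.1, mul_one] at this
    exact this
  have sm1 : ∀ t ∈ F, ∀ x ∈ RAM.cone t, x.1 = 0 → x = 0 := by
    intro t ht x hx e
    rcases RAM.cone_of_hull hx with rfl | ⟨r, hr, p, hp, rfl⟩
    · rfl
    · have := sc1 t ht t ht r 0 p hp p hp (by rw [e]; simp)
      exact absurd this hr.ne'
  have sm2 : ∀ t ∈ F, ∀ x ∈ RAM.cone t, x.2 = 0 → x = 0 := by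
    intro t ht x hx e
    rcases RAM.cone_of_hull hx with rfl | ⟨r, hr, p, hp, rfl⟩
    · rfl
    · have := sc2 t ht t ht r 0 p hp p hp (by rw [e]; simp)
      exact absurd this hr.ne'
  have un1 : ∀ t ∈ F, ∀ t' ∈ F, ∀ x ∈ RAM.cone t, ∀ y ∈ RAM.cone t', x.1 = y.1 → x = y := by
    intro t ht t' ht' x hx y hy' e
    rcases RAM.cone_of_hull hx with rfl | ⟨r, hr, p, hp, rfl⟩
    · exact (sm1 t' ht' y hy' e.symm).symm
    rcases RAM.cone_of_hull hy' with rfl | ⟨r', hr', p', hp', rfl⟩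
    · exact sm1 t ht _ hx e
    obtain rfl := sc1 t ht t' ht' r r' p hp p' hp' e
    have e' : p.1 = p'.1 := smul_right_injective _ hr.ne' e
    have : p = p' := Prod.ext e' (by rw [(hul t ht p hp).2, (hul t' ht' p' hp').2, e'])
    rw [this]
  have un2 : ∀ t ∈ F, ∀ t' ∈ F, ∀ x ∈ RAM.cone t, ∀ y ∈ RAM.cone t', x.2 = y.2 → x = y := by
    intro t ht t' ht' x hx y hy' e
    rcases RAM.cone_of_hull hx with rfl | ⟨r, hr, p, hp, rfl⟩
    · exact (sm2 t' ht' y hy' e.symm).symm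
    rcases RAM.cone_of_hull hy' with rfl | ⟨r', hr', p', hp', rfl⟩
    · exact sm2 t ht _ hx e
    obtain rfl := sc2 t ht t' ht' r r' p hp p' hp' e
    have e' : p.2 = p'.2 := smul_right_injective _ hr.ne' e
    have e'' : p.1 = p'.1 := by
      refine hinj (hul t ht p hp).1 (hul t' ht' p' hp').1 ?_
      rw [← (hul t ht p hp).2, ← (hul t' ht' p' hp').2, e']
    rw [show p = p' from Prod.ext e'' e']
  have nn : ∀ t ∈ F, ∀ x ∈ RAM.cone t, (∀ i, 0 ≤ x.2 i) ∧ ∃ i, x.2 i = 0 := by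
    intro t ht x hx
    rcases RAM.cone_of_hull hx with rfl | ⟨r, hr, p, hp, rfl⟩
    · exact ⟨fun _ => le_rfl, 0, rfl⟩
    · obtain ⟨a, b, i, hi⟩ := hy t ht p hp
      exact ⟨fun i => mul_nonneg hr.le (a i), i, by simp [hi]⟩
  have un3 : ∀ t ∈ F, ∀ t' ∈ F, ∀ x ∈ RAM.cone t, ∀ y ∈ RAM.cone t', sphT m x.2 = sphT m y.2 → x = y := by
    intro t ht t' ht' x hx y hy' e
    have hx' := nn t ht x hx
    have hy'' := nn t' ht' y hy'
    exact un2 t ht t' ht' x hx y hy' (sphT_inj hx'.1 hy''.1 hx'.2 hy''.2 e)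
  -- dimension
  have hface : ∀ t ∈ F, ∃ σ : Finset (V × Bool), σ.card ≤ k + 1 ∧ ∀ p ∈ t, ∀ s, s ∉ σ → p.1 s = 0 := by
    intro t ht
    rcases t.eq_empty_or_nonempty with rfl | hne
    · exact ⟨∅, by simp, by simp⟩
    have hcard : (0 : ℝ) < t.card := by exact_mod_cast hne.card_pos
    have hq : ∑ p ∈ t, ((t.card : ℝ)⁻¹) • p ∈ convexHull ℝ (t : Set ((V × Bool → ℝ) × (Fin (m + 2) → ℝ))) := by
      refine (convex_convexHull ℝ _).sum_mem (fun _ _ => by positivity) ?_ (fun p hp => subset_convexHull ℝ _ hp)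
      simp [hcard.ne']
    obtain ⟨-, -, σ, hσ, h0⟩ := hc t ht _ hq
    refine ⟨σ, ?_, fun p hp s hs => ?_⟩
    · rw [← hσ.2]
      exact hdim.1 _ hσ.1
    · have := h0 s hs
      simp only [Prod.fst_sum, Finset.sum_apply, Prod.smul_fst, Pi.smul_apply, smul_eq_mul] at this
      have hz := (Finset.sum_eq_zero_iff_of_nonneg (fun q hq =>
        mul_nonneg (inv_nonneg.2 hcard.le) ((hc t ht q (subset_convexHull ℝ _ hq)).1 s))).1 this p hp
      exact (mul_eq_zero.1 hz).resolve_left (inv_ne_zero hcard.ne')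
  have hspan : ∀ t ∈ F, (Submodule.span ℝ (t : Set ((V × Bool → ℝ) × (Fin (m + 2) → ℝ)))).map ((sphT m).comp (LinearMap.snd ℝ _ _)) ≠ ⊤ := by
    intro t ht htop
    obtain ⟨σ, hσ, h0⟩ := hface t ht
    have hσ0 : ∀ p ∈ Submodule.span ℝ (t : Set ((V × Bool → ℝ) × (Fin (m + 2) → ℝ))), ∀ s, s ∉ σ → p.1 s = 0 := by
      intro p hp
      induction hp using Submodule.span_induction with
      | mem x h => exact h0 x h
      | zero => intro s _; rfl
      | add x y _ _ hx hy => intro s hs; simp [hx s hs, hy s hs]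
      | smul r x _ hx => intro s hs; simp [hx s hs]
    let R : Submodule.span ℝ (t : Set ((V × Bool → ℝ) × (Fin (m + 2) → ℝ))) →ₗ[ℝ] (σ → ℝ) :=
      { toFun := fun p s => p.1.1 s.1
        map_add' := fun _ _ => rfl
        map_smul' := fun _ _ => rfl }
    have hR : Function.Injective R := by
      rw [injective_iff_map_eq_zero]
      intro p hp
      have hp1 : p.1.1 = 0 := by
        funext s
        by_cases hs : s ∈ σ
        · exact congrFun hp ⟨s, hs⟩
        · exact hσ0 p.1 p.2 s hs
      obtain ⟨x, hx, y, hy', e⟩ := RAM.span_cone p.2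
      have : x = y := un1 t ht t ht x hx y hy' (by
        rw [e, Prod.fst_sub] at hp1
        exact sub_eq_zero.1 hp1)
      exact Subtype.ext (by rw [e, this, sub_self]; rfl)
    have d1 := LinearMap.finrank_le_finrank_of_injective hR
    have d2 := Submodule.finrank_map_le ((sphT m).comp (LinearMap.snd ℝ (V × Bool → ℝ) (Fin (m + 2) → ℝ)))
      (Submodule.span ℝ (t : Set ((V × Bool → ℝ) × (Fin (m + 2) → ℝ))))
    rw [htop] at d2
    simp only [finrank_top, finrank_euclideanSpace_fin, Module.finrank_fintype_fun_eq_card, Fintype.card_coe] at d1 d2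
    omega
  let Φ : ((V × Bool → ℝ) × (Fin (m + 2) → ℝ)) →ₗ[ℝ] (V × Bool → ℝ) × EuclideanSpace ℝ (Fin (m + 1)) := LinearMap.prodMap LinearMap.id (sphT m)
  refine ⟨F.image (fun t => t.image Φ),
    F.image (fun t : Finset ((V × Bool → ℝ) × (Fin (m + 2) → ℝ)) => (Submodule.span ℝ (t : Set ((V × Bool → ℝ) × (Fin (m + 2) → ℝ)))).map ((sphT m).comp (LinearMap.snd ℝ _ _))), ?_, ?_, ?_, ?_, ?_⟩
  · intro W hW
    obtain ⟨t, ht, rfl⟩ := Finset.mem_image.1 hW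
    exact hspan t ht
  · intro g hg x hx
    obtain ⟨t, ht, rfl⟩ := Finset.mem_image.1 hg
    obtain ⟨x, hx', rfl⟩ := (RAM.mem_cone_image Φ t).1 hx
    clear hx
    have hx := hx'
    refine ⟨_, Finset.mem_image_of_mem _ ht, x, ?_, rfl⟩
    exact RAM.cone_min (S := (Submodule.span ℝ (t : Set ((V × Bool → ℝ) × (Fin (m + 2) → ℝ))) : Set ((V × Bool → ℝ) × (Fin (m + 2) → ℝ)))) (Submodule.zero_mem _)
      (fun _ h _ h' => Submodule.add_mem _ h h') (fun _ _ _ h => Submodule.smul_mem _ _ h)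
      (fun _ h => Submodule.subset_span h) hx
  · intro g hg x hx
    obtain ⟨t, ht, rfl⟩ := Finset.mem_image.1 hg
    obtain ⟨x, hx', rfl⟩ := (RAM.mem_cone_image Φ t).1 hx
    clear hx
    have hx := hx'
    have hx1 : (Φ x).1 = x.1 := rfl
    rw [hx1]
    rcases RAM.cone_of_hull hx with rfl | ⟨r, hr, p, hp, rfl⟩
    · exact ⟨⟨fun _ => le_rfl, fun _ _ _ h => absurd rfl h⟩, fun _ _ => rfl⟩
    · obtain ⟨a, b, σ, hσ, h0⟩ := hc t ht p hp
      have hmem : ∀ s, (r • p).1 s ≠ 0 → s ∈ σ := by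
        intro s hs
        by_contra hn
        exact hs (by simp [h0 s hn])
      refine ⟨⟨fun s => mul_nonneg hr.le (a s), fun s s' hne hs hs' => ?_⟩, fun s hs => ?_⟩
      · have m1 := hmem s hs
        have m2 := hmem s' hs'
        refine ⟨fun e => hne (Finset.card_image_iff.1 hσ.2 m1 m2 e), ?_⟩
        refine L.down_closed hσ.1 ?_ (Finset.insert_nonempty _ _)
        intro v hv
        rcases Finset.mem_insert.1 hv with rfl | hv
        · exact Finset.mem_image_of_mem _ m1
        · rw [Finset.mem_singleton.1 hv]; exact Finset.mem_image_of_mem _ m2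
      · by_contra hn
        refine (Finset.mem_filter.1 hs).2 (L.down_closed hσ.1 ?_ (Finset.singleton_nonempty _))
        exact Finset.singleton_subset_iff.2 (Finset.mem_image_of_mem _ (hmem s hn))
  · intro (c : V × Bool → ℝ) hcC hN
    obtain ⟨hc0, hcl⟩ := hcC
    by_cases hz : c = 0
    · refine ⟨_, Finset.mem_image_of_mem _ (Finset.mem_insert_self _ _), 0, ?_⟩
      rw [hz]; exact RAM.zero_mem_cone _
    let σ : Finset (V × Bool) := Finset.univ.filter fun s => c s ≠ 0
    have hσ : σ ∈ (oct L).faces := by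
      refine ⟨hflag _ ?_ ?_, ?_⟩
      · obtain ⟨s, hs⟩ := Function.ne_iff.1 hz
        exact ⟨s.1, Finset.mem_image_of_mem _ (Finset.mem_filter.2 ⟨Finset.mem_univ _, hs⟩)⟩
      · intro u hu w hw
        obtain ⟨x, hx, rfl⟩ := Finset.mem_image.1 hu
        obtain ⟨y, hy', rfl⟩ := Finset.mem_image.1 hw
        by_cases e : x = y
        · subst e
          rw [Finset.pair_eq_singleton]
          by_contra hn
          exact (Finset.mem_filter.1 hx).2 (hN x (Finset.mem_filter.2 ⟨Finset.mem_univ _, hn⟩))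
        · exact (hcl x y e (Finset.mem_filter.1 hx).2 (Finset.mem_filter.1 hy').2).2
      · rw [pface, Finset.card_image_iff]
        intro x hx y hy' e
        by_contra hn
        exact (hcl x y hn (Finset.mem_filter.1 hx).2 (Finset.mem_filter.1 hy').2).1 e
    let r : ℝ := ∑ s, c s
    have hr : 0 < r := by
      obtain ⟨s, hs⟩ := Function.ne_iff.1 hz
      exact Finset.sum_pos' (fun s _ => hc0 s) ⟨s, Finset.mem_univ _, lt_of_le_of_ne (hc0 s) (Ne.symm hs)⟩
    have hreal : r⁻¹ • c ∈ realization (oct L) := by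
      refine mem_realization.2 ⟨σ, hσ, fun s => mul_nonneg (inv_nonneg.2 hr.le) (hc0 s), ?_, fun s hs => ?_⟩
      · simp only [Pi.smul_apply, smul_eq_mul, ← Finset.mul_sum]
        exact inv_mul_cancel₀ hr.ne'
      · have : c s = 0 := by
          by_contra hn; exact hs (Finset.mem_filter.2 ⟨Finset.mem_univ _, hn⟩)
        simp [this]
    have hmem : ((r⁻¹ • c, f (r⁻¹ • c)) : ((V × Bool → ℝ) × (Fin (m + 2) → ℝ))) ∈ ⋃ t ∈ F, convexHull ℝ (t : Set ((V × Bool → ℝ) × (Fin (m + 2) → ℝ))) := by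
      rw [← hF]; exact ⟨hreal, rfl⟩
    simp only [Set.mem_iUnion, exists_prop] at hmem
    obtain ⟨t, ht, hp⟩ := hmem
    refine ⟨_, Finset.mem_image_of_mem _ ht, sphT m (r • f (r⁻¹ • c)), ?_⟩
    refine (RAM.mem_cone_image Φ t).2 ⟨r • (r⁻¹ • c, f (r⁻¹ • c)),
      RAM.smul_mem_cone hr.le (RAM.hull_cone hp), ?_⟩
    refine Prod.ext ?_ rfl
    change r • r⁻¹ • c = c
    rw [smul_smul, mul_inv_cancel₀ hr.ne', one_smul]
  · intro g hg g' hg' x hx y hy'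
    obtain ⟨t, ht, rfl⟩ := Finset.mem_image.1 hg
    obtain ⟨t', ht', rfl⟩ := Finset.mem_image.1 hg'
    obtain ⟨x, hx', rfl⟩ := (RAM.mem_cone_image Φ t).1 hx
    clear hx
    have hx := hx'
    obtain ⟨y, hy'', rfl⟩ := (RAM.mem_cone_image Φ t').1 hy'
    clear hy'
    have hy' := hy''
    constructor
    · intro e
      rw [un1 t ht t' ht' x hx y hy' e]
    · intro e
      rw [un3 t ht t' ht' x hx y hy' e]

theorem span_singleton_ne_top_euc (m : ℕ) (hm : 1 < m + 1) (u : EuclideanSpace ℝ (Fin (m + 1))) :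
    Submodule.span ℝ {u} ≠ ⊤ := by
  intro h
  have h1 := finrank_span_le_card (R := ℝ) ({u} : Set (EuclideanSpace ℝ (Fin (m + 1))))
  rw [h, finrank_top, finrank_euclideanSpace_fin] at h1
  simp only [Set.toFinset_singleton, Finset.card_singleton] at h1
  omega

open Classical in
theorem main_result
    {V : Type} [Fintype V] [DecidableEq V] (L : SCplx V) (k : ℕ)
    (hflag : IsFlag L) (hdim : IsDimOf L k) (h : k + 2 < embdim (oct L)) :
    actdim (RAAG L) ≤ ((embdim (oct L) + 1 : ℕ) : ℕ∞) := by
  have hne : {m | PLEmbedsInSphere (oct L) m}.Nonempty :=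
    Nat.nonempty_of_pos_sInf (show 0 < embdim (oct L) by omega)
  have hemb : PLEmbedsInSphere (oct L) (embdim (oct L)) := Nat.sInf_mem hne
  have hb := PH_base L k _ hflag hdim h hemb
  have he := RAM.PH_empty _ _ (span_singleton_ne_top_euc _ (by omega)) _ (by
    intro s hs t hadj
    refine (Finset.mem_filter.1 hs).2 (L.down_closed hadj.2 ?_ (Finset.singleton_nonempty _))
    simp) hb
  obtain ⟨D⟩ := RAM.exists_KData_of_PH _ _ he
  exact actdim_le_of_KData L _ D


theorem actdim_RAAG_le_embdim_oct_add_one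
    {V : Type} [Fintype V] [DecidableEq V] (L : SCplx V) (k : ℕ)
    (hflag : IsFlag L) (hdim : IsDimOf L k) (h : k + 2 < embdim (oct L)) :
    actdim (RAAG L) ≤ ((embdim (oct L) + 1 : ℕ) : ℕ∞) := by
  exact main_result L k hflag hdim h
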